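/- arXiv:0805.4682 — 3 statements merged into one kernel-verified Lean document; each statement's English description precedes it below -/
import Mathlib

section
/- Let f = (f_1,…,f_m) be a primitive family whose singular series S(f) exists and is nonzero, and let k ≥ 1 be an integer. Then for every k-tuple h of positive integers such that f∘h is primitive, the singular series S(f∘h) exists, and lim_{h→∞} h^{−k} · Σ* S(f∘h) = S(f)^k, where the sum Σ* runs over all k-tuples h = (h_1,…,h_k) with 1 ≤ h_i ≤ h such that f∘h is primitive. -/
open Filter Topology

/-- A primitive family: a (nonempty) family of pairwise distinct polynomials in `ℤ[X]`
of degree `≥ 1`, each irreducible, with positive leading coefficient and content `1`. -/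
def IsPrimitiveFamily {ι : Type*} [Fintype ι] (f : ι → Polynomial ℤ) : Prop :=
  Nonempty ι ∧ Function.Injective f ∧
    ∀ j, Irreducible (f j) ∧ 1 ≤ (f j).natDegree ∧ 0 < (f j).leadingCoeff ∧
      (f j).content = 1

/-- The family `f∘h = (f_j(X + h_i))_{j,i}` of `m·k` polynomials. -/
noncomputable def shiftFamily {m k : ℕ} (f : Fin m → Polynomial ℤ) (h : Fin k → ℕ) :
    Fin m × Fin k → Polynomial ℤ :=
  fun ji => (f ji.1).comp (Polynomial.X + Polynomial.C (h ji.2 : ℤ))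

/-- `ν_p(g)`: the number of `x ∈ ℤ/pℤ` with `g_j(x) = 0` for some `j`. -/
noncomputable def nuPoly {ι : Type*} [Fintype ι] (g : ι → Polynomial ℤ) (p : ℕ) : ℕ :=
  {x : ZMod p | ∃ j, Polynomial.aeval x (g j) = 0}.ncard

/-- The partial product `∏_{p ≤ y} (1 - ν_p(g)/p)(1 - 1/p)^(-M)` of the singular
series of the family `g` (with `M` members). -/
noncomputable def partialSS {ι : Type*} [Fintype ι] (g : ι → Polynomial ℤ) (y : ℕ) : ℝ :=
  ∏ p ∈ (Finset.range (y + 1)).filter Nat.Prime,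
    (1 - (nuPoly g p : ℝ) / p) * (1 - 1 / (p : ℝ)) ^ (-(Fintype.card ι : ℤ))

open Polynomial in
/-- A nonconstant integer polynomial determines the shift that produced it. -/
lemma eq_of_comp_X_add_C_eq {f : ℤ[X]} (hf : 1 ≤ f.natDegree) {a b : ℤ}
    (h : f.comp (X + C a) = f.comp (X + C b)) : a = b := by
  by_contra hab
  have hev (x : ℤ) : f.eval (x + a) = f.eval (x + b) := by
    simpa using congrArg (eval x) h
  have hper (n : ℕ) : f.eval (n * (a - b)) = f.eval 0 := by
    induction n with
    | zero => simp
    | succ n ih =>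
      rw [← ih]
      have := hev (n * (a - b) - b)
      rw [sub_add_cancel] at this
      rw [← this]
      congr 1
      push_cast
      ring
  have hinf : Set.Infinite {x | eval x f = eval x (C (f.eval 0))} := by
    refine (Set.infinite_range_of_injective (f := fun n : ℕ => (n : ℤ) * (a - b)) ?_).mono ?_
    · intro n n' hn
      simpa [sub_ne_zero.mpr hab] using hn
    · rintro _ ⟨n, rfl⟩
      simpa using hper n
  have := eq_of_infinite_eval_eq _ _ hinf
  rw [this, natDegree_C] at hf
  omega

open Polynomial in
/-- Distinct irreducible primitive integer polynomials with positive leading coefficients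
have nonzero resultant. -/
lemma resultant_ne_zero_of_irreducible {F G : ℤ[X]} (hF : Irreducible F) (hG : Irreducible G)
    (hFp : F.IsPrimitive) (hFl : 0 < F.leadingCoeff)
    (hGl : 0 < G.leadingCoeff) (hne : F ≠ G) : F.resultant G ≠ 0 := by
  have hco : IsCoprime (F.map (Int.castRingHom ℚ)) (G.map (Int.castRingHom ℚ)) := by
    rw [((IsPrimitive.Int.irreducible_iff_irreducible_map_cast hFp).mp hF).coprime_iff_not_dvd,
      ← IsPrimitive.Int.dvd_iff_map_cast_dvd_map_cast _ _ hFp]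
    intro hdvd
    obtain ⟨u, hu⟩ := hF.associated_of_dvd hG hdvd
    obtain ⟨c, hc, hcu⟩ := Polynomial.isUnit_iff.mp u.isUnit
    rw [← hcu] at hu
    rcases Int.isUnit_iff.mp hc with rfl | rfl
    · exact hne (by simpa using hu)
    · have := congrArg leadingCoeff hu
      simp at this
      omega
  have := Polynomial.resultant_ne_zero _ _ hco
  have hinj : Function.Injective (Int.castRingHom ℚ) := Int.cast_injective
  rw [natDegree_map_eq_of_injective hinj, natDegree_map_eq_of_injective hinj,
    resultant_map_map] at this
  exact fun h => this (by rw [h]; simp)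

open Polynomial in
/-- The resultant of `f(X + a)` and `g(X)`, as a polynomial in the shift `a`. -/
noncomputable def shiftResultant (f g : ℤ[X]) : ℤ[X] :=
  resultant ((f.map C).comp (X + C X)) (g.map C) f.natDegree g.natDegree

open Polynomial in
lemma eval_shiftResultant (f g : ℤ[X]) (a : ℤ) :
    (shiftResultant f g).eval a = (f.comp (X + C a)).resultant g := by
  rw [← coe_evalRingHom, shiftResultant, ← resultant_map_map]
  have h : (evalRingHom a).comp (C : ℤ →+* ℤ[X]) = RingHom.id ℤ := by ext; simp
  rw [Polynomial.map_comp, Polynomial.map_map, Polynomial.map_map, h]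
  have hd : (f.comp (X + C a)).natDegree = f.natDegree := by
    rw [natDegree_comp, natDegree_X_add_C, mul_one]
  rw [hd, Polynomial.map_id, Polynomial.map_id, Polynomial.map_add, map_X, map_C,
    coe_evalRingHom, eval_X]

open Polynomial in
lemma dvd_eval_shiftResultant {f g : ℤ[X]} (hg : 1 ≤ g.natDegree) {a : ℤ} {p : ℕ} {x : ZMod p}
    (hfx : aeval (x + a) f = 0) (hgx : aeval x g = 0) :
    (p : ℤ) ∣ (shiftResultant f g).eval a := by
  obtain ⟨u, v, -, -, huv⟩ := exists_mul_add_mul_eq_C_resultant (f.comp (X + C a)) g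
    (m := (f.comp (X + C a)).natDegree) (n := g.natDegree) le_rfl le_rfl (by omega)
  rw [eval_shiftResultant, ← ZMod.intCast_zmod_eq_zero_iff_dvd]
  have := congrArg (aeval x) huv
  simpa [aeval_comp, hfx, hgx] using this.symm

open Polynomial in
lemma abs_eval_le (F : ℤ[X]) {a H : ℤ} (ha : |a| ≤ H) (hH : 1 ≤ H) :
    |F.eval a| ≤ (∑ n ∈ Finset.range (F.natDegree + 1), |F.coeff n|) * H ^ F.natDegree := by
  rw [eval_eq_sum_range, Finset.sum_mul]
  refine (Finset.abs_sum_le_sum_abs _ _).trans (Finset.sum_le_sum fun n hn => ?_)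
  rw [abs_mul, abs_pow]
  refine mul_le_mul_of_nonneg_left ?_ (abs_nonneg _)
  exact (pow_le_pow_left₀ (abs_nonneg a) ha n).trans
    (pow_le_pow_right₀ hH (by simpa [Nat.lt_succ_iff] using hn))

section Family

variable {m k : ℕ} {f : Fin m → Polynomial ℤ}

/-- The residues modulo `p` at which some member of the family vanishes. -/
def zeroSet (f : Fin m → Polynomial ℤ) (p : ℕ) : Set (ZMod p) :=
  {x | ∃ j, Polynomial.aeval x (f j) = 0}

lemma nuPoly_eq_ncard (f : Fin m → Polynomial ℤ) (p : ℕ) : nuPoly f p = (zeroSet f p).ncard := rfl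

lemma nuPoly_shiftFamily (f : Fin m → Polynomial ℤ) (h : Fin k → ℕ) (p : ℕ) :
    nuPoly (shiftFamily f h) p = {x : ZMod p | ∃ i, x + h i ∈ zeroSet f p}.ncard := by
  unfold nuPoly
  congr 1
  ext x
  simp only [shiftFamily, zeroSet, Set.mem_ofPred_eq, Prod.exists, Polynomial.aeval_comp]
  rw [exists_comm]
  simp

lemma setOf_exists_add_mem_zeroSet (f : Fin m → Polynomial ℤ) (h : Fin k → ℕ) (p : ℕ) :
    {x : ZMod p | ∃ i, x + h i ∈ zeroSet f p} =
      ⋃ i, (fun x : ZMod p => x + h i) ⁻¹' zeroSet f p := by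
  ext; simp

lemma ncard_preimage_add_right {p : ℕ} (S : Set (ZMod p)) (a : ZMod p) :
    ((fun x : ZMod p => x + a) ⁻¹' S).ncard = S.ncard :=
  Set.ncard_preimage_of_injective_subset_range (add_left_injective a)
    (by rw [(add_right_surjective a).range_eq]; exact Set.subset_univ _)

lemma nuPoly_shiftFamily_le (f : Fin m → Polynomial ℤ) (h : Fin k → ℕ) (p : ℕ) [NeZero p] :
    nuPoly (shiftFamily f h) p ≤ k * nuPoly f p := by
  rw [nuPoly_shiftFamily, setOf_exists_add_mem_zeroSet, nuPoly_eq_ncard]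
  refine (Set.ncard_iUnion_le_of_fintype _).trans ?_
  simp [ncard_preimage_add_right]

lemma nuPoly_shiftFamily_eq {h : Fin k → ℕ} {p : ℕ} [NeZero p]
    (hd : ∀ i i', i ≠ i' → ∀ x : ZMod p, x + h i ∈ zeroSet f p → x + h i' ∉ zeroSet f p) :
    nuPoly (shiftFamily f h) p = k * nuPoly f p := by
  rw [nuPoly_shiftFamily, setOf_exists_add_mem_zeroSet, nuPoly_eq_ncard,
    Set.ncard_iUnion_of_finite]
  · simp [ncard_preimage_add_right, finsum_eq_sum_of_fintype]
  · exact fun i => Set.toFinite _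
  · intro i i' hii
    exact Set.disjoint_left.mpr fun x hx hx' => hd i i' hii x hx hx'

lemma shiftFamily_member (hf : IsPrimitiveFamily f) (j : Fin m) (a : ℤ) :
    Irreducible ((f j).comp (Polynomial.X + Polynomial.C a)) ∧
      1 ≤ ((f j).comp (Polynomial.X + Polynomial.C a)).natDegree ∧
      0 < ((f j).comp (Polynomial.X + Polynomial.C a)).leadingCoeff ∧
      ((f j).comp (Polynomial.X + Polynomial.C a)).content = 1 := by
  obtain ⟨hirr, hdeg, hlc, -⟩ := hf.2.2 j
  have hirr' : Irreducible ((f j).comp (Polynomial.X + Polynomial.C a)) := by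
    have := (MulEquiv.irreducible_iff (Polynomial.taylorEquiv a)).mpr hirr
    exact this
  have hdeg' : ((f j).comp (Polynomial.X + Polynomial.C a)).natDegree = (f j).natDegree := by
    rw [Polynomial.natDegree_comp, Polynomial.natDegree_X_add_C, mul_one]
  refine ⟨hirr', by omega, ?_, ?_⟩
  · rw [Polynomial.leadingCoeff_comp (by rw [Polynomial.natDegree_X_add_C]; exact one_ne_zero),
      Polynomial.leadingCoeff_X_add_C, one_pow, mul_one]
    exact hlc
  · exact (hirr'.isPrimitive (by omega)).content_eq_one

lemma shiftFamily_injective_iff (hf : IsPrimitiveFamily f) (hk : 1 ≤ k) (h : Fin k → ℕ) :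
    IsPrimitiveFamily (shiftFamily f h) ↔ Function.Injective (shiftFamily f h) := by
  refine ⟨fun h => h.2.1, fun hi => ⟨?_, hi, fun j => ?_⟩⟩
  · have := hf.1
    have : Nonempty (Fin k) := ⟨⟨0, hk⟩⟩
    infer_instance
  · exact shiftFamily_member hf j.1 _

open Polynomial in
lemma comp_eq_of_eq_comp_sub {F G : ℤ[X]} {a b : ℤ} (h : F.comp (X + C (a - b)) = G) :
    F.comp (X + C a) = G.comp (X + C b) := by
  rw [← h, comp_assoc]
  congr 1
  simp only [C_sub, add_comp, X_comp, sub_comp, C_comp]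
  ring

open Polynomial in
/-- Outside the prime divisors of a nonzero integer of polynomial size, the translates of the
zero set are disjoint. -/
lemma exists_bad_modulus (hf : IsPrimitiveFamily f) (k : ℕ) :
    ∃ A B : ℕ, ∀ H : ℕ, 1 ≤ H → ∀ h : Fin k → ℕ, IsPrimitiveFamily (shiftFamily f h) →
      (∀ i, h i ≤ H) → ∃ Δ : ℕ, Δ ≠ 0 ∧ Δ ≤ A * H ^ B ∧
        ∀ p : ℕ, p.Prime → ¬ p ∣ Δ → nuPoly (shiftFamily f h) p = k * nuPoly f p := by
  set F : ℤ[X] := ∏ j, ∏ j', shiftResultant (f j) (f j') with hF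
  set S := ∑ n ∈ Finset.range (F.natDegree + 1), |F.coeff n| with hS
  set t := (Finset.univ : Finset (Fin k)).offDiag.card with ht
  refine ⟨S.natAbs ^ t, F.natDegree * t, fun H hH h hprim hle => ?_⟩
  refine ⟨∏ q ∈ (Finset.univ : Finset (Fin k)).offDiag,
    (F.eval ((h q.1 : ℤ) - h q.2)).natAbs, ?_, ?_, ?_⟩
  · refine Finset.prod_ne_zero_iff.mpr fun q hq => Int.natAbs_ne_zero.mpr ?_
    simp only [Finset.mem_offDiag, Finset.mem_univ, true_and] at hq
    rw [hF, eval_prod]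
    refine Finset.prod_ne_zero_iff.mpr fun j _ => ?_
    rw [eval_prod]
    refine Finset.prod_ne_zero_iff.mpr fun j' _ => ?_
    rw [eval_shiftResultant]
    obtain ⟨h1, h2, h3, h4⟩ := shiftFamily_member hf j ((h q.1 : ℤ) - h q.2)
    obtain ⟨g1, g2, g3, g4⟩ := hf.2.2 j'
    refine resultant_ne_zero_of_irreducible h1 g1 (isPrimitive_iff_content_eq_one.mpr h4)
      h3 g3 fun heq => ?_
    have := hprim.2.1 (a₁ := (j, q.1)) (a₂ := (j', q.2)) (comp_eq_of_eq_comp_sub heq)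
    exact hq (congrArg Prod.snd this)
  · calc _ ≤ ∏ q ∈ (Finset.univ : Finset (Fin k)).offDiag, (S.natAbs * H ^ F.natDegree) := by
          refine Finset.prod_le_prod' fun q _ => ?_
          have h1 := hle q.1
          have h2 := hle q.2
          have := abs_eval_le F (a := (h q.1 : ℤ) - h q.2) (H := H)
            (by rw [abs_le]; constructor <;> omega) (by omega)
          zify
          exact this.trans (mul_le_mul_of_nonneg_right (le_abs_self S) (by positivity))
      _ = _ := by rw [Finset.prod_const, mul_pow, pow_mul]
  · intro p hp hpd
    have : NeZero p := ⟨hp.ne_zero⟩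
    refine nuPoly_shiftFamily_eq fun i i' hii x hx hx' => hpd ?_
    obtain ⟨j, hj⟩ := hx
    obtain ⟨j', hj'⟩ := hx'
    have hdvd := dvd_eval_shiftResultant (f := f j) (g := f j') (a := (h i : ℤ) - h i') (p := p)
      (x := x + h i') (hf.2.2 j').2.1 (by
        have : x + (h i' : ZMod p) + (((h i : ℤ) - h i' : ℤ) : ZMod p) = x + h i := by
          push_cast
          ring
        rw [this]
        exact hj) hj'
    refine dvd_trans ?_ (Finset.dvd_prod_of_mem
      (fun q : Fin k × Fin k => (F.eval ((h q.1 : ℤ) - h q.2)).natAbs)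
      (show (i, i') ∈ (Finset.univ : Finset (Fin k)).offDiag from
        Finset.mem_offDiag.mpr ⟨Finset.mem_univ _, Finset.mem_univ _, hii⟩))
    rw [← Int.natCast_dvd]
    refine hdvd.trans ?_
    rw [← coe_evalRingHom]
    refine map_dvd _ ?_
    exact (Finset.dvd_prod_of_mem (fun j' => shiftResultant (f j) (f j'))
      (Finset.mem_univ j')).trans
      (Finset.dvd_prod_of_mem (fun j => ∏ j', shiftResultant (f j) (f j')) (Finset.mem_univ j))

end Family

section Sieve

open Classical in
/-- Chinese remainder theorem as a count of integers avoiding residue classes modulo each prime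
of a finite set. -/
lemma card_filter_range_prod (s : Finset ℕ) (hs : ∀ p ∈ s, p.Prime) (B : ∀ p, Set (ZMod p)) :
    (((Finset.range (∏ p ∈ s, p)).filter fun n : ℕ => ∀ p ∈ s, (n : ZMod p) ∉ B p).card : ℝ) =
      (∏ p ∈ s, (p : ℝ)) * ∏ p ∈ s, (1 - ((B p).ncard : ℝ) / p) := by
  have hne (p : s) : NeZero (p : ℕ) := ⟨(hs p p.2).ne_zero⟩
  have hco : Pairwise (Function.onFun Nat.Coprime fun p : s => (p : ℕ)) := fun p q hpq =>
    (Nat.coprime_primes (hs p p.2) (hs q q.2)).mpr (Subtype.coe_injective.ne hpq)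
  have hP : ∏ p ∈ s, p = ∏ p : s, (p : ℕ) := (Finset.prod_coe_sort s (fun p => p)).symm
  have hP0 : NeZero (∏ p : s, (p : ℕ)) := ⟨Finset.prod_ne_zero_iff.mpr fun p _ => (hne p).ne⟩
  let e := ZMod.prodEquivPi (fun p : s => (p : ℕ)) hco
  have he (n : ℕ) (p : s) : e n p = (n : ZMod p) := by
    rw [map_natCast]
    rfl
  have hcard : ((Finset.range (∏ p ∈ s, p)).filter
      fun n : ℕ => ∀ p ∈ s, (n : ZMod p) ∉ B p).card =
      (Fintype.piFinset fun p : s => Finset.univ.filter fun x : ZMod p => x ∉ B p).card := by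
    refine Finset.card_nbij (fun n (p : s) => (n : ZMod p)) ?_ ?_ ?_
    · intro n hn
      simp only [Finset.mem_coe, Finset.mem_filter] at hn
      simpa using fun p hp => hn.2 p hp
    · intro n hn n' hn' hnn
      simp only [Finset.coe_filter, Finset.mem_range, Set.mem_ofPred_eq, hP] at hn hn'
      have h1 : e n = e n' := by
        funext p
        rw [he, he]
        exact congrFun hnn p
      have h2 := e.injective h1
      rw [ZMod.natCast_eq_natCast_iff'] at h2
      rwa [Nat.mod_eq_of_lt hn.1, Nat.mod_eq_of_lt hn'.1] at h2
    · intro y hy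
      have hval : e ((e.symm y).val : ℕ) = y := by
        rw [ZMod.natCast_zmod_val, e.apply_symm_apply]
      refine ⟨(e.symm y).val, ?_, ?_⟩
      · simp only [Finset.coe_filter, Finset.mem_range, Set.mem_ofPred_eq, hP]
        refine ⟨ZMod.val_lt _, fun p hp => ?_⟩
        have := he (e.symm y).val ⟨p, hp⟩
        rw [hval] at this
        simp only [← this]
        simp only [Finset.mem_coe, Fintype.mem_piFinset, Finset.mem_filter] at hy
        exact (hy ⟨p, hp⟩).2
      · funext p
        simp only [← he]
        rw [hval]
  rw [hcard, Fintype.card_piFinset, Nat.cast_prod, ← Finset.prod_mul_distrib,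
    ← Finset.prod_coe_sort s]
  refine Finset.prod_congr rfl fun p _ => ?_
  have hp0 : ((p : ℕ) : ℝ) ≠ 0 := by exact_mod_cast (hne p).ne
  have h1 : (Finset.univ.filter fun x : ZMod p => x ∉ B p).card + (B p).ncard = p := by
    refine Eq.trans ?_ (ZMod.card p)
    rw [Set.ncard_eq_toFinset_card', ← Finset.card_add_card_compl (B p).toFinset, add_comm]
    congr 2
    ext x
    simp
  have h2 : ((Finset.univ.filter fun x : ZMod p => x ∉ B p).card : ℝ) + (B p).ncard = p := by
    exact_mod_cast h1
  field_simp
  linarith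

/-- A full block of `q` periods of a periodic predicate contains `q` times the count of one
period. -/
lemma card_filter_Ico_mul_period {g : ℕ → Prop} [DecidablePred g] {P : ℕ}
    (hg : Function.Periodic g P) (a q : ℕ) :
    ((Finset.Ico a (a + q * P)).filter g).card = q * P.count g := by
  induction q with
  | zero => simp
  | succ q ih =>
    rw [← Finset.Ico_union_Ico_eq_Ico (b := a + q * P) (by omega)
      (by rw [add_mul]; omega), Finset.filter_union, Finset.card_union_of_disjoint, ih,
      show a + (q + 1) * P = a + q * P + P by ring, Nat.filter_Ico_card_eq_of_periodic _ _ _ hg]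
    · ring
    · exact Finset.disjoint_filter_filter (Finset.Ico_disjoint_Ico_consecutive _ _ _)

/-- The count of a periodic predicate on an interval, up to one period. -/
lemma card_filter_Icc_bounds {g : ℕ → Prop} [DecidablePred g] {P : ℕ} (hP : 0 < P)
    (hg : Function.Periodic g P) (x H : ℕ) :
    ((H : ℝ) - P) * (P.count g / P) ≤ (((Finset.Icc 1 H).filter fun n => g (x + n)).card : ℝ) ∧
      (((Finset.Icc 1 H).filter fun n => g (x + n)).card : ℝ) ≤ (H + P) * (P.count g / P) := by
  have hPR : (0 : ℝ) < P := by exact_mod_cast hP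
  have hN : ((Finset.Icc 1 H).filter fun n => g (x + n)).card =
      ((Finset.Ico (x + 1) (x + 1 + H)).filter g).card := by
    refine Finset.card_nbij (fun n => x + n) ?_ ?_ ?_
    · intro n hn
      simp only [Finset.mem_coe, Finset.mem_filter, Finset.mem_Icc, Finset.mem_Ico] at hn ⊢
      exact ⟨by omega, hn.2⟩
    · intro n _ n' _ h
      simpa using h
    · intro n hn
      simp only [Finset.coe_filter, Finset.mem_Ico, Set.mem_ofPred_eq] at hn
      refine ⟨n - x, ?_, by simp only; omega⟩
      simp only [Finset.coe_filter, Finset.mem_Icc, Set.mem_ofPred_eq]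
      rw [Nat.add_sub_cancel' (by omega)]
      exact ⟨by omega, hn.2⟩
  have hdiv := Nat.div_add_mod H P
  have hmod := Nat.mod_lt H hP
  have hlo : (H / P) * P ≤ H := Nat.div_mul_le_self H P
  have hhi : H ≤ (H / P + 1) * P := by rw [add_mul, mul_comm]; omega
  rw [hN]
  constructor
  · have h1 : (H / P) * P.count g ≤ ((Finset.Ico (x + 1) (x + 1 + H)).filter g).card := by
      rw [← card_filter_Ico_mul_period hg (x + 1)]
      exact Finset.card_le_card (Finset.filter_subset_filter _
        (Finset.Ico_subset_Ico_right (by omega)))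
    have h2 : ((H : ℝ) - P) / P ≤ (H / P : ℕ) := by
      rw [div_le_iff₀ hPR, sub_le_iff_le_add]
      have : (H : ℝ) ≤ ((H / P + 1) * P : ℕ) := by exact_mod_cast hhi
      push_cast at this ⊢
      linarith
    calc ((H : ℝ) - P) * (P.count g / P) = ((H : ℝ) - P) / P * P.count g := by ring
      _ ≤ (H / P : ℕ) * P.count g := by gcongr
      _ ≤ _ := by exact_mod_cast h1
  · have h1 : ((Finset.Ico (x + 1) (x + 1 + H)).filter g).card ≤ (H / P + 1) * P.count g := by
      rw [← card_filter_Ico_mul_period hg (x + 1)]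
      exact Finset.card_le_card (Finset.filter_subset_filter _
        (Finset.Ico_subset_Ico_right (by omega)))
    have h2 : ((H / P + 1 : ℕ) : ℝ) ≤ (H + P) / P := by
      rw [le_div_iff₀ hPR]
      have : ((H / P * P : ℕ) : ℝ) ≤ H := by exact_mod_cast hlo
      push_cast at this ⊢
      linarith
    calc (((Finset.Ico (x + 1) (x + 1 + H)).filter g).card : ℝ)
        ≤ ((H / P + 1) * P.count g : ℕ) := by exact_mod_cast h1
      _ = ((H / P + 1 : ℕ) : ℝ) * P.count g := Nat.cast_mul _ _
      _ ≤ (H + P) / P * P.count g := by gcongr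
      _ = _ := by ring

open Classical in
/-- Averaging the local densities of a union of translates over a box. -/
lemma sum_prod_density_bounds (s : Finset ℕ) (hs : ∀ p ∈ s, p.Prime) (Z : ∀ p, Set (ZMod p))
    (k H : ℕ) (hH : ∏ p ∈ s, p ≤ H) :
    (((H : ℝ) - (∏ p ∈ s, p : ℕ)) * ∏ p ∈ s, (1 - ((Z p).ncard : ℝ) / p)) ^ k ≤
        ∑ h ∈ Fintype.piFinset fun _ : Fin k => Finset.Icc 1 H,
          ∏ p ∈ s, (1 - ({x : ZMod p | ∃ i, x + h i ∈ Z p}.ncard : ℝ) / p) ∧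
      ∑ h ∈ Fintype.piFinset fun _ : Fin k => Finset.Icc 1 H,
          ∏ p ∈ s, (1 - ({x : ZMod p | ∃ i, x + h i ∈ Z p}.ncard : ℝ) / p) ≤
        (((H : ℝ) + (∏ p ∈ s, p : ℕ)) * ∏ p ∈ s, (1 - ((Z p).ncard : ℝ) / p)) ^ k := by
  set P := ∏ p ∈ s, p with hPdef
  have hP : 0 < P := Finset.prod_pos fun p hp => (hs p hp).pos
  have hPR : (0 : ℝ) < P := by exact_mod_cast hP
  have hPc : ∏ p ∈ s, (p : ℝ) = P := by rw [hPdef]; push_cast; rfl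
  let g : ℕ → Prop := fun n => ∀ p ∈ s, (n : ZMod p) ∉ Z p
  have hper : Function.Periodic g P := by
    intro n
    refine propext (forall₂_congr fun p hp => ?_)
    have : (P : ZMod p) = 0 := (ZMod.natCast_eq_zero_iff _ _).mpr (Finset.dvd_prod_of_mem _ hp)
    simp [this]
  have hdens : (P.count g : ℝ) / P = ∏ p ∈ s, (1 - ((Z p).ncard : ℝ) / p) := by
    rw [Nat.count_eq_card_filter_range, div_eq_iff hPR.ne', mul_comm]
    have := card_filter_range_prod s hs Z
    rw [hPc] at this
    exact this
  have hsum : ∑ h ∈ Fintype.piFinset fun _ : Fin k => Finset.Icc 1 H,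
      ∏ p ∈ s, (1 - ({x : ZMod p | ∃ i, x + h i ∈ Z p}.ncard : ℝ) / p) =
      (∑ x ∈ Finset.range P, (((Finset.Icc 1 H).filter fun n => g (x + n)).card : ℝ) ^ k) / P := by
    rw [eq_div_iff hPR.ne', Finset.sum_mul]
    have hterm (h : Fin k → ℕ) :
        (∏ p ∈ s, (1 - ({x : ZMod p | ∃ i, x + h i ∈ Z p}.ncard : ℝ) / p)) * P =
          ∑ x ∈ Finset.range P, ∏ i, if g (x + h i) then (1 : ℝ) else 0 := by
      have := card_filter_range_prod s hs fun p => {x : ZMod p | ∃ i, x + h i ∈ Z p}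
      rw [hPc, mul_comm] at this
      rw [← this, Finset.card_filter, Nat.cast_sum]
      refine Finset.sum_congr rfl fun x _ => ?_
      rw [Finset.prod_ite_zero]
      simp only [Finset.prod_const_one, Nat.cast_ite, Nat.cast_one, Nat.cast_zero]
      refine if_congr ?_ rfl rfl
      simp only [Set.mem_ofPred_eq, not_exists, g, Finset.mem_univ, true_imp_iff, Nat.cast_add]
      exact ⟨fun h i p hp => h p hp i, fun h p hp i => h i p hp⟩
    simp only [hterm]
    rw [Finset.sum_comm]
    refine Finset.sum_congr rfl fun x _ => ?_
    rw [Finset.sum_prod_piFinset (Finset.Icc 1 H)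
      (fun (_ : Fin k) n => if g (x + n) then (1 : ℝ) else 0)]
    rw [Finset.sum_boole, Finset.prod_const, Finset.card_univ, Fintype.card_fin]
  rw [hsum, ← hdens]
  have hHP : (0 : ℝ) ≤ H - P := by rw [sub_nonneg]; exact_mod_cast hH
  constructor
  · rw [le_div_iff₀ hPR, mul_comm]
    calc (P : ℝ) * (((H : ℝ) - P) * (P.count g / P)) ^ k
        = ∑ x ∈ Finset.range P, (((H : ℝ) - P) * (P.count g / P)) ^ k := by simp
      _ ≤ _ := Finset.sum_le_sum fun x _ =>
        pow_le_pow_left₀ (by positivity) (card_filter_Icc_bounds hP hper x H).1 k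
  · rw [div_le_iff₀ hPR, mul_comm]
    calc _ ≤ ∑ x ∈ Finset.range P, (((H : ℝ) + P) * (P.count g / P)) ^ k :=
          Finset.sum_le_sum fun x _ =>
            pow_le_pow_left₀ (by positivity) (card_filter_Icc_bounds hP hper x H).2 k
      _ = _ := by simp

end Sieve

section Weights

variable {m k : ℕ} {f : Fin m → Polynomial ℤ}

open Classical in
/-- The tuples in a box whose translates do not form a primitive family are negligible. -/
lemma exists_card_not_primitive_le (hf : IsPrimitiveFamily f) (hk : 1 ≤ k) :
    ∃ K : ℕ, ∀ H : ℕ, ((Fintype.piFinset fun _ : Fin k => Finset.Icc 1 H).filter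
      fun h => ¬ IsPrimitiveFamily (shiftFamily f h)).card ≤ K * H ^ (k - 1) := by
  refine ⟨Fintype.card ((Fin m × Fin k) × (Fin m × Fin k)), fun H => ?_⟩
  let E (q : (Fin m × Fin k) × (Fin m × Fin k)) : Finset (Fin k → ℕ) :=
    (Fintype.piFinset fun _ : Fin k => Finset.Icc 1 H).filter
      fun h => q.1.2 ≠ q.2.2 ∧ shiftFamily f h q.1 = shiftFamily f h q.2
  have hE (q) : (E q).card ≤ H ^ (k - 1) := by
    have hcard : (Fintype.piFinset fun i : Fin k =>
        if i = q.1.2 then {0} else Finset.Icc 1 H).card = H ^ (k - 1) := by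
      rw [Fintype.card_piFinset, ← Finset.mul_prod_erase _ _ (Finset.mem_univ q.1.2)]
      rw [Finset.prod_congr rfl (g := fun _ => H)]
      · simp
      · intro i hi
        simp [Finset.ne_of_mem_erase hi]
    rw [← hcard]
    refine Finset.card_le_card_of_injOn (fun h => Function.update h q.1.2 0) ?_ ?_
    · intro h hh
      simp only [E, Finset.coe_filter, Fintype.mem_piFinset, Set.mem_ofPred_eq] at hh
      simp only [Finset.mem_coe, Fintype.mem_piFinset]
      intro i
      by_cases hi : i = q.1.2
      · subst hi
        simp
      · simpa [hi] using hh.1 i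
    · intro h hh h' hh' heq
      simp only [E, Finset.coe_filter, Fintype.mem_piFinset, Set.mem_ofPred_eq] at hh hh'
      have hoff (i : Fin k) (hi : i ≠ q.1.2) : h i = h' i := by
        simpa [hi] using congrFun heq i
      have hon : h q.1.2 = h' q.1.2 := by
        have h1 := hh.2.2
        have h2 := hh'.2.2
        simp only [shiftFamily] at h1 h2
        rw [hoff q.2.2 hh.2.1.symm, ← h2] at h1
        exact_mod_cast eq_of_comp_X_add_C_eq (hf.2.2 q.1.1).2.1 h1
      funext i
      by_cases hi : i = q.1.2
      · rw [hi, hon]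
      · exact hoff i hi
  refine le_trans (Finset.card_le_card ?_)
    (Finset.card_biUnion_le_card_mul Finset.univ E _ fun q _ => hE q)
  intro h hh
  simp only [Finset.mem_filter, shiftFamily_injective_iff hf hk] at hh
  obtain ⟨hbox, hnot⟩ := hh
  simp only [Function.Injective, not_forall] at hnot
  obtain ⟨a, b, hab, hne⟩ := hnot
  simp only [Finset.mem_biUnion, Finset.mem_univ, true_and]
  refine ⟨(a, b), ?_⟩
  simp only [E, Finset.mem_filter]
  refine ⟨hbox, fun hi => hne (Prod.ext (hf.2.1 ?_) hi), hab⟩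
  simp only [shiftFamily, hi] at hab
  have := congrArg
    (fun F => Polynomial.comp F (Polynomial.X - Polynomial.C (h b.2 : ℤ))) hab
  simpa [Polynomial.comp_assoc] using this

lemma nuPoly_le_sum_natDegree (hf : IsPrimitiveFamily f) {p : ℕ} (hp : p.Prime) :
    nuPoly f p ≤ ∑ j, (f j).natDegree := by
  have := Fact.mk hp
  have hset : zeroSet f p ⊆ ⋃ j, {x : ZMod p | Polynomial.aeval x (f j) = 0} := by
    rintro x ⟨j, hj⟩
    exact Set.mem_iUnion.mpr ⟨j, hj⟩
  rw [nuPoly_eq_ncard]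
  refine (Set.ncard_le_ncard hset).trans ((Set.ncard_iUnion_le_of_fintype _).trans ?_)
  refine Finset.sum_le_sum fun j _ => ?_
  have hne : (f j).map (Int.castRingHom (ZMod p)) ≠ 0 := by
    intro h0
    have hdvd : Polynomial.C (p : ℤ) ∣ f j := by
      rw [Polynomial.C_dvd_iff_dvd_coeff]
      intro n
      rw [← ZMod.intCast_zmod_eq_zero_iff_dvd]
      simpa using congrArg (Polynomial.coeff · n) h0
    have := (Polynomial.isPrimitive_iff_content_eq_one.mpr (hf.2.2 j).2.2.2) _ hdvd
    exact hp.one_lt.ne' (by simpa [Int.isUnit_iff_natAbs_eq] using this)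
  calc {x : ZMod p | Polynomial.aeval x (f j) = 0}.ncard
      ≤ (((f j).map (Int.castRingHom (ZMod p))).roots.toFinset : Set (ZMod p)).ncard := by
        refine Set.ncard_le_ncard (fun x hx => ?_)
        simp only [Finset.mem_coe, Multiset.mem_toFinset, Polynomial.mem_roots hne,
          Polynomial.IsRoot.def, Polynomial.eval_map]
        exact hx
    _ ≤ _ := by
        rw [Set.ncard_coe_finset]
        exact (Multiset.toFinset_card_le _).trans
          ((Polynomial.card_roots' _).trans Polynomial.natDegree_map_le)

/-- The local factor at `p` of the singular series of `f∘h` relative to that of `f`. -/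
noncomputable def shiftWeight (f : Fin m → Polynomial ℤ) (h : Fin k → ℕ) (p : ℕ) : ℝ :=
  (1 - (nuPoly (shiftFamily f h) p : ℝ) / p) / (1 - (nuPoly f p : ℝ) / p) ^ k

lemma partialSS_shiftFamily (h : Fin k → ℕ) (y : ℕ)
    (hpos : ∀ p : ℕ, p.Prime → nuPoly f p < p) :
    partialSS (shiftFamily f h) y =
      partialSS f y ^ k * ∏ p ∈ Nat.primesLE y, shiftWeight f h p := by
  unfold partialSS Nat.primesLE Nat.primesBelow
  rw [← Finset.prod_pow, ← Finset.prod_mul_distrib]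
  refine Finset.prod_congr rfl fun p hp => ?_
  have hp' := (Finset.mem_filter.mp hp).2
  have hp0 : (0 : ℝ) < p := by exact_mod_cast hp'.pos
  have h1 : (1 - (nuPoly f p : ℝ) / p) ≠ 0 := by
    have : (nuPoly f p : ℝ) < p := by exact_mod_cast hpos p hp'
    exact (sub_pos.mpr ((div_lt_one hp0).mpr this)).ne'
  rw [shiftWeight, mul_pow, ← zpow_natCast ((1 - 1 / (p : ℝ)) ^ (-(Fintype.card (Fin m) : ℤ))),
    ← zpow_mul, Fintype.card_prod, Fintype.card_fin, Fintype.card_fin, Nat.cast_mul, neg_mul]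
  have h2 := pow_ne_zero k h1
  generalize (1 - (nuPoly f p : ℝ) / p) ^ k = Y at h2 ⊢
  generalize (1 - 1 / (p : ℝ)) ^ (-((m : ℤ) * (k : ℤ))) = W
  field_simp

lemma nuPoly_lt_of_tendsto {Sf : ℝ} (hSf : Tendsto (partialSS f) atTop (𝓝 Sf)) (hSf0 : Sf ≠ 0)
    {p : ℕ} (hp : p.Prime) : nuPoly f p < p := by
  have : NeZero p := ⟨hp.ne_zero⟩
  have hle : nuPoly f p ≤ p := by
    have := Set.ncard_le_ncard (Set.subset_univ (zeroSet f p))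
    rwa [Set.ncard_univ, Nat.card_zmod] at this
  refine lt_of_le_of_ne hle fun heq => hSf0 (tendsto_nhds_unique hSf ?_)
  refine tendsto_const_nhds.congr' ?_
  filter_upwards [eventually_ge_atTop p] with y hy
  refine (Finset.prod_eq_zero (i := p) (by simp [hp]; omega) ?_).symm
  have : (p : ℝ) ≠ 0 := by exact_mod_cast hp.ne_zero
  simp [heq, this]

lemma one_sub_pow_bounds {q : ℝ} (h0 : 0 ≤ q) (h1 : q ≤ 1) (k : ℕ) :
    1 - k * q ≤ (1 - q) ^ k ∧ (1 - q) ^ k ≤ 1 - k * q + k ^ 2 * q ^ 2 := by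
  have hb (n : ℕ) : 1 - n * q ≤ (1 - q) ^ n := by
    have := one_add_mul_le_pow (a := -q) (by linarith) n
    rw [← sub_eq_add_neg] at this
    linarith
  refine ⟨hb k, ?_⟩
  induction k with
  | zero => simp
  | succ k ih =>
    have hk : (0 : ℝ) ≤ k := Nat.cast_nonneg k
    have h3 : (1 - q) ^ k * q ≥ (1 - k * q) * q := mul_le_mul_of_nonneg_right (hb k) h0
    rw [pow_succ]
    push_cast
    nlinarith [mul_nonneg hk (mul_nonneg h0 h0)]

/-- Uniform bounds for the relative local factors. -/
lemma exists_shiftWeight_bounds (hf : IsPrimitiveFamily f)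
    (hpos : ∀ p : ℕ, p.Prime → nuPoly f p < p) (k : ℕ) :
    ∃ C : ℝ, 1 ≤ C ∧ ∀ p : ℕ, p.Prime → ∀ h : Fin k → ℕ,
      0 ≤ shiftWeight f h p ∧ shiftWeight f h p ≤ C ∧ |shiftWeight f h p - 1| ≤ C / p ∧
        (nuPoly (shiftFamily f h) p = k * nuPoly f p →
          |shiftWeight f h p - 1| ≤ C / (p : ℝ) ^ 2) := by
  set D := ∑ j, (f j).natDegree
  set c : ℝ := 1 / (2 * D + 2) with hc
  have hD : (0 : ℝ) ≤ D := Nat.cast_nonneg D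
  have hc0 : 0 < c := by positivity
  have hc1 : c ≤ 1 := by
    rw [hc, div_le_one (by positivity)]
    linarith
  have hck : 0 < c ^ k := pow_pos hc0 k
  have hck1 : c ^ k ≤ 1 := pow_le_one₀ hc0.le hc1
  have hkR : (0 : ℝ) ≤ k := Nat.cast_nonneg k
  have hCnum : (1 : ℝ) ≤ k ^ 2 * D ^ 2 + k * D + 1 := by
    have : (0 : ℝ) ≤ k ^ 2 * D ^ 2 + k * D := by positivity
    linarith
  refine ⟨(k ^ 2 * D ^ 2 + k * D + 1) / c ^ k, ?_, fun p hp h => ?_⟩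
  · rw [le_div_iff₀ hck]
    linarith
  have : NeZero p := ⟨hp.ne_zero⟩
  have hp0 : (0 : ℝ) < p := by exact_mod_cast hp.pos
  set q : ℝ := (nuPoly f p : ℝ) / p with hq
  set r : ℝ := (nuPoly (shiftFamily f h) p : ℝ) / p with hr
  have hνD : (nuPoly f p : ℝ) ≤ D := by exact_mod_cast nuPoly_le_sum_natDegree hf hp
  have hν1 : (nuPoly f p : ℝ) + 1 ≤ p := by exact_mod_cast hpos p hp
  have hq0 : 0 ≤ q := by positivity
  have hqD : q ≤ D / p := by rw [hq]; gcongr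
  have hq1 : c ≤ 1 - q := by
    rw [le_sub_iff_add_le, ← le_sub_iff_add_le', hq, div_le_iff₀ hp0, sub_mul, one_mul,
      le_sub_comm, hc, one_div_mul_eq_div, div_le_iff₀ (by positivity)]
    nlinarith [mul_nonneg hD (sub_nonneg.mpr hν1), mul_nonneg hD (sub_nonneg.mpr hνD)]
  have hr0 : 0 ≤ r := by positivity
  have hr1 : r ≤ 1 := by
    rw [hr, div_le_one hp0]
    have : nuPoly (shiftFamily f h) p ≤ p := by
      rw [nuPoly_shiftFamily]
      have := Set.ncard_le_ncard (Set.subset_univ {x : ZMod p | ∃ i, x + h i ∈ zeroSet f p})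
      rwa [Set.ncard_univ, Nat.card_zmod] at this
    exact_mod_cast this
  have hrq : r ≤ k * q := by
    rw [hr, hq, ← mul_div_assoc]
    gcongr
    exact_mod_cast nuPoly_shiftFamily_le f h p
  have hcq : c ^ k ≤ (1 - q) ^ k := pow_le_pow_left₀ hc0.le hq1 k
  have hqk : 0 < (1 - q) ^ k := hck.trans_le hcq
  obtain ⟨hlo, hhi⟩ := one_sub_pow_bounds hq0 (by linarith) k
  have hqk1 : (1 - q) ^ k ≤ 1 := pow_le_one₀ (by linarith) (by linarith)
  have hw : shiftWeight f h p = (1 - r) / (1 - q) ^ k := rfl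
  have hw1 : shiftWeight f h p - 1 = (1 - r - (1 - q) ^ k) / (1 - q) ^ k := by
    rw [hw]
    field_simp
  have hkey {N : ℝ} (hN : |1 - r - (1 - q) ^ k| ≤ N) :
      |shiftWeight f h p - 1| ≤ N / c ^ k := by
    rw [hw1, abs_div, abs_of_pos hqk]
    exact div_le_div₀ ((abs_nonneg _).trans hN) hN hck hcq
  refine ⟨?_, ?_, ?_, fun heq => ?_⟩
  · rw [hw]
    exact div_nonneg (by linarith) hqk.le
  · rw [hw]
    exact div_le_div₀ (by linarith) (by linarith) hck hcq
  · refine (hkey (N := k * (D / p)) ?_).trans ?_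
    · have := mul_le_mul_of_nonneg_left hqD hkR
      rw [abs_le]
      constructor <;> linarith
    · rw [div_right_comm]
      gcongr
      rw [← mul_div_assoc]
      gcongr
      have : (0 : ℝ) ≤ k ^ 2 * D ^ 2 := by positivity
      linarith
  · have hreq : r = k * q := by
      rw [hr, hq, heq]
      push_cast
      ring
    refine (hkey (N := k ^ 2 * (D / p) ^ 2) ?_).trans ?_
    · have : (k : ℝ) ^ 2 * q ^ 2 ≤ k ^ 2 * (D / p) ^ 2 := by gcongr
      rw [abs_le]
      constructor <;> nlinarith [sq_nonneg ((k : ℝ) * q)]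
    · rw [div_right_comm, div_pow, ← mul_div_assoc]
      gcongr
      have : (0 : ℝ) ≤ k * D := by positivity
      linarith

end Weights

section Tail

/-- Few primes above `z` divide a given nonzero integer. -/
lemma card_mul_log_le_of_dvd {b : Finset ℕ} {z Δ : ℕ} (hz : 1 ≤ z) (hΔ : Δ ≠ 0)
    (hb : ∀ p ∈ b, p.Prime ∧ z < p ∧ p ∣ Δ) : b.card * Real.log z ≤ Real.log Δ := by
  have h1 : ∏ p ∈ b, p ≤ Δ := Nat.le_of_dvd (Nat.pos_of_ne_zero hΔ)
    (Finset.prod_primes_dvd Δ (fun p hp => (hb p hp).1.prime) fun p hp => (hb p hp).2.2)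
  have h2 : z ^ b.card ≤ ∏ p ∈ b, p := Finset.pow_card_le_prod _ _ _ fun p hp => (hb p hp).2.1.le
  rw [← Real.log_pow]
  refine Real.log_le_log (by positivity) ?_
  exact_mod_cast h2.trans h1

variable {w : ℕ → ℝ} {C : ℝ} {Δ : ℕ}

lemma sum_abs_sub_one_le (hC : 0 ≤ C) (hΔ : Δ ≠ 0)
    (h1 : ∀ p : ℕ, p.Prime → |w p - 1| ≤ C / p)
    (h2 : ∀ p : ℕ, p.Prime → ¬ p ∣ Δ → |w p - 1| ≤ C / (p : ℝ) ^ 2) {z y : ℕ} (hz : 2 ≤ z)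
    (hzy : z ≤ y) :
    ∑ p ∈ (Finset.Ioc z y).filter Nat.Prime, |w p - 1| ≤
      C * (1 / z + Real.log Δ / (z * Real.log z)) := by
  have hz0 : (0 : ℝ) < z := by positivity
  have hlog : 0 < Real.log z := Real.log_pos (by exact_mod_cast hz)
  set b := ((Finset.Ioc z y).filter Nat.Prime).filter (· ∣ Δ) with hb
  have hcard : (b.card : ℝ) ≤ Real.log Δ / Real.log z := by
    rw [le_div_iff₀ hlog]
    refine card_mul_log_le_of_dvd (by omega) hΔ fun p hp => ?_
    simp only [hb, Finset.mem_filter, Finset.mem_Ioc] at hp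
    exact ⟨hp.1.2, hp.1.1.1, hp.2⟩
  rw [← Finset.sum_filter_add_sum_filter_not _ (· ∣ Δ), mul_add, add_comm]
  gcongr
  · calc _ ≤ ∑ p ∈ ((Finset.Ioc z y).filter Nat.Prime).filter (¬ · ∣ Δ), C * ((p : ℝ) ^ 2)⁻¹ :=
          Finset.sum_le_sum fun p hp => by
            simp only [Finset.mem_filter] at hp
            simpa [div_eq_mul_inv] using h2 p hp.1.2 hp.2
      _ ≤ ∑ p ∈ Finset.Ioc z y, C * ((p : ℝ) ^ 2)⁻¹ := by
          refine Finset.sum_le_sum_of_subset_of_nonneg ?_ fun p _ _ => by positivity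
          exact (Finset.filter_subset _ _).trans (Finset.filter_subset _ _)
      _ ≤ C * (1 / z) := by
          rw [← Finset.mul_sum]
          gcongr
          refine (sum_Ioc_inv_sq_le_sub (by omega) hzy).trans ?_
          rw [one_div, sub_le_self_iff]
          positivity
  · calc _ ≤ ∑ p ∈ b, C / z := Finset.sum_le_sum fun p hp => by
            simp only [hb, Finset.mem_filter, Finset.mem_Ioc] at hp
            refine (h1 p hp.1.2).trans ?_
            have : (z : ℝ) ≤ p := by exact_mod_cast hp.1.1.1.le
            gcongr
      _ = b.card * (C / z) := by simp
      _ ≤ Real.log Δ / Real.log z * (C / z) := by gcongr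
      _ = _ := by
        field_simp

/-- Convergence of an Euler product whose factors are `1 + O(1/p²)` away from finitely many
primes. -/
lemma exists_tendsto_prod_primesLE
    (h2 : ∀ p : ℕ, p.Prime → ¬ p ∣ Δ → |w p - 1| ≤ C / (p : ℝ) ^ 2) (hΔ : Δ ≠ 0) (hC : 0 ≤ C) :
    ∃ t, Tendsto (fun y => ∏ p ∈ Nat.primesLE y, w p) atTop (𝓝 t) := by
  have hsum : Summable fun n : ℕ => (if n.Prime then w n else 1) - 1 := by
    refine Summable.of_norm_bounded_eventually_nat
      ((Real.summable_nat_pow_inv.mpr one_lt_two).mul_left C) ?_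
    filter_upwards [eventually_gt_atTop Δ] with n hn
    split_ifs with hp
    · simpa [div_eq_mul_inv] using
        h2 n hp fun hd => (Nat.le_of_dvd (Nat.pos_of_ne_zero hΔ) hd).not_gt hn
    · simp only [sub_self, norm_zero]
      positivity
  obtain ⟨t, ht⟩ := Real.multipliable_one_add_of_summable hsum
  refine ⟨t, ?_⟩
  have := (tendsto_add_atTop_iff_nat 1).mpr ht.tendsto_prod_nat
  simpa [Nat.primesLE, Nat.primesBelow, Finset.prod_filter] using this

/-- Distance from a partial Euler product to its limit. -/
lemma abs_limit_sub_prod_le (hC : 0 ≤ C) (hΔ : Δ ≠ 0) (h0 : ∀ p : ℕ, p.Prime → 0 ≤ w p)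
    (h1 : ∀ p : ℕ, p.Prime → |w p - 1| ≤ C / p)
    (h2 : ∀ p : ℕ, p.Prime → ¬ p ∣ Δ → |w p - 1| ≤ C / (p : ℝ) ^ 2) {z : ℕ} (hz : 2 ≤ z)
    {t : ℝ} (ht : Tendsto (fun y => ∏ p ∈ Nat.primesLE y, w p) atTop (𝓝 t)) {e : ℝ}
    (he : C * (1 / z + Real.log Δ / (z * Real.log z)) ≤ e) :
    |t - ∏ p ∈ Nat.primesLE z, w p| ≤ (Real.exp e - 1) * ∏ p ∈ Nat.primesLE z, w p := by
  have hT : 0 ≤ ∏ p ∈ Nat.primesLE z, w p :=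
    Finset.prod_nonneg fun p hp => h0 p (Nat.prime_of_mem_primesLE hp)
  refine le_of_tendsto (ht.sub_const _).abs ?_
  filter_upwards [eventually_ge_atTop z] with y hy
  have hsplit : ∏ p ∈ Nat.primesLE y, w p =
      (∏ p ∈ Nat.primesLE z, w p) * ∏ p ∈ (Finset.Ioc z y).filter Nat.Prime, w p := by
    rw [← Finset.prod_union]
    · refine Finset.prod_congr ?_ fun _ _ => rfl
      ext p
      simp only [Nat.mem_primesLE, Finset.mem_filter, Finset.mem_union, Finset.mem_Ioc]
      by_cases hp : p.Prime
      · simp only [hp, and_true]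
        omega
      · simp [hp]
    · rw [Finset.disjoint_left]
      intro p hp hp'
      simp only [Nat.mem_primesLE, Finset.mem_filter, Finset.mem_Ioc] at hp hp'
      omega
  have hexp := Finset.norm_prod_one_add_sub_one_le ((Finset.Ioc z y).filter Nat.Prime)
    fun p => w p - 1
  simp only [add_sub_cancel, Real.norm_eq_abs] at hexp
  rw [hsplit, ← mul_sub_one, abs_mul, abs_of_nonneg hT, mul_comm]
  gcongr
  refine hexp.trans ?_
  gcongr
  exact (sum_abs_sub_one_le hC hΔ h1 h2 hz hy).trans he

end Tail

section Average

variable {m k : ℕ} {f : Fin m → Polynomial ℤ}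

/-- The average of the partial products of the relative local factors over a box. -/
lemma sum_prod_shiftWeight_bounds (hpos : ∀ p : ℕ, p.Prime → nuPoly f p < p) {z H : ℕ}
    (hH0 : 0 < H) (hH : primorial z ≤ H) :
    (1 - (primorial z : ℝ) / H) ^ k ≤
        (∑ h ∈ Fintype.piFinset fun _ : Fin k => Finset.Icc 1 H,
          ∏ p ∈ Nat.primesLE z, shiftWeight f h p) / (H : ℝ) ^ k ∧
      (∑ h ∈ Fintype.piFinset fun _ : Fin k => Finset.Icc 1 H,
          ∏ p ∈ Nat.primesLE z, shiftWeight f h p) / (H : ℝ) ^ k ≤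
        (1 + (primorial z : ℝ) / H) ^ k := by
  have hHR : (0 : ℝ) < H := by exact_mod_cast hH0
  rw [primorial_eq_prod_primesLE] at hH ⊢
  obtain ⟨hlo, hhi⟩ := sum_prod_density_bounds (Nat.primesLE z)
    (fun p hp => Nat.prime_of_mem_primesLE hp) (zeroSet f) k H hH
  set G : ℝ := ∏ p ∈ Nat.primesLE z, (1 - ((zeroSet f p).ncard : ℝ) / p) with hG
  have hG0 : 0 < G := Finset.prod_pos fun p hp => by
    have hp' := Nat.prime_of_mem_primesLE hp
    have hp0 : (0 : ℝ) < p := by exact_mod_cast hp'.pos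
    rw [sub_pos, div_lt_one hp0, ← nuPoly_eq_ncard]
    exact_mod_cast hpos p hp'
  have hT (h : Fin k → ℕ) : ∏ p ∈ Nat.primesLE z, shiftWeight f h p =
      (∏ p ∈ Nat.primesLE z,
        (1 - ({x : ZMod p | ∃ i, x + h i ∈ zeroSet f p}.ncard : ℝ) / p)) / G ^ k := by
    rw [hG, ← Finset.prod_pow, ← Finset.prod_div_distrib]
    refine Finset.prod_congr rfl fun p _ => ?_
    rw [shiftWeight, nuPoly_shiftFamily, nuPoly_eq_ncard]
  have hden : 0 < G ^ k * (H : ℝ) ^ k := by positivity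
  simp only [hT, ← Finset.sum_div, div_div]
  rw [le_div_iff₀ hden, div_le_iff₀ hden, ← mul_pow, ← mul_pow, ← mul_pow]
  have h1 : (1 - (primorial z : ℝ) / H) * (G * H) = (H - (primorial z : ℝ)) * G := by
    field_simp
  have h2 : (1 + (primorial z : ℝ) / H) * (G * H) = (H + (primorial z : ℝ)) * G := by
    field_simp
  rw [← primorial_eq_prod_primesLE] at hlo hhi ⊢
  rw [h1, h2]
  exact ⟨hlo, hhi⟩

/-- Existence of the limit of the relative local factors. -/
lemma exists_tendsto_prod_shiftWeight (hf : IsPrimitiveFamily f)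
    (hpos : ∀ p : ℕ, p.Prime → nuPoly f p < p) (h : Fin k → ℕ)
    (hh : IsPrimitiveFamily (shiftFamily f h)) :
    ∃ t, Tendsto (fun y => ∏ p ∈ Nat.primesLE y, shiftWeight f h p) atTop (𝓝 t) := by
  obtain ⟨A, B, hAB⟩ := exists_bad_modulus hf k
  obtain ⟨Δ, hΔ, -, hν⟩ := hAB (∑ i, h i + 1) (by omega) h hh fun i =>
    (Finset.single_le_sum (fun _ _ => Nat.zero_le _) (Finset.mem_univ i)).trans (Nat.le_succ _)
  obtain ⟨C, hC, hw⟩ := exists_shiftWeight_bounds hf hpos k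
  exact exists_tendsto_prod_primesLE (Δ := Δ)
    (fun p hp hd => (hw p hp h).2.2.2 (hν p hp hd)) hΔ (by linarith)

/-- For `L ≥ 2` the exponent `⌊log_L H / 2⌋` tends to infinity with `H`. -/
lemma tendsto_log_div_two {L : ℕ} (hL : 1 < L) :
    Tendsto (fun H => Nat.log L H / 2) atTop atTop := by
  refine tendsto_atTop.mpr fun b => ?_
  filter_upwards [eventually_ge_atTop (L ^ (b * 2))] with H hH
  rw [Nat.le_div_iff_mul_le two_pos]
  exact Nat.le_log_of_pow_le hL hH

lemma pow_log_div_two_le_sqrt {L H : ℕ} (hH : H ≠ 0) :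
    (L : ℝ) ^ (Nat.log L H / 2) ≤ √H := by
  refine Real.le_sqrt_of_sq_le ?_
  rw [← pow_mul]
  have h1 : L ^ Nat.log L H ≤ H := Nat.pow_log_le_self L hH
  rcases Nat.eq_zero_or_pos L with rfl | hL
  · simp [Nat.one_le_iff_ne_zero, hH]
  have h2 : L ^ (Nat.log L H / 2 * 2) ≤ L ^ Nat.log L H :=
    Nat.pow_le_pow_right hL (Nat.div_mul_le_self _ _)
  exact_mod_cast h2.trans h1

lemma log_le_mul_log_div_two {L H : ℕ} (hL : 1 < L) (hH : H ≠ 0)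
    (hz : 1 ≤ Nat.log L H / 2) :
    Real.log H ≤ (Nat.log L H / 2 : ℕ) * (4 * Real.log L) := by
  have h1 : H ≤ L ^ (Nat.log L H / 2 * 4) :=
    (Nat.lt_pow_succ_log_self hL H).le.trans (Nat.pow_le_pow_right hL.le (by omega))
  have h2 : (H : ℝ) ≤ (L : ℝ) ^ (Nat.log L H / 2 * 4) := by exact_mod_cast h1
  have h3 := Real.log_le_log (by exact_mod_cast Nat.pos_of_ne_zero hH) h2
  rw [Real.log_pow] at h3
  refine h3.trans_eq ?_
  push_cast
  ring

open Classical in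
/-- The limits of the relative local factors have average `1`. -/
lemma tendsto_average_limit_shiftWeight (hf : IsPrimitiveFamily f)
    (hpos : ∀ p : ℕ, p.Prime → nuPoly f p < p) (hk : 1 ≤ k) (t : (Fin k → ℕ) → ℝ)
    (ht : ∀ h, IsPrimitiveFamily (shiftFamily f h) →
      Tendsto (fun y => ∏ p ∈ Nat.primesLE y, shiftWeight f h p) atTop (𝓝 (t h))) :
    Tendsto
      (fun H : ℕ =>
        (∑ h ∈ (Fintype.piFinset fun _ : Fin k => Finset.Icc 1 H).filter
            (fun h => IsPrimitiveFamily (shiftFamily f h)), t h) / (H : ℝ) ^ k)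
      atTop (𝓝 1) := by
  obtain ⟨A, B, hAB⟩ := exists_bad_modulus hf k
  obtain ⟨C, hC, hw⟩ := exists_shiftWeight_bounds hf hpos k
  obtain ⟨K, hK⟩ := exists_card_not_primitive_le hf hk
  set L : ℕ := max 4 ⌈C⌉₊ with hL
  have hL4 : 4 ≤ L := le_max_left _ _
  have hLC : C ≤ L := (Nat.le_ceil C).trans (by exact_mod_cast le_max_right _ _)
  let z : ℕ → ℕ := fun H => Nat.log L H / 2
  have hz : Tendsto z atTop atTop := tendsto_log_div_two (by omega)
  have hzR : Tendsto (fun H => (z H : ℝ)) atTop atTop := tendsto_natCast_atTop_atTop.comp hz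
  let T : ℕ → (Fin k → ℕ) → ℝ := fun H h => ∏ p ∈ Nat.primesLE (z H), shiftWeight f h p
  let box : ℕ → Finset (Fin k → ℕ) := fun H => Fintype.piFinset fun _ : Fin k => Finset.Icc 1 H
  let S : ℕ → ℝ := fun H => (∑ h ∈ box H, T H h) / (H : ℝ) ^ k
  have hsqrt : Tendsto (fun H : ℕ => 1 / √(H : ℝ)) atTop (𝓝 0) := by
    simp only [one_div]
    exact (Real.tendsto_sqrt_atTop.comp tendsto_natCast_atTop_atTop).inv_tendsto_atTop
  have hP (H : ℕ) (hH : H ≠ 0) : (primorial (z H) : ℝ) ≤ √H := by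
    have h1 : primorial (z H) ≤ L ^ z H :=
      (primorial_le_four_pow _).trans (Nat.pow_le_pow_left hL4 _)
    exact le_trans (by exact_mod_cast h1) (pow_log_div_two_le_sqrt hH)
  have hT0 (H : ℕ) (h : Fin k → ℕ) : 0 ≤ T H h :=
    Finset.prod_nonneg fun p hp => (hw p (Nat.prime_of_mem_primesLE hp) h).1
  have hTle (H : ℕ) (hH : H ≠ 0) (h : Fin k → ℕ) : T H h ≤ C * √H := by
    calc T H h ≤ ∏ p ∈ Nat.primesLE (z H), C :=
          Finset.prod_le_prod (fun p hp => (hw p (Nat.prime_of_mem_primesLE hp) h).1)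
            fun p hp => (hw p (Nat.prime_of_mem_primesLE hp) h).2.1
      _ = C ^ (Nat.primesLE (z H)).card := by rw [Finset.prod_const]
      _ ≤ C ^ (z H + 1) := by
          refine pow_le_pow_right₀ hC ((Finset.card_filter_le _ _).trans ?_)
          rw [Finset.card_range]
      _ = C * C ^ z H := pow_succ' C _
      _ ≤ C * (L : ℝ) ^ z H := by gcongr
      _ ≤ C * √H := by
          gcongr
          exact pow_log_div_two_le_sqrt hH
  have hS1 : Tendsto S atTop (𝓝 1) := by
    have hlo : Tendsto (fun H : ℕ => (1 - 1 / √(H : ℝ)) ^ k) atTop (𝓝 1) := by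
      simpa using (hsqrt.const_sub 1).pow k
    have hhi : Tendsto (fun H : ℕ => (1 + 1 / √(H : ℝ)) ^ k) atTop (𝓝 1) := by
      simpa using (hsqrt.const_add 1).pow k
    have key : ∀ᶠ H : ℕ in atTop, (1 - 1 / √(H : ℝ)) ^ k ≤ S H ∧ S H ≤ (1 + 1 / √(H : ℝ)) ^ k := by
      filter_upwards [eventually_ge_atTop 1] with H hH
      have hHR : (1 : ℝ) ≤ H := by exact_mod_cast hH
      have hs1 : 1 ≤ √(H : ℝ) := Real.one_le_sqrt.mpr hHR
      have hsH : √(H : ℝ) * √H = H := Real.mul_self_sqrt (by linarith)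
      have hPH := hP H (by omega)
      have hle : primorial (z H) ≤ H := by
        have : (primorial (z H) : ℝ) ≤ H := by nlinarith
        exact_mod_cast this
      have hdiv : (primorial (z H) : ℝ) / H ≤ 1 / √H := by
        rw [div_le_div_iff₀ (by linarith) (by linarith)]
        nlinarith
      obtain ⟨h1, h2⟩ := sum_prod_shiftWeight_bounds (k := k) hpos (by omega) hle
      refine ⟨le_trans ?_ h1, h2.trans ?_⟩
      · refine pow_le_pow_left₀ ?_ (by linarith) k
        rw [sub_nonneg, div_le_one (by linarith)]
        exact hs1
      · gcongr
    exact tendsto_of_tendsto_of_tendsto_of_le_of_le' hlo hhi (key.mono fun _ h => h.1)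
      (key.mono fun _ h => h.2)
  set κ : ℝ := Real.log A + B * (4 * Real.log L) with hκ
  let E : ℕ → ℝ := fun H => C * (1 / z H + κ / Real.log (z H))
  have hE : Tendsto E atTop (𝓝 0) := by
    have h1 : Tendsto (fun H => 1 / (z H : ℝ)) atTop (𝓝 0) := hzR.const_div_atTop 1
    have h2 : Tendsto (fun H => κ / Real.log (z H)) atTop (𝓝 0) :=
      (Real.tendsto_log_atTop.comp hzR).const_div_atTop κ
    have h3 := (h1.add h2).const_mul C
    rwa [add_zero, mul_zero] at h3
  have herr : Tendsto (fun H : ℕ => (Real.exp (E H) - 1) * S H + K * C * (1 / √(H : ℝ)))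
      atTop (𝓝 0) := by
    have h1 : Tendsto (fun H => Real.exp (E H) - 1) atTop (𝓝 0) := by
      simpa using ((Real.continuous_exp.tendsto 0).comp hE).sub_const 1
    simpa using (h1.mul hS1).add (hsqrt.const_mul ((K : ℝ) * C))
  suffices hdiff : Tendsto (fun H : ℕ =>
      (∑ h ∈ (box H).filter (fun h => IsPrimitiveFamily (shiftFamily f h)), t h) / (H : ℝ) ^ k
        - S H) atTop (𝓝 0) by
    simpa [box] using hdiff.add hS1
  refine squeeze_zero_norm' ?_ herr
  filter_upwards [eventually_ge_atTop 1, hz.eventually_ge_atTop 2] with H hH hzH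
  have hHR : (0 : ℝ) < H := by exact_mod_cast hH
  have hzR : (2 : ℝ) ≤ z H := by exact_mod_cast hzH
  have hlogz : 0 < Real.log (z H) := Real.log_pos (by linarith)
  have hclose (h : Fin k → ℕ) (hb : h ∈ box H) (hh : IsPrimitiveFamily (shiftFamily f h)) :
      |t h - T H h| ≤ (Real.exp (E H) - 1) * T H h := by
    have hhi (i : Fin k) : h i ≤ H := (Finset.mem_Icc.mp (Fintype.mem_piFinset.mp hb i)).2
    obtain ⟨Δ, hΔ, hle, hν⟩ := hAB H hH h hh hhi
    refine abs_limit_sub_prod_le (by linarith) hΔ (fun p hp => (hw p hp h).1)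
      (fun p hp => (hw p hp h).2.2.1) (fun p hp hd => (hw p hp h).2.2.2 (hν p hp hd)) hzH
      (ht h hh) ?_
    have hA : A ≠ 0 := by
      rintro rfl
      exact hΔ (by simpa using hle)
    have hlogΔ : Real.log Δ ≤ z H * κ := by
      have h1 : Real.log Δ ≤ Real.log A + B * Real.log H := by
        rw [← Real.log_pow, ← Real.log_mul (by exact_mod_cast hA) (by positivity)]
        refine Real.log_le_log (by exact_mod_cast Nat.pos_of_ne_zero hΔ) ?_
        exact_mod_cast hle
      have h2 := log_le_mul_log_div_two (L := L) (H := H) (by omega) (by omega)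
        (one_le_two.trans hzH)
      have h3 : (B : ℝ) * Real.log H ≤ B * (z H * (4 * Real.log L)) :=
        mul_le_mul_of_nonneg_left h2 (Nat.cast_nonneg B)
      have h4 : 0 ≤ Real.log A := Real.log_natCast_nonneg A
      rw [hκ]
      nlinarith
    have hdiv : Real.log Δ / (z H * Real.log (z H)) ≤ κ / Real.log (z H) := by
      rw [div_le_div_iff₀ (by positivity) hlogz]
      nlinarith [mul_le_mul_of_nonneg_right hlogΔ hlogz.le]
    exact mul_le_mul_of_nonneg_left (by linarith) (by linarith)
  set prim := (box H).filter fun h => IsPrimitiveFamily (shiftFamily f h) with hprim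
  set nonprim := (box H).filter fun h => ¬ IsPrimitiveFamily (shiftFamily f h) with hnonprim
  have hexp : 0 ≤ Real.exp (E H) - 1 := by
    have hκ0 : 0 ≤ κ := by
      have := Real.log_natCast_nonneg A
      have := Real.log_natCast_nonneg L
      positivity
    have : 0 ≤ E H := by
      change 0 ≤ C * (1 / z H + κ / Real.log (z H))
      positivity
    linarith [Real.add_one_le_exp (E H)]
  have hsplit : ∑ h ∈ box H, T H h = ∑ h ∈ prim, T H h + ∑ h ∈ nonprim, T H h :=
    (Finset.sum_filter_add_sum_filter_not _ _ _).symm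
  have hnp0 : 0 ≤ ∑ h ∈ nonprim, T H h := Finset.sum_nonneg fun h _ => hT0 H h
  have hnp : ∑ h ∈ nonprim, T H h ≤ K * (H : ℝ) ^ (k - 1) * (C * √H) := by
    calc _ ≤ ∑ h ∈ nonprim, C * √(H : ℝ) := Finset.sum_le_sum fun h _ => hTle H (by omega) h
      _ = nonprim.card * (C * √H) := by simp
      _ ≤ _ := by
        gcongr
        exact_mod_cast hK H
  have hp : |∑ h ∈ prim, t h - ∑ h ∈ prim, T H h| ≤
      (Real.exp (E H) - 1) * ∑ h ∈ box H, T H h := by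
    rw [← Finset.sum_sub_distrib]
    calc _ ≤ ∑ h ∈ prim, |t h - T H h| := Finset.abs_sum_le_sum_abs _ _
      _ ≤ ∑ h ∈ prim, (Real.exp (E H) - 1) * T H h := Finset.sum_le_sum fun h hh =>
          hclose h (Finset.mem_filter.mp hh).1 (Finset.mem_filter.mp hh).2
      _ = (Real.exp (E H) - 1) * ∑ h ∈ prim, T H h := by rw [Finset.mul_sum]
      _ ≤ _ := mul_le_mul_of_nonneg_left (by linarith) hexp
  have hHk : (H : ℝ) ^ k = H ^ (k - 1) * (√H * √H) := by
    rw [Real.mul_self_sqrt hHR.le, ← pow_succ, Nat.sub_add_cancel hk]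
  have hs0 : 0 < √(H : ℝ) := Real.sqrt_pos.mpr hHR
  have hrhs : K * C * (1 / √(H : ℝ)) = K * (H : ℝ) ^ (k - 1) * (C * √H) / (H : ℝ) ^ k := by
    rw [hHk]
    field_simp
  rw [Real.norm_eq_abs, hrhs, ← sub_div, ← mul_div_assoc, ← add_div, abs_div,
    abs_of_pos (pow_pos hHR k)]
  gcongr
  rw [hsplit] at hp ⊢
  rw [← sub_sub]
  refine (abs_sub _ _).trans (add_le_add hp ?_)
  rwa [abs_of_nonneg hnp0]

end Average

open Classical in
/-- Let `f` be a primitive family whose singular series exists and is nonzero, and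
`k ≥ 1`. Then for every `k`-tuple `h` of positive integers with `f∘h` primitive the
singular series `S(f∘h)` exists, and the average of `S(f∘h)` over `k`-tuples with
entries at most `H` such that `f∘h` is primitive tends to `S(f)^k`. -/
theorem average_of_shifted_singular_series (m : ℕ) (f : Fin m → Polynomial ℤ)
    (hf : IsPrimitiveFamily f) (Sf : ℝ) (hSf : Tendsto (partialSS f) atTop (𝓝 Sf))
    (hSf0 : Sf ≠ 0) (k : ℕ) (hk : 1 ≤ k) :
    (∀ h : Fin k → ℕ, (∀ i, 1 ≤ h i) → IsPrimitiveFamily (shiftFamily f h) →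
      ∃ t : ℝ, Tendsto (partialSS (shiftFamily f h)) atTop (𝓝 t)) ∧
    Tendsto
      (fun H : ℕ =>
        (∑ h ∈ (Fintype.piFinset fun _ : Fin k => Finset.Icc 1 H).filter
            (fun h => IsPrimitiveFamily (shiftFamily f h)),
          limUnder atTop (partialSS (shiftFamily f h))) / (H : ℝ) ^ k)
      atTop (𝓝 (Sf ^ k)) := by
  have hpos (p : ℕ) (hp : p.Prime) : nuPoly f p < p := nuPoly_lt_of_tendsto hSf hSf0 hp
  choose! t ht using exists_tendsto_prod_shiftWeight (k := k) hf hpos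
  have hlim (h : Fin k → ℕ) (hh : IsPrimitiveFamily (shiftFamily f h)) :
      Tendsto (partialSS (shiftFamily f h)) atTop (𝓝 (Sf ^ k * t h)) := by
    exact ((hSf.pow k).mul (ht h hh)).congr fun y => (partialSS_shiftFamily h y hpos).symm
  refine ⟨fun h _ hh => ⟨_, hlim h hh⟩, ?_⟩
  have hmain := (tendsto_average_limit_shiftWeight hf hpos hk t ht).const_mul (Sf ^ k)
  rw [mul_one] at hmain
  refine hmain.congr fun H => ?_
  rw [← mul_div_assoc, Finset.mul_sum]
  congr 1
  refine Finset.sum_congr rfl fun h hh => ?_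
  exact (hlim h (Finset.mem_filter.mp hh).2).limUnder_eq.symm
end

section
/- Let f = (f_1,…,f_m) be a primitive family whose singular series S(f) exists and is nonzero, and let k ≥ 1 be an integer. Then for every λ > 0 and ε > 0 there exists a constant C ≥ 0 (depending only on k, f, λ, ε) such that for all N ≥ 2 and all real h with 1 ≤ h ≤ λ(log N)^m: Σ* π(N; f∘h) ≤ C · N/(log N)^{1−ε}, where the sum Σ* runs over all k-tuples h = (h_1,…,h_k) of distinct positive integers with h_i ≤ h such that f∘h is NOT primitive. -/
open Filter Topology

/-- `π(N; g)`: the number of `1 ≤ n ≤ N` such that all `g_j(n)` are positive primes. -/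
noncomputable def piCount {ι : Type*} [Fintype ι] (g : ι → Polynomial ℤ) (N : ℝ) : ℕ :=
  {n : ℕ | 1 ≤ n ∧ (n : ℝ) ≤ N ∧
    ∀ j, 0 < (g j).eval (n : ℤ) ∧ Prime ((g j).eval (n : ℤ))}.ncard

/-- The `k`-tuples of distinct positive integers with all entries `≤ H`. -/
def distinctTuples (k H : ℕ) : Finset (Fin k → ℕ) :=
  (Fintype.piFinset fun _ : Fin k => Finset.Icc 1 H).filter Function.Injective

section Bonferroni

/-- The alternating sum of `∏ i ∈ T, x i` over the subsets `T` of `P` with at most `s` elements. -/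
noncomputable def truncatedInclExcl {ι : Type*} (P : Finset ι) (x : ι → ℝ) (s : ℕ) : ℝ :=
  ∑ T ∈ P.powerset, if T.card ≤ s then (-1) ^ T.card * ∏ i ∈ T, x i else 0

/-- The sum of `∏ i ∈ T, x i` over the subsets `T` of `P` with exactly `s` elements. -/
noncomputable def elemSym {ι : Type*} (P : Finset ι) (x : ι → ℝ) (s : ℕ) : ℝ :=
  ∑ T ∈ P.powerset, if T.card = s then ∏ i ∈ T, x i else 0

variable {ι : Type*}

theorem truncatedInclExcl_zero (P : Finset ι) (x : ι → ℝ) : truncatedInclExcl P x 0 = 1 := by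
  unfold truncatedInclExcl
  rw [Finset.sum_eq_single ∅]
  · simp
  · intro T _ hT
    simp [hT]
  · simp

theorem elemSym_zero (P : Finset ι) (x : ι → ℝ) : elemSym P x 0 = 1 := by
  unfold elemSym
  rw [Finset.sum_eq_single ∅]
  · simp
  · intro T _ hT
    simp [hT]
  · simp

theorem truncatedInclExcl_insert [DecidableEq ι] {P : Finset ι} {a : ι} (ha : a ∉ P) (x : ι → ℝ) (s : ℕ) :
    truncatedInclExcl (insert a P) x (s + 1) =
      truncatedInclExcl P x (s + 1) - x a * truncatedInclExcl P x s := by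
  unfold truncatedInclExcl
  rw [Finset.sum_powerset_insert ha, sub_eq_add_neg, Finset.mul_sum, ← Finset.sum_neg_distrib]
  congr 1
  refine Finset.sum_congr rfl fun T hT => ?_
  have haT : a ∉ T := fun h => ha (Finset.mem_powerset.1 hT h)
  rw [Finset.card_insert_of_notMem haT, Finset.prod_insert haT]
  by_cases h : T.card ≤ s
  · simp [h]; ring
  · simp [h]

theorem elemSym_insert [DecidableEq ι] {P : Finset ι} {a : ι} (ha : a ∉ P) (x : ι → ℝ) (s : ℕ) :
    elemSym (insert a P) x (s + 1) = elemSym P x (s + 1) + x a * elemSym P x s := by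
  unfold elemSym
  rw [Finset.sum_powerset_insert ha, Finset.mul_sum]
  congr 1
  refine Finset.sum_congr rfl fun T hT => ?_
  have haT : a ∉ T := fun h => ha (Finset.mem_powerset.1 hT h)
  rw [Finset.card_insert_of_notMem haT, Finset.prod_insert haT]
  by_cases h : T.card = s <;> simp [h]

/-- The Bonferroni inequalities for a product `∏ (1 - x i)`. -/
theorem bonferroni [DecidableEq ι] (P : Finset ι) (x : ι → ℝ) (h0 : ∀ i ∈ P, 0 ≤ x i) (h1 : ∀ i ∈ P, x i ≤ 1)
    (s : ℕ) :
    0 ≤ (-1) ^ s * (truncatedInclExcl P x s - ∏ i ∈ P, (1 - x i)) ∧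
      (-1) ^ s * (truncatedInclExcl P x s - ∏ i ∈ P, (1 - x i)) ≤ elemSym P x (s + 1) := by
  induction P using Finset.induction_on generalizing s with
  | empty => simp [truncatedInclExcl, elemSym]
  | insert a P ha ih =>
    have hxa := h0 a (Finset.mem_insert_self a P)
    have ih' := ih (fun i hi => h0 i (Finset.mem_insert_of_mem hi))
      (fun i hi => h1 i (Finset.mem_insert_of_mem hi))
    have hp : 0 ≤ ∏ i ∈ P, (1 - x i) := Finset.prod_nonneg fun i hi =>
      sub_nonneg.2 (h1 i (Finset.mem_insert_of_mem hi))
    have hp1 : ∏ i ∈ P, (1 - x i) ≤ 1 := Finset.prod_le_one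
      (fun i hi => sub_nonneg.2 (h1 i (Finset.mem_insert_of_mem hi)))
      (fun i hi => by linarith [h0 i (Finset.mem_insert_of_mem hi)])
    rw [Finset.prod_insert ha, elemSym_insert ha]
    cases s with
    | zero =>
      have := ih' 0
      simp only [truncatedInclExcl_zero, elemSym_zero, pow_zero, one_mul] at this ⊢
      constructor <;> nlinarith [mul_nonneg hxa hp, mul_nonneg hxa (sub_nonneg.2 hp1)]
    | succ s =>
      rw [truncatedInclExcl_insert ha]
      have e : (-1 : ℝ) ^ (s + 1) * (truncatedInclExcl P x (s + 1) - x a * truncatedInclExcl P x s -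
          (1 - x a) * ∏ i ∈ P, (1 - x i)) =
          (-1) ^ (s + 1) * (truncatedInclExcl P x (s + 1) - ∏ i ∈ P, (1 - x i)) +
          x a * ((-1) ^ s * (truncatedInclExcl P x s - ∏ i ∈ P, (1 - x i))) := by
        ring
      rw [e]
      exact ⟨add_nonneg (ih' (s + 1)).1 (mul_nonneg hxa (ih' s).1),
        add_le_add (ih' (s + 1)).2 (mul_le_mul_of_nonneg_left (ih' s).2 hxa)⟩

/-- Rankin's bound for elementary symmetric functions. -/
theorem elemSym_le_exp (P : Finset ι) (x : ι → ℝ) (h0 : ∀ i ∈ P, 0 ≤ x i) (s : ℕ) :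
    elemSym P x s ≤ Real.exp (Real.exp 1 * ∑ i ∈ P, x i - s) := by
  have key : Real.exp s * elemSym P x s ≤ ∏ i ∈ P, (1 + Real.exp 1 * x i) := by
    rw [Finset.prod_one_add, elemSym, Finset.mul_sum]
    refine Finset.sum_le_sum fun T hT => ?_
    have hT0 : 0 ≤ ∏ i ∈ T, x i :=
      Finset.prod_nonneg fun i hi => h0 i (Finset.mem_powerset.1 hT hi)
    rw [Finset.prod_mul_distrib, Finset.prod_const]
    split_ifs with h
    · rw [h, ← Real.exp_nat_mul, mul_one]
    · simpa using mul_nonneg (by positivity) hT0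
  have h2 : ∏ i ∈ P, (1 + Real.exp 1 * x i) ≤ Real.exp (Real.exp 1 * ∑ i ∈ P, x i) := by
    rw [Finset.mul_sum, Real.exp_sum]
    refine Finset.prod_le_prod (fun i hi => ?_) (fun i hi => ?_)
    · have := h0 i hi
      positivity
    · rw [add_comm]
      exact Real.add_one_le_exp _
  rw [Real.exp_sub, le_div_iff₀ (Real.exp_pos _), mul_comm]
  exact key.trans h2

/-- Rankin's bound for a sum over small subsets. -/
theorem sum_powerset_card_le (P : Finset ι) (w : ι → ℝ) {D z : ℝ} (hD : 1 ≤ D) (hz : 1 ≤ z)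
    (hPz : (P.card : ℝ) ≤ z) (h0 : ∀ i ∈ P, 0 ≤ w i) (h1 : ∀ i ∈ P, w i ≤ D) (s : ℕ) :
    (∑ T ∈ P.powerset, if T.card ≤ s then ∏ i ∈ T, w i else 0) ≤ Real.exp 1 * (D * z) ^ s := by
  have hY : 1 ≤ D * z := one_le_mul_of_one_le_of_one_le hD hz
  have hY0 : 0 < D * z := by positivity
  have key : (∑ T ∈ P.powerset, if T.card ≤ s then ∏ i ∈ T, w i else 0) ≤
      (D * z) ^ s * ∏ i ∈ P, (1 + w i / (D * z)) := by
    rw [Finset.prod_one_add, Finset.mul_sum]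
    refine Finset.sum_le_sum fun T hT => ?_
    have hT0 : 0 ≤ ∏ i ∈ T, w i :=
      Finset.prod_nonneg fun i hi => h0 i (Finset.mem_powerset.1 hT hi)
    rw [Finset.prod_div_distrib, Finset.prod_const]
    split_ifs with h
    · rw [mul_div_assoc', le_div_iff₀ (by positivity), mul_comm]
      exact mul_le_mul_of_nonneg_right (pow_le_pow_right₀ hY h) hT0
    · positivity
  have h2 : ∏ i ∈ P, (1 + w i / (D * z)) ≤ Real.exp 1 := by
    calc ∏ i ∈ P, (1 + w i / (D * z)) ≤ ∏ i ∈ P, Real.exp (1 / z) := by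
          refine Finset.prod_le_prod (fun i hi => ?_) (fun i hi => ?_)
          · have := h0 i hi
            positivity
          · have h3 : w i / (D * z) ≤ 1 / z := by
              rw [div_le_div_iff₀ hY0 (by positivity), one_mul]
              exact mul_le_mul_of_nonneg_right (h1 i hi) (by positivity)
            linarith [Real.add_one_le_exp (1 / z)]
      _ = Real.exp (P.card * (1 / z)) := by rw [Finset.prod_const, ← Real.exp_nat_mul]
      _ ≤ Real.exp 1 := by
          rw [Real.exp_le_exp, mul_one_div, div_le_one (by positivity)]
          exact hPz
  calc _ ≤ _ := key
    _ ≤ (D * z) ^ s * Real.exp 1 := mul_le_mul_of_nonneg_left h2 (by positivity)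
    _ = _ := mul_comm _ _

end Bonferroni

section Sieve

theorem abs_card_modEq_sub_le (X q a : ℕ) (hq : 0 < q) :
    |(((Finset.Ioc 0 X).filter (fun n => n ≡ a [MOD q])).card : ℝ) - X / q| ≤ 1 := by
  have h := Nat.Ioc_filter_modEq_card 0 X hq a
  set c := ((Finset.Ioc 0 X).filter (fun n => n ≡ a [MOD q])).card with hc
  have hq' : (0 : ℚ) < q := by exact_mod_cast hq
  have hle : ((((0 : ℕ) : ℚ) - a) / q) ≤ ((X : ℚ) - a) / q := by
    gcongr
    exact_mod_cast Nat.zero_le X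
  rw [max_eq_left (sub_nonneg.2 (Int.floor_le_floor hle))] at h
  have h' : (c : ℚ) = (⌊((X : ℚ) - a) / q⌋ : ℚ) - (⌊(((0 : ℕ) : ℚ) - a) / q⌋ : ℚ) := by
    exact_mod_cast h
  have e : ((X : ℚ) - a) / q - (((0 : ℕ) : ℚ) - a) / q = X / q := by
    field_simp
    push_cast
    ring
  have : |(c : ℚ) - X / q| ≤ 1 := by
    rw [abs_le]
    have h1 := Int.floor_le (((X : ℚ) - a) / q)
    have h2 := Int.lt_floor_add_one (((X : ℚ) - a) / q)
    have h3 := Int.floor_le ((((0 : ℕ) : ℚ) - a) / q)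
    have h4 := Int.lt_floor_add_one ((((0 : ℕ) : ℚ) - a) / q)
    constructor <;> linarith
  have h5 := (Rat.cast_le (K := ℝ)).2 this
  push_cast at h5
  exact h5

theorem abs_card_residues_sub_le (T : Finset ℕ) (hT : ∀ p ∈ T, p.Prime) (Ω : ℕ → Finset ℕ)
    (hΩ : ∀ p ∈ T, Ω p ⊆ Finset.range p) (X q a : ℕ) (hq : 0 < q) (hqT : ∀ p ∈ T, q.Coprime p) :
    |(((Finset.Ioc 0 X).filter (fun n => n ≡ a [MOD q] ∧ ∀ p ∈ T, n % p ∈ Ω p)).card : ℝ) -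
      X / q * ∏ p ∈ T, ((Ω p).card : ℝ) / p| ≤ ∏ p ∈ T, ((Ω p).card : ℝ) := by
  induction T using Finset.induction_on generalizing q a with
  | empty => simpa using abs_card_modEq_sub_le X q a hq
  | insert p T hp ih =>
    have hpp := hT p (Finset.mem_insert_self p T)
    have hcop : q.Coprime p := hqT p (Finset.mem_insert_self p T)
    have hsplit : (((Finset.Ioc 0 X).filter
        (fun n => n ≡ a [MOD q] ∧ ∀ l ∈ insert p T, n % l ∈ Ω l)).card : ℝ) =
        ∑ c ∈ Ω p, (((Finset.Ioc 0 X).filter (fun n => n ≡ Nat.chineseRemainder hcop a c [MOD q * p] ∧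
          ∀ l ∈ T, n % l ∈ Ω l)).card : ℝ) := by
      rw [← Nat.cast_sum, Finset.card_eq_sum_card_fiberwise (f := fun n => n % p) (t := Ω p)]
      · congr 1
        refine Finset.sum_congr rfl fun c hc => ?_
        congr 1
        ext n
        have hcp : c % p = c := Nat.mod_eq_of_lt
          (Finset.mem_range.1 (hΩ p (Finset.mem_insert_self p T) hc))
        have hcr := (Nat.chineseRemainder hcop a c).2
        simp only [Finset.mem_filter, Finset.mem_insert, forall_eq_or_imp]
        rw [← Nat.modEq_and_modEq_iff_modEq_mul hcop]
        constructor
        · rintro ⟨⟨h1, h2, h3, h4⟩, h5⟩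
          exact ⟨h1, ⟨h2.trans hcr.1.symm, Nat.ModEq.trans (by rw [Nat.ModEq, h5, hcp]) hcr.2.symm⟩, h4⟩
        · rintro ⟨h1, ⟨h2, h3⟩, h4⟩
          have h5 : n % p = c := by
            have := h3.trans hcr.2
            rwa [Nat.ModEq, hcp] at this
          exact ⟨⟨h1, h2.trans hcr.1, by rwa [h5], h4⟩, h5⟩
      · intro n hn
        have hn' := (Finset.mem_filter.1 (Finset.mem_coe.1 hn)).2.2
        exact hn' p (Finset.mem_insert_self p T)
    have hp0 : (p : ℝ) ≠ 0 := by exact_mod_cast hpp.ne_zero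
    have hq0 : (q : ℝ) ≠ 0 := by exact_mod_cast hq.ne'
    have hmain : (X : ℝ) / q * ∏ l ∈ insert p T, ((Ω l).card : ℝ) / l =
        ∑ _c ∈ Ω p, (X : ℝ) / ((q * p : ℕ) : ℝ) * ∏ l ∈ T, ((Ω l).card : ℝ) / l := by
      rw [Finset.prod_insert hp, Finset.sum_const, nsmul_eq_mul]
      push_cast
      field_simp
    rw [hsplit, hmain, ← Finset.sum_sub_distrib, Finset.prod_insert hp]
    calc _ ≤ _ := Finset.abs_sum_le_sum_abs _ _
      _ ≤ ∑ _c ∈ Ω p, ∏ l ∈ T, ((Ω l).card : ℝ) := by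
          refine Finset.sum_le_sum fun c _ => ?_
          refine ih (fun l hl => hT l (Finset.mem_insert_of_mem hl))
            (fun l hl => hΩ l (Finset.mem_insert_of_mem hl)) (q * p) _ (Nat.mul_pos hq hpp.pos) ?_
          intro l hl
          have hl' := hT l (Finset.mem_insert_of_mem hl)
          refine Nat.Coprime.mul_left (hqT l (Finset.mem_insert_of_mem hl)) ?_
          rw [Nat.coprime_primes hpp hl']
          rintro rfl
          exact hp hl
      _ = _ := by rw [Finset.sum_const, nsmul_eq_mul]

/-- Brun's pure sieve. -/
theorem brun_pure_sieve (P : Finset ℕ) (hP : ∀ p ∈ P, p.Prime) (Ω : ℕ → Finset ℕ)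
    (hΩ : ∀ p ∈ P, Ω p ⊆ Finset.range p) (X s : ℕ) :
    (((Finset.Ioc 0 X).filter (fun n => ∀ p ∈ P, n % p ∉ Ω p)).card : ℝ) ≤
      X * (∏ p ∈ P, (1 - ((Ω p).card : ℝ) / p) +
        elemSym P (fun p => ((Ω p).card : ℝ) / p) (2 * s + 1)) +
      ∑ T ∈ P.powerset, if T.card ≤ 2 * s then ∏ p ∈ T, ((Ω p).card : ℝ) else 0 := by
  have hpt (n : ℕ) : (if ∀ p ∈ P, n % p ∉ Ω p then (1 : ℝ) else 0) ≤
      truncatedInclExcl P (fun p => if n % p ∈ Ω p then 1 else 0) (2 * s) := by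
    have := (bonferroni P (fun p => if n % p ∈ Ω p then (1 : ℝ) else 0)
      (fun i _ => by split_ifs <;> norm_num) (fun i _ => by split_ifs <;> norm_num) (2 * s)).1
    rw [pow_mul, neg_one_sq, one_pow, one_mul, sub_nonneg] at this
    refine le_trans (le_of_eq ?_) this
    split_ifs with h
    · exact (Finset.prod_eq_one fun p hp => by simp [h p hp]).symm
    · push Not at h
      obtain ⟨p, hp, hpn⟩ := h
      exact (Finset.prod_eq_zero hp (by simp [hpn])).symm
  have hdensity := (bonferroni P (fun p => ((Ω p).card : ℝ) / p) (fun i _ => by positivity)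
    (fun p hp => by
      have : ((Ω p).card : ℝ) ≤ p := by
        exact_mod_cast (Finset.card_le_card (hΩ p hp)).trans (Finset.card_range p).le
      exact div_le_one_of_le₀ this (by positivity)) (2 * s)).2
  rw [pow_mul, neg_one_sq, one_pow, one_mul] at hdensity
  have hcount (T : Finset ℕ) (hT : T ∈ P.powerset) :
      (∑ n ∈ Finset.Ioc 0 X, if T.card ≤ 2 * s then
          (-1 : ℝ) ^ T.card * ∏ p ∈ T, (if n % p ∈ Ω p then (1 : ℝ) else 0) else 0) ≤
        X * (if T.card ≤ 2 * s then (-1) ^ T.card * ∏ p ∈ T, ((Ω p).card : ℝ) / p else 0) +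
        (if T.card ≤ 2 * s then ∏ p ∈ T, ((Ω p).card : ℝ) else 0) := by
    split_ifs with h
    · have hTP := Finset.mem_powerset.1 hT
      have h1 := abs_card_residues_sub_le T (fun p hp => hP p (hTP hp)) Ω
        (fun p hp => hΩ p (hTP hp)) X 1 0 one_pos (fun p _ => Nat.coprime_one_left p)
      simp only [Nat.modEq_one, true_and, Nat.cast_one, div_one] at h1
      rw [← Finset.mul_sum]
      have h2 : ∑ n ∈ Finset.Ioc 0 X, ∏ p ∈ T, (if n % p ∈ Ω p then (1 : ℝ) else 0) =
          ((Finset.Ioc 0 X).filter (fun n => ∀ p ∈ T, n % p ∈ Ω p)).card := by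
        rw [Finset.card_eq_sum_ones, Finset.sum_filter]
        push_cast
        refine Finset.sum_congr rfl fun n _ => ?_
        rw [Finset.prod_ite_zero]
        simp
      rw [h2]
      have h3 := abs_le.1 h1
      rcases neg_one_pow_eq_or ℝ T.card with e | e <;> rw [e] <;> linarith [h3.1, h3.2]
    · simp
  calc (((Finset.Ioc 0 X).filter (fun n => ∀ p ∈ P, n % p ∉ Ω p)).card : ℝ)
      = ∑ n ∈ Finset.Ioc 0 X, (if ∀ p ∈ P, n % p ∉ Ω p then (1 : ℝ) else 0) := by
        rw [Finset.card_eq_sum_ones, Finset.sum_filter]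
        push_cast
        rfl
    _ ≤ ∑ n ∈ Finset.Ioc 0 X, truncatedInclExcl P (fun p => if n % p ∈ Ω p then 1 else 0) (2 * s) :=
        Finset.sum_le_sum fun n _ => hpt n
    _ ≤ X * truncatedInclExcl P (fun p => ((Ω p).card : ℝ) / p) (2 * s) +
        ∑ T ∈ P.powerset, if T.card ≤ 2 * s then ∏ p ∈ T, ((Ω p).card : ℝ) else 0 := by
        unfold truncatedInclExcl
        rw [Finset.sum_comm, Finset.mul_sum, ← Finset.sum_add_distrib]
        exact Finset.sum_le_sum hcount
    _ ≤ _ := by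
        gcongr
        linarith

end Sieve

section PrimeSums

/-- The primes up to `y`. -/
def primesUpTo (y : ℕ) : Finset ℕ := (Finset.range (y + 1)).filter Nat.Prime

theorem mem_primesUpTo {y p : ℕ} : p ∈ primesUpTo y ↔ p ≤ y ∧ p.Prime := by
  simp [primesUpTo]

theorem card_primesUpTo_le (y : ℕ) : (primesUpTo y).card ≤ y := by
  have : primesUpTo y ⊆ Finset.Icc 1 y := fun p hp => by
    rw [mem_primesUpTo] at hp
    exact Finset.mem_Icc.2 ⟨hp.2.one_le, hp.1⟩
  simpa using Finset.card_le_card this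

theorem sum_inv_primesUpTo_two_pow_le (K : ℕ) :
    ∑ p ∈ primesUpTo (2 ^ (K + 1)), (1 : ℝ) / p ≤ 1 / 2 + 4 * (harmonic K : ℝ) := by
  induction K with
  | zero =>
    have : primesUpTo (2 ^ (0 + 1)) = {2} := by decide
    rw [this]
    simp
  | succ k ih =>
    have hsub : primesUpTo (2 ^ (k + 1)) ⊆ primesUpTo (2 ^ (k + 1 + 1)) := fun p hp => by
      rw [mem_primesUpTo] at hp ⊢
      exact ⟨hp.1.trans (Nat.pow_le_pow_right two_pos (by omega)), hp.2⟩
    rw [← Finset.sum_sdiff hsub]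
    have hlog : (0 : ℝ) < Real.log 2 := Real.log_pos one_lt_two
    have hdy : ∑ p ∈ primesUpTo (2 ^ (k + 1 + 1)) \ primesUpTo (2 ^ (k + 1)), (1 : ℝ) / p ≤
        4 / (k + 1) := by
      calc _ ≤ ∑ p ∈ primesUpTo (2 ^ (k + 1 + 1)) \ primesUpTo (2 ^ (k + 1)),
            Real.log p / ((k + 1) * Real.log 2 * 2 ^ (k + 1)) := by
            refine Finset.sum_le_sum fun p hp => ?_
            rw [Finset.mem_sdiff, mem_primesUpTo, mem_primesUpTo] at hp
            have hlt : 2 ^ (k + 1) < p := by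
              by_contra h
              exact hp.2 ⟨not_lt.1 h, hp.1.2⟩
            have hlt' : (2 : ℝ) ^ (k + 1) < p := by exact_mod_cast hlt
            have hl : (k + 1) * Real.log 2 ≤ Real.log p := by
              have := Real.log_le_log (by positivity) hlt'.le
              rw [Real.log_pow] at this
              exact_mod_cast this
            have hp0 : (0 : ℝ) < p := lt_trans (by positivity) hlt'
            rw [div_le_div_iff₀ hp0 (by positivity), one_mul]
            exact mul_le_mul hl hlt'.le (by positivity) (le_trans (by positivity) hl)
        _ ≤ ∑ p ∈ primesUpTo (2 ^ (k + 1 + 1)),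
            Real.log p / ((k + 1) * Real.log 2 * 2 ^ (k + 1)) := by
            refine Finset.sum_le_sum_of_subset_of_nonneg Finset.sdiff_subset fun p hp _ => ?_
            have := Real.log_natCast_nonneg p
            positivity
        _ = Chebyshev.theta (2 ^ (k + 1 + 1) : ℕ) / ((k + 1) * Real.log 2 * 2 ^ (k + 1)) := by
            rw [← Finset.sum_div, Chebyshev.theta_eq_sum_Icc, Nat.floor_natCast]
            congr 1
            refine Finset.sum_congr ?_ fun _ _ => rfl
            ext p
            simp [mem_primesUpTo]
        _ ≤ Real.log 4 * (2 ^ (k + 1 + 1) : ℕ) / ((k + 1) * Real.log 2 * 2 ^ (k + 1)) := by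
            gcongr
            exact Chebyshev.theta_le_log4_mul_x (by positivity)
        _ = 4 / (k + 1) := by
            have : Real.log 4 = 2 * Real.log 2 := by
              rw [show (4 : ℝ) = 2 ^ 2 by norm_num, Real.log_pow]
              norm_num
            rw [this]
            push_cast
            field_simp
            ring
    rw [harmonic_succ]
    push_cast
    have : (4 : ℝ) / (k + 1) = 4 * (k + 1 : ℝ)⁻¹ := div_eq_mul_inv _ _
    linarith

theorem exists_sum_inv_primes_le :
    ∃ C : ℝ, ∀ L : ℝ, 1 ≤ L → ∀ y : ℕ, (y : ℝ) ≤ Real.exp L →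
      ∑ p ∈ primesUpTo y, (1 : ℝ) / p ≤ C + 4 * Real.log L := by
  refine ⟨5 + 4 * Real.log 2, fun L hL y hy => ?_⟩
  have hlog2 := Real.log_two_gt_d9
  have hlog2' := Real.log_two_lt_d9
  have hlog : (0 : ℝ) < Real.log 2 := Real.log_pos one_lt_two
  set K := ⌊2 * L⌋₊ with hK
  have hK1 : 2 * L < K + 1 := Nat.lt_floor_add_one _
  have hKL : (K : ℝ) ≤ 2 * L := Nat.floor_le (by linarith)
  have hy2 : y ≤ 2 ^ (K + 1) := by
    have : (y : ℝ) ≤ 2 ^ (K + 1) := by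
      refine hy.trans ?_
      rw [← Real.exp_log (show (0 : ℝ) < 2 ^ (K + 1) by positivity), Real.exp_le_exp, Real.log_pow]
      push_cast
      nlinarith
    exact_mod_cast this
  have hsub : primesUpTo y ⊆ primesUpTo (2 ^ (K + 1)) := fun p hp => by
    rw [mem_primesUpTo] at hp ⊢
    exact ⟨hp.1.trans hy2, hp.2⟩
  have h1 := Finset.sum_le_sum_of_subset_of_nonneg (f := fun p : ℕ => (1 : ℝ) / p) hsub
    (fun p _ _ => by positivity)
  have h2 := sum_inv_primesUpTo_two_pow_le K
  have h3 := harmonic_floor_le_one_add_log (2 * L) (by linarith)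
  rw [Real.log_mul (by norm_num) (by linarith)] at h3
  linarith

theorem prod_primes_one_sub_inv_le (y : ℕ) (hy : 1 ≤ y) :
    ∏ p ∈ primesUpTo y, (1 - 1 / (p : ℝ)) ≤ (Real.log (y + 1))⁻¹ := by
  let g : ℕ →* ℝ :=
    { toFun := fun n => (n : ℝ)⁻¹
      map_one' := by simp
      map_mul' := fun a b => by push_cast; rw [mul_inv] }
  have hg (n : ℕ) : g n = (n : ℝ)⁻¹ := rfl
  have hlt {p : ℕ} (hp : p.Prime) : ‖g p‖ < 1 := by
    rw [hg, norm_inv, Real.norm_natCast]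
    exact inv_lt_one_of_one_lt₀ (by exact_mod_cast hp.one_lt)
  obtain ⟨hs, hsum⟩ := EulerProduct.summable_and_hasSum_smoothNumbers_prod_primesBelow_geometric hlt
    (y + 1)
  have hmem (n : ℕ) (hn : n ∈ Finset.Icc 1 y) : n ∈ (y + 1).smoothNumbers := by
    rw [Finset.mem_Icc] at hn
    rw [Nat.mem_smoothNumbers]
    refine ⟨by omega, fun p hp => ?_⟩
    have := Nat.le_of_mem_primeFactorsList hp
    omega
  have hharm : Real.log (y + 1) ≤ ∏ p ∈ (y + 1).primesBelow, (1 - g p)⁻¹ := by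
    calc Real.log (y + 1) ≤ (harmonic y : ℝ) := by exact_mod_cast log_add_one_le_harmonic y
      _ = ∑ n ∈ (Finset.Icc 1 y).attach, g (⟨n.1, hmem n.1 n.2⟩ : (y + 1).smoothNumbers) := by
          rw [harmonic_eq_sum_Icc, Finset.sum_attach (Finset.Icc 1 y) (fun n => g n)]
          push_cast
          rfl
      _ = ∑ n ∈ (Finset.Icc 1 y).attach.map
            ⟨fun n => (⟨n.1, hmem n.1 n.2⟩ : (y + 1).smoothNumbers), fun a b hab =>
              Subtype.ext (Subtype.mk.inj hab)⟩, g n := by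
          rw [Finset.sum_map]
          rfl
      _ ≤ _ := sum_le_hasSum _ (fun n _ => by rw [hg]; positivity) hsum
  have hlog : 0 < Real.log (y + 1) := Real.log_pos (by
    have : (1 : ℝ) ≤ y := by exact_mod_cast hy
    linarith)
  rw [Finset.prod_inv_distrib] at hharm
  have := inv_anti₀ hlog hharm
  rw [inv_inv] at this
  refine le_trans (le_of_eq ?_) this
  exact Finset.prod_congr rfl fun p _ => by rw [hg, one_div]

theorem sum_inv_le_two_add_log (S : Finset ℕ) (hS : ∀ n ∈ S, 1 ≤ n) {B : ℝ} (hB : 1 ≤ B)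
    (hcard : (S.card : ℝ) ≤ B) : ∑ n ∈ S, (1 : ℝ) / n ≤ 2 + Real.log B := by
  rw [← Finset.sum_filter_add_sum_filter_not S (fun n => n ≤ ⌊B⌋₊)]
  have h1 : ∑ n ∈ S.filter (fun n => n ≤ ⌊B⌋₊), (1 : ℝ) / n ≤ 1 + Real.log B := by
    have hsub : S.filter (fun n => n ≤ ⌊B⌋₊) ⊆ Finset.Icc 1 ⌊B⌋₊ := fun n hn => by
      rw [Finset.mem_filter] at hn
      exact Finset.mem_Icc.2 ⟨hS n hn.1, hn.2⟩
    refine (Finset.sum_le_sum_of_subset_of_nonneg hsub fun n _ _ => by positivity).trans ?_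
    refine le_trans (le_of_eq ?_) (harmonic_floor_le_one_add_log B hB)
    rw [harmonic_eq_sum_Icc]
    push_cast
    simp
  have h2 : ∑ n ∈ S.filter (fun n => ¬ n ≤ ⌊B⌋₊), (1 : ℝ) / n ≤ 1 := by
    calc _ ≤ ∑ n ∈ S.filter (fun n => ¬ n ≤ ⌊B⌋₊), 1 / B := by
          refine Finset.sum_le_sum fun n hn => ?_
          rw [Finset.mem_filter, not_le, Nat.floor_lt (by linarith)] at hn
          exact one_div_le_one_div_of_le (by linarith) hn.2.le
      _ ≤ S.card * (1 / B) := by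
          rw [Finset.sum_const, nsmul_eq_mul]
          gcongr
          exact Finset.filter_subset _ _
      _ ≤ 1 := by
          rw [mul_one_div]
          exact div_le_one_of_le₀ hcard (by linarith)
  linarith

theorem card_primes_dvd_le (S : Finset ℕ) (hS : ∀ p ∈ S, p.Prime) (n : ℤ) (hn : n ≠ 0)
    (hdvd : ∀ p ∈ S, (p : ℤ) ∣ n) : (S.card : ℝ) ≤ 2 * Real.log |(n : ℝ)| := by
  have h1 : ∏ p ∈ S, p ∣ n.natAbs := by
    refine Finset.prod_primes_dvd _ (fun p hp => (hS p hp).prime) fun p hp => ?_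
    exact Int.natCast_dvd.1 (hdvd p hp)
  have h2 : 2 ^ S.card ≤ n.natAbs := by
    calc 2 ^ S.card = ∏ _p ∈ S, 2 := by rw [Finset.prod_const]
      _ ≤ ∏ p ∈ S, p := Finset.prod_le_prod' fun p hp => (hS p hp).two_le
      _ ≤ n.natAbs := Nat.le_of_dvd (Int.natAbs_pos.2 hn) h1
  have h3 : (2 : ℝ) ^ S.card ≤ |(n : ℝ)| := by
    have : ((2 ^ S.card : ℕ) : ℝ) ≤ (n.natAbs : ℝ) := by exact_mod_cast h2
    rw [Nat.cast_natAbs] at this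
    exact_mod_cast this
  have h4 := Real.log_le_log (by positivity) h3
  rw [Real.log_pow] at h4
  nlinarith [Real.log_two_gt_d9, (Nat.cast_nonneg S.card : (0 : ℝ) ≤ S.card)]

end PrimeSums

section SieveAsymptotics

theorem eventually_mul_log_le_rpow (c : ℝ) {δ : ℝ} (hδ : 0 < δ) :
    ∀ᶠ L : ℝ in atTop, c * Real.log L ≤ L ^ δ := by
  have h := (isLittleO_log_rpow_atTop hδ).bound (show 0 < (|c| + 1)⁻¹ by positivity)
  filter_upwards [h, eventually_ge_atTop 1] with L hL hL1
  have hlog : 0 ≤ Real.log L := Real.log_nonneg hL1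
  rw [Real.norm_of_nonneg hlog, Real.norm_of_nonneg (Real.rpow_nonneg (by linarith) δ),
    inv_mul_eq_div, le_div_iff₀ (by positivity)] at hL
  nlinarith [le_abs_self c]

/-- Brun's pure sieve in an asymptotic form, losing only a small power of the logarithm. -/
theorem eventually_sieve_bound (D : ℕ) (hD : 1 ≤ D) (A : ℝ) {δ : ℝ} (hδ : 0 < δ) :
    ∀ᶠ L : ℝ in atTop, ∃ y : ℕ, 1 ≤ y ∧ (y : ℝ) ≤ Real.exp (L / 2) ∧
      L ^ (1 - δ) ≤ Real.log (y + 1) ∧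
      ∀ P ⊆ primesUpTo y, ∀ Ω : ℕ → Finset ℕ, (∀ p ∈ P, Ω p ⊆ Finset.range p) →
        (∀ p ∈ P, (Ω p).card ≤ D) → ∀ X : ℕ, (X : ℝ) ≤ Real.exp L →
          (((Finset.Ioc 0 X).filter (fun n => ∀ p ∈ P, n % p ∉ Ω p)).card : ℝ) ≤
            Real.exp L * ∏ p ∈ P, (1 - ((Ω p).card : ℝ) / p) +
              2 * (Real.exp L * L ^ (-A)) := by
  obtain ⟨C, hC⟩ := exists_sum_inv_primes_le
  have hE : 0 < Real.exp 1 := Real.exp_pos 1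
  have hDr : (1 : ℝ) ≤ D := by exact_mod_cast hD
  set a : ℝ := 2 * Real.exp 1 * D + |A| + 1 with ha
  have ha1 : 1 ≤ a := by
    have : 0 ≤ 2 * Real.exp 1 * D + |A| := by positivity
    linarith
  filter_upwards [eventually_mul_log_le_rpow (12 * a) hδ,
    eventually_mul_log_le_rpow (4 * (3 * a * Real.log D + A + 1)) one_pos,
    Real.tendsto_log_atTop.eventually_ge_atTop (Real.exp 1 * D * C),
    Real.tendsto_log_atTop.eventually_ge_atTop 2, eventually_ge_atTop 1]
    with L h1 h2 h3 h4 hL1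
  rw [Real.rpow_one] at h2
  have hL0 : 0 < L := by linarith
  have hlog0 : 0 < Real.log L := by linarith
  have halog : 2 ≤ a * Real.log L := by nlinarith
  set w : ℝ := L / (12 * a * Real.log L) with hw
  have hw0 : 0 < w := by positivity
  have hwL : w ≤ L / 2 := by
    rw [hw]
    exact div_le_div_of_nonneg_left hL0.le two_pos (by nlinarith)
  have hz1 : 1 ≤ Real.exp w := Real.one_le_exp hw0.le
  have hyle : (⌊Real.exp w⌋₊ : ℝ) ≤ Real.exp w := Nat.floor_le (Real.exp_pos _).le
  refine ⟨⌊Real.exp w⌋₊, Nat.le_floor (by simpa using hz1),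
    hyle.trans (Real.exp_le_exp.2 hwL), ?_, ?_⟩
  · have hlog : w ≤ Real.log (⌊Real.exp w⌋₊ + 1) := by
      rw [Real.le_log_iff_exp_le (by positivity)]
      exact (Nat.lt_floor_add_one _).le
    refine le_trans ?_ hlog
    rw [Real.rpow_sub hL0, Real.rpow_one, hw]
    exact div_le_div_of_nonneg_left hL0.le (by positivity) h1
  intro P hP Ω hΩ hΩD X hX
  set s := ⌈a * Real.log L⌉₊ with hs
  have hs1 : a * Real.log L ≤ s := Nat.le_ceil _
  have hs2 : (s : ℝ) < a * Real.log L + 1 := Nat.ceil_lt_add_one (by positivity)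
  have hexpA : Real.exp L * L ^ (-A) = Real.exp (L - A * Real.log L) := by
    rw [Real.rpow_def_of_pos hL0, ← Real.exp_add]
    ring_nf
  have hbrun := brun_pure_sieve P (fun p hp => (mem_primesUpTo.1 (hP hp)).2) Ω hΩ X s
  have hsum : ∑ p ∈ P, ((Ω p).card : ℝ) / p ≤ D * (C + 4 * Real.log L) := by
    calc ∑ p ∈ P, ((Ω p).card : ℝ) / p ≤ ∑ p ∈ P, D * ((1 : ℝ) / p) := by
          refine Finset.sum_le_sum fun p hp => ?_
          rw [mul_one_div]
          have : ((Ω p).card : ℝ) ≤ D := by exact_mod_cast hΩD p hp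
          gcongr
      _ = D * ∑ p ∈ P, (1 : ℝ) / p := by rw [Finset.mul_sum]
      _ ≤ D * ∑ p ∈ primesUpTo ⌊Real.exp w⌋₊, (1 : ℝ) / p := by
          gcongr
      _ ≤ D * (C + 4 * Real.log L) := by
          gcongr
          exact hC L hL1 _ (hyle.trans (Real.exp_le_exp.2 (by linarith)))
  have htail : elemSym P (fun p => ((Ω p).card : ℝ) / p) (2 * s + 1) ≤ L ^ (-A) := by
    refine (elemSym_le_exp P _ (fun p _ => by positivity) _).trans ?_
    rw [Real.rpow_def_of_pos hL0, Real.exp_le_exp]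
    push_cast
    have h5 := mul_le_mul_of_nonneg_left hsum hE.le
    have h6 : A * Real.log L ≤ |A| * Real.log L :=
      mul_le_mul_of_nonneg_right (le_abs_self A) hlog0.le
    have h7 : |A| * Real.log L ≥ 0 := by positivity
    have h8 : a * Real.log L = 2 * Real.exp 1 * D * Real.log L + |A| * Real.log L +
      Real.log L := by rw [ha]; ring
    nlinarith
  have herr : (∑ T ∈ P.powerset, if T.card ≤ 2 * s then ∏ p ∈ T, ((Ω p).card : ℝ) else 0) ≤
      Real.exp L * L ^ (-A) := by
    refine (sum_powerset_card_le P (fun p => ((Ω p).card : ℝ)) hDr hz1 ?_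
      (fun p _ => by positivity) (fun p hp => by exact_mod_cast hΩD p hp) (2 * s)).trans ?_
    · refine le_trans ?_ hyle
      exact_mod_cast (Finset.card_le_card hP).trans (card_primesUpTo_le _)
    · have hD' : (D : ℝ) = Real.exp (Real.log D) := (Real.exp_log (by linarith)).symm
      have hlD : 0 ≤ Real.log D := Real.log_nonneg hDr
      rw [hexpA, show (D : ℝ) * Real.exp w = Real.exp (Real.log D + w) by
        rw [Real.exp_add, ← hD'], ← Real.exp_nat_mul, ← Real.exp_add, Real.exp_le_exp]
      push_cast
      have h5 : 2 * (s : ℝ) ≤ 3 * (a * Real.log L) := by linarith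
      have h6 : 2 * (s : ℝ) * (Real.log D + w) ≤ 3 * (a * Real.log L) * (Real.log D + w) :=
        mul_le_mul_of_nonneg_right h5 (by linarith)
      have h7 : 3 * (a * Real.log L) * w = L / 4 := by
        rw [hw]
        field_simp
        norm_num
      nlinarith
  have hX0 : (0 : ℝ) ≤ X := Nat.cast_nonneg X
  have hprod0 : 0 ≤ ∏ p ∈ P, (1 - ((Ω p).card : ℝ) / p) := by
    refine Finset.prod_nonneg fun p hp => sub_nonneg.2 ?_
    refine div_le_one_of_le₀ ?_ (by positivity)
    exact_mod_cast (Finset.card_le_card (hΩ p hp)).trans (Finset.card_range p).le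
  have hA0 : 0 ≤ L ^ (-A) := by positivity
  calc _ ≤ _ := hbrun
    _ ≤ X * (∏ p ∈ P, (1 - ((Ω p).card : ℝ) / p) + L ^ (-A)) + Real.exp L * L ^ (-A) := by
        gcongr
    _ ≤ Real.exp L * (∏ p ∈ P, (1 - ((Ω p).card : ℝ) / p) + L ^ (-A)) +
        Real.exp L * L ^ (-A) := by gcongr
    _ = _ := by ring

end SieveAsymptotics

section Zeros

open Polynomial

/-- The number of zeros of `g` in `ℤ/pℤ`. -/
noncomputable def zeroCount (g : ℤ[X]) (p : ℕ) : ℕ := {x : ZMod p | aeval x g = 0}.ncard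

theorem aeval_comp_X_add_C {p : ℕ} (g : ℤ[X]) (a : ℤ) (x : ZMod p) :
    aeval x (g.comp (X + C a)) = aeval (x + (a : ZMod p)) g := by
  rw [aeval_comp]
  simp

theorem zeroCount_comp_X_add_C (g : ℤ[X]) (a : ℤ) (p : ℕ) :
    zeroCount (g.comp (X + C a)) p = zeroCount g p := by
  unfold zeroCount
  rw [← Set.ncard_image_of_injective _ (add_left_injective (a : ZMod p))]
  congr 1
  ext x
  simp only [Set.mem_image, Set.mem_ofPred_eq, aeval_comp_X_add_C]
  constructor
  · rintro ⟨y, hy, rfl⟩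
    exact hy
  · intro hx
    exact ⟨x - a, by simpa using hx, by simp⟩

theorem zeroCount_le_natDegree {g : ℤ[X]} (hg : g.content = 1) {p : ℕ} (hp : p.Prime) :
    zeroCount g p ≤ g.natDegree := by
  have := Fact.mk hp
  have hmap : g.map (Int.castRingHom (ZMod p)) ≠ 0 := by
    intro h
    have hdvd : C (p : ℤ) ∣ g := by
      rw [C_dvd_iff_dvd_coeff]
      intro i
      have := congrArg (fun q => coeff q i) h
      simpa [ZMod.intCast_zmod_eq_zero_iff_dvd] using this
    have := (isPrimitive_iff_content_eq_one.2 hg) _ hdvd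
    exact (Nat.prime_iff_prime_int.1 hp).not_isUnit this
  have hset : {x : ZMod p | aeval x g = 0} =
      ((g.map (Int.castRingHom (ZMod p))).roots.toFinset : Set (ZMod p)) := by
    ext x
    simp [hmap, aeval_def, eval_map]
  rw [zeroCount, hset, Set.ncard_coe_finset]
  exact (Multiset.toFinset_card_le _).trans ((card_roots' _).trans (natDegree_map_le))

theorem nuPoly_le_sum_zeroCount {ι : Type*} [Fintype ι] (g : ι → ℤ[X]) {p : ℕ} (hp : p.Prime) :
    nuPoly g p ≤ ∑ j, zeroCount (g j) p := by
  have := Fact.mk hp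
  have : {x : ZMod p | ∃ j, aeval x (g j) = 0} =
      ⋃ j ∈ (Finset.univ : Finset ι), {x : ZMod p | aeval x (g j) = 0} := by
    ext x
    simp
  rw [nuPoly, this]
  exact Finset.set_ncard_biUnion_le _ _

theorem sum_zeroCount_le_nuPoly {ι : Type*} [Fintype ι] (g : ι → ℤ[X]) {p : ℕ} (hp : p.Prime)
    (J : Finset ι) (hJ : ∀ a ∈ J, ∀ b ∈ J, a ≠ b → ∀ x : ZMod p,
      ¬ (aeval x (g a) = 0 ∧ aeval x (g b) = 0)) :
    ∑ j ∈ J, zeroCount (g j) p ≤ nuPoly g p := by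
  have := Fact.mk hp
  classical
  have h1 : ∑ j ∈ J, zeroCount (g j) p =
      (J.biUnion fun j => Finset.univ.filter fun x : ZMod p => aeval x (g j) = 0).card := by
    rw [Finset.card_biUnion]
    · refine Finset.sum_congr rfl fun j _ => ?_
      rw [zeroCount, ← Set.ncard_coe_finset]
      simp
    · intro a ha b hb hab
      rw [Function.onFun, Finset.disjoint_left]
      intro x hxa hxb
      simp only [Finset.mem_filter] at hxa hxb
      exact hJ a ha b hb hab x ⟨hxa.2, hxb.2⟩
  rw [h1, nuPoly, ← Set.ncard_coe_finset]
  refine Set.ncard_le_ncard ?_ (Set.toFinite _)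
  intro x hx
  simp only [Finset.coe_biUnion, Set.mem_iUnion, Finset.coe_filter] at hx
  obtain ⟨j, _, hj⟩ := hx
  exact ⟨j, hj.2⟩

end Zeros

section Resultant

open Polynomial

theorem exists_abs_eval_le (Q : ℤ[X]) :
    ∃ c : ℕ, ∀ d : ℤ, |((Q.eval d : ℤ) : ℝ)| ≤ (c + 1) * (1 + |(d : ℝ)|) ^ c := by
  refine ⟨max Q.natDegree (∑ i ∈ Finset.range (Q.natDegree + 1), (Q.coeff i).natAbs), fun d => ?_⟩
  set S := ∑ i ∈ Finset.range (Q.natDegree + 1), (Q.coeff i).natAbs with hS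
  have h1 : (1 : ℝ) ≤ 1 + |(d : ℝ)| := by linarith [abs_nonneg (d : ℝ)]
  have h2 : |((Q.eval d : ℤ) : ℝ)| ≤ S * (1 + |(d : ℝ)|) ^ Q.natDegree := by
    rw [eval_eq_sum_range]
    push_cast
    refine (Finset.abs_sum_le_sum_abs _ _).trans ?_
    rw [hS, Nat.cast_sum, Finset.sum_mul]
    refine Finset.sum_le_sum fun i hi => ?_
    rw [abs_mul, abs_pow, Nat.cast_natAbs, Int.cast_abs]
    gcongr
    calc |(d : ℝ)| ^ i ≤ (1 + |(d : ℝ)|) ^ i := by gcongr; linarith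
      _ ≤ _ := pow_le_pow_right₀ h1 (by simpa [Nat.lt_succ_iff] using hi)
  refine h2.trans ?_
  gcongr
  · have : (S : ℝ) ≤ (max Q.natDegree S : ℕ) := by exact_mod_cast le_max_right _ _
    linarith
  · exact le_max_left _ _

theorem isCoprime_map_of_ne {a b : ℤ[X]} (ha : Irreducible a) (hb : Irreducible b)
    (hac : a.content = 1) (hbc : b.content = 1) (hal : 0 < a.leadingCoeff)
    (hbl : 0 < b.leadingCoeff) (hab : a ≠ b) :
    IsCoprime (a.map (Int.castRingHom ℚ)) (b.map (Int.castRingHom ℚ)) := by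
  have hap := isPrimitive_iff_content_eq_one.2 hac
  have hbp := isPrimitive_iff_content_eq_one.2 hbc
  have ha' := (IsPrimitive.Int.irreducible_iff_irreducible_map_cast hap).1 ha
  have hb' := (IsPrimitive.Int.irreducible_iff_irreducible_map_cast hbp).1 hb
  by_contra h
  have hdvd : a.map (Int.castRingHom ℚ) ∣ b.map (Int.castRingHom ℚ) := by
    by_contra h'
    exact h ((ha'.coprime_iff_not_dvd).2 h')
  rw [← IsPrimitive.Int.dvd_iff_map_cast_dvd_map_cast _ _ hap] at hdvd
  obtain ⟨u, hu⟩ := (ha.associated_of_dvd hb hdvd)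
  obtain ⟨r, hr, hru⟩ := isUnit_iff.1 u.isUnit
  rw [← hru] at hu
  rcases Int.isUnit_iff.1 hr with rfl | rfl
  · exact hab (by simpa using hu)
  · rw [← hu] at hbl
    simp at hbl
    omega

theorem comp_X_add_C_props {a : ℤ[X]} (ha : Irreducible a) (hd : 1 ≤ a.natDegree)
    (hl : 0 < a.leadingCoeff) (d : ℤ) :
    Irreducible (a.comp (X + C d)) ∧ (a.comp (X + C d)).natDegree = a.natDegree ∧
      0 < (a.comp (X + C d)).leadingCoeff ∧ (a.comp (X + C d)).content = 1 := by
  have hdeg : (a.comp (X + C d)).natDegree = a.natDegree := by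
    rw [natDegree_comp, natDegree_X_add_C, mul_one]
  have hirr : Irreducible (a.comp (X + C d)) := by
    have := (MulEquiv.irreducible_iff (algEquivAevalXAddC d) (x := a)).2 ha
    simpa [comp, aeval_def] using this
  refine ⟨hirr, hdeg, ?_, ?_⟩
  · rw [leadingCoeff_comp (by rw [natDegree_X_add_C]; exact one_ne_zero), leadingCoeff_X_add_C,
      one_pow, mul_one]
    exact hl
  · rw [← isPrimitive_iff_content_eq_one]
    exact hirr.isPrimitive (by omega)

/-- Translates of `a` that differ from `b` have a common zero modulo few primes only. -/
theorem exists_common_zero_dvd {a b : ℤ[X]} (ha : Irreducible a) (had : 1 ≤ a.natDegree)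
    (hal : 0 < a.leadingCoeff) (hb : Irreducible b)
    (hbl : 0 < b.leadingCoeff) (hbc : b.content = 1) :
    ∃ c : ℕ, ∀ d : ℤ, a.comp (X + C d) ≠ b → ∃ R : ℤ, R ≠ 0 ∧
      |(R : ℝ)| ≤ (c + 1) * (1 + |(d : ℝ)|) ^ c ∧
      ∀ p : ℕ, ∀ x : ZMod p, aeval x (a.comp (X + C d)) = 0 → aeval x b = 0 → (p : ℤ) ∣ R := by
  set Q : ℤ[X] := resultant ((a.map (C : ℤ →+* ℤ[X])).comp (X + C X)) (b.map C)
    a.natDegree b.natDegree with hQ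
  obtain ⟨c, hc⟩ := exists_abs_eval_le Q
  refine ⟨c, fun d hne => ⟨Q.eval d, ?_, hc d, ?_⟩⟩
  all_goals
    have hprops := comp_X_add_C_props ha had hal d
    have hev : Q.eval d = resultant (a.comp (X + C d)) b a.natDegree b.natDegree := by
      rw [← coe_evalRingHom, hQ, ← resultant_map_map]
      congr 1
      · rw [Polynomial.map_comp, Polynomial.map_map]
        have : (evalRingHom d).comp (C : ℤ →+* ℤ[X]) = RingHom.id ℤ := by ext; simp
        simp [this]
      · rw [Polynomial.map_map]
        have : (evalRingHom d).comp (C : ℤ →+* ℤ[X]) = RingHom.id ℤ := by ext; simp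
        simp [this]
    rw [hev]
  · have hcop := isCoprime_map_of_ne hprops.1 hb hprops.2.2.2 hbc hprops.2.2.1 hbl hne
    have hres := resultant_ne_zero _ _ hcop
    rw [natDegree_map_eq_of_injective (Int.castRingHom ℚ).injective_int,
      natDegree_map_eq_of_injective (Int.castRingHom ℚ).injective_int, resultant_map_map,
      hprops.2.1] at hres
    intro h
    rw [h] at hres
    simp at hres
  · intro p x hxa hxb
    obtain ⟨u, v, _, _, huv⟩ := exists_mul_add_mul_eq_C_resultant (a.comp (X + C d)) b
      hprops.2.1.le le_rfl (Or.inl (by omega))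
    have := congrArg (aeval x) huv
    rw [map_add, map_mul, map_mul, hxa, hxb, zero_mul, zero_mul, add_zero] at this
    rw [← ZMod.intCast_zmod_eq_zero_iff_dvd]
    simpa using this.symm

end Resultant

section Translates

open Polynomial

theorem comp_X_add_C_comp (g : ℤ[X]) (a b : ℤ) :
    (g.comp (X + C a)).comp (X + C b) = g.comp (X + C (a + b)) := by
  rw [comp_assoc]
  congr 1
  simp only [add_comp, X_comp, C_comp, C_add]
  ring

theorem comp_X_add_C_injective {g : ℤ[X]} (hd : 1 ≤ g.natDegree) :
    Function.Injective fun a : ℤ => g.comp (X + C a) := by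
  intro a b hab
  by_contra hne
  have hstep : ∀ x : ℤ, g.eval (x + (b - a)) = g.eval x := by
    intro x
    have := congrArg (eval (x - a)) hab
    simp only [eval_comp, eval_add, eval_X, eval_C, sub_add_cancel] at this
    rw [this]
    congr 1
    ring
  have hn : ∀ n : ℕ, g.eval (n * (b - a)) = g.eval 0 := by
    intro n
    induction n with
    | zero => simp
    | succ n ih => rw [← ih, ← hstep (n * (b - a))]; congr 1; push_cast; ring
  have hinj : Function.Injective fun n : ℕ => (n : ℤ) * (b - a) := by
    intro n n' h
    have h' := mul_right_cancel₀ (sub_ne_zero.2 (Ne.symm hne)) h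
    exact_mod_cast h'
  have := eq_of_infinite_eval_eq g (C (g.eval 0)) ((Set.infinite_range_of_injective hinj).mono (by
    rintro _ ⟨n, rfl⟩
    simpa using hn n))
  rw [this, natDegree_C] at hd
  omega

theorem exists_shift_bound {m : ℕ} (f : Fin m → ℤ[X]) (hd : ∀ j, 1 ≤ (f j).natDegree) :
    ∃ M : ℕ, ∀ j j' (d : ℤ), (f j).comp (X + C d) = f j' → |d| ≤ M := by
  have h : ∀ j j', ∃ D : ℕ, ∀ d : ℤ, (f j).comp (X + C d) = f j' → |d| ≤ D := by
    intro j j'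
    by_cases he : ∃ d : ℤ, (f j).comp (X + C d) = f j'
    · obtain ⟨d, he⟩ := he
      refine ⟨d.natAbs, fun d' he' => ?_⟩
      rw [comp_X_add_C_injective (hd j) (he'.trans he.symm), Int.natCast_natAbs]
    · exact ⟨0, fun d hd => absurd ⟨d, hd⟩ he⟩
  choose D hD using h
  refine ⟨∑ j, ∑ j', D j j', fun j j' d he => (hD j j' d he).trans ?_⟩
  have h1 : D j j' ≤ ∑ j', D j j' :=
    Finset.single_le_sum (f := fun j' => D j j') (fun _ _ => Nat.zero_le _) (Finset.mem_univ _)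
  have h2 : ∑ j', D j j' ≤ ∑ j, ∑ j', D j j' :=
    Finset.single_le_sum (f := fun j => ∑ j', D j j') (fun _ _ => Nat.zero_le _)
      (Finset.mem_univ _)
  exact_mod_cast h1.trans h2

/-- A finite family is not stable under a nontrivial translation. -/
theorem exists_translate_not_mem {m : ℕ} (f : Fin m → ℤ[X]) (hd : ∀ j, 1 ≤ (f j).natDegree)
    {δ : ℤ} (hδ : δ ≠ 0) (j₀ : Fin m) :
    ∃ j, (∃ a : ℤ, f j = (f j₀).comp (X + C a)) ∧ ∀ j', (f j).comp (X + C δ) ≠ f j' := by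
  by_contra! h
  have hn : ∀ n : ℕ, ∃ j, f j = (f j₀).comp (X + C (n * δ)) := by
    intro n
    induction n with
    | zero => exact ⟨j₀, by simp⟩
    | succ n ih =>
      obtain ⟨j, hj⟩ := ih
      obtain ⟨j', hj'⟩ := h j ⟨_, hj⟩
      refine ⟨j', ?_⟩
      rw [← hj', hj, comp_X_add_C_comp]
      congr 3
      push_cast
      ring
  choose J hJ using hn
  refine not_injective_infinite_finite J fun n n' he => ?_
  have h1 := comp_X_add_C_injective (hd j₀) ((hJ n).symm.trans ((congrArg f he).trans (hJ n')))
  exact_mod_cast mul_right_cancel₀ hδ h1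

theorem comp_eq_comp_iff (g g' : ℤ[X]) (a b : ℤ) :
    g.comp (X + C a) = g'.comp (X + C b) ↔ g.comp (X + C (a - b)) = g' := by
  constructor
  · intro h
    have := congrArg (fun q => q.comp (X + C (-b))) h
    simpa only [comp_X_add_C_comp, add_neg_cancel, C_0, add_zero, comp_X, ← sub_eq_add_neg]
      using this
  · rintro rfl
    rw [comp_X_add_C_comp, sub_add_cancel]

end Translates

section Leaders

open Polynomial

variable {m k : ℕ}

/-- The indices of entries of `t` that do not exceed another entry by at most `M`. -/
def leaders (M : ℕ) (t : Fin k → ℕ) : Finset (Fin k) :=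
  Finset.univ.filter fun i => ∀ i', t i' < t i → t i' + M < t i

theorem mem_leaders {M : ℕ} {t : Fin k → ℕ} {i : Fin k} :
    i ∈ leaders M t ↔ ∀ i', t i' < t i → t i' + M < t i := by
  simp [leaders]

theorem exists_leader_le (M : ℕ) (t : Fin k → ℕ) (i : Fin k) :
    ∃ l ∈ leaders M t, t l ≤ t i ∧
      t i ≤ t l + M * (Finset.univ.filter fun i' => t i' < t i).card := by
  induction hn : t i using Nat.strong_induction_on generalizing i with
  | _ n ih =>
    subst hn
    by_cases hi : i ∈ leaders M t
    · exact ⟨i, hi, le_rfl, Nat.le_add_right _ _⟩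
    · rw [mem_leaders] at hi
      push Not at hi
      obtain ⟨i', hlt, hle⟩ := hi
      obtain ⟨l, hl, h1, h2⟩ := ih (t i') hlt i' rfl
      refine ⟨l, hl, h1.trans hlt.le, ?_⟩
      have hcard : (Finset.univ.filter fun i'' => t i'' < t i').card + 1 ≤
          (Finset.univ.filter fun i'' => t i'' < t i).card := by
        refine Finset.card_lt_card ⟨fun x hx => ?_, fun h => ?_⟩
        · simp only [Finset.mem_filter, Finset.mem_univ, true_and] at hx ⊢
          exact hx.trans hlt
        · have := h (by simpa using hlt : i' ∈ _)
          simp at this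
      nlinarith [Nat.mul_le_mul_left M hcard]

theorem card_filter_leaders_le (M H : ℕ) (I : Finset (Fin k)) :
    ((distinctTuples k H).filter fun t => leaders M t = I).card ≤
      H ^ I.card * (k * (k * M + 1)) ^ k := by
  set U := Fintype.piFinset fun i : Fin k => if i ∈ I then Finset.Icc 1 H else {0} with hU
  have hUcard : U.card = H ^ I.card := by
    rw [hU, Fintype.card_piFinset]
    have : ∀ i : Fin k, (if i ∈ I then Finset.Icc 1 H else {0}).card = if i ∈ I then H else 1 := by
      intro i
      split_ifs <;> simp
    simp [this]
  have hsub : ((distinctTuples k H).filter fun t => leaders M t = I) ⊆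
      (U ×ˢ (Finset.univ : Finset (Fin k → Fin k × Fin (k * M + 1)))).image
        fun uv i => uv.1 (uv.2 i).1 + ((uv.2 i).2 : ℕ) := by
    intro t ht
    simp only [distinctTuples, Finset.mem_filter, Fintype.mem_piFinset] at ht
    obtain ⟨⟨htH, _⟩, rfl⟩ := ht
    choose l hl h1 h2 using exists_leader_le M t
    have h3 : ∀ i, t i - t (l i) < k * M + 1 := by
      intro i
      have hc : (Finset.univ.filter fun i' => t i' < t i).card ≤ k :=
        (Finset.card_le_univ _).trans (by simp)
      have := h2 i
      have := Nat.mul_le_mul_left M hc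
      rw [mul_comm k M]
      omega
    refine Finset.mem_image.2 ⟨(fun i => if i ∈ leaders M t then t i else 0,
      fun i => (l i, ⟨t i - t (l i), h3 i⟩)), ?_, ?_⟩
    · simp only [Finset.mem_product, Finset.mem_univ, and_true, hU, Fintype.mem_piFinset]
      intro i
      split_ifs with hi
      · exact htH i
      · simp
    · funext i
      simp only [hl i, if_true]
      have := h1 i
      omega
  refine (Finset.card_le_card hsub).trans (Finset.card_image_le.trans ?_)
  rw [Finset.card_product, hUcard]
  simp

theorem shiftFamily_eq_iff {f : Fin m → ℤ[X]} {t : Fin k → ℕ} {a b : Fin m × Fin k} :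
    shiftFamily f t a = shiftFamily f t b ↔
      (f a.1).comp (X + C ((t a.2 : ℤ) - t b.2)) = f b.1 :=
  comp_eq_comp_iff _ _ _ _

theorem zeroCount_shiftFamily (f : Fin m → ℤ[X]) (t : Fin k → ℕ) (a : Fin m × Fin k) (p : ℕ) :
    zeroCount (shiftFamily f t a) p = zeroCount (f a.1) p :=
  zeroCount_comp_X_add_C _ _ _

theorem exists_not_leader {f : Fin m → ℤ[X]} (hf : IsPrimitiveFamily f) {M : ℕ}
    (hM : ∀ j j' (d : ℤ), (f j).comp (X + C d) = f j' → |d| ≤ M) (hk : 1 ≤ k) {t : Fin k → ℕ}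
    (hinj : Function.Injective t) (ht : ¬ IsPrimitiveFamily (shiftFamily f t)) :
    ∃ i₀ ∈ leaders M t, ∃ i₁ ∉ leaders M t, t i₀ < t i₁ ∧ t i₁ ≤ t i₀ + M := by
  have hne : ∃ i, i ∉ leaders M t := by
    by_contra! hall
    obtain ⟨⟨j⟩, hfinj, hprop⟩ := hf
    refine ht ⟨⟨(j, ⟨0, hk⟩)⟩, fun a b hab => ?_, fun a => ?_⟩
    · rw [shiftFamily_eq_iff] at hab
      have habs := abs_le.1 (hM _ _ _ hab)
      have heq : t a.2 = t b.2 := by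
        rcases lt_trichotomy (t a.2) (t b.2) with h | h | h
        · have := mem_leaders.1 (hall b.2) a.2 h
          omega
        · exact h
        · have := mem_leaders.1 (hall a.2) b.2 h
          omega
      rw [heq, sub_self, C_0, add_zero, comp_X] at hab
      exact Prod.ext (hfinj hab) (hinj heq)
    · obtain ⟨h1, h2, h3, h4⟩ := hprop a.1
      obtain ⟨g1, g2, g3, g4⟩ := comp_X_add_C_props h1 h2 h3 (t a.2)
      exact ⟨g1, g2 ▸ h2, g3, g4⟩
  obtain ⟨i₁, hi₁, hmin⟩ := Finset.exists_min_image (Finset.univ.filter fun i => i ∉ leaders M t) t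
    (by obtain ⟨i, hi⟩ := hne; exact ⟨i, by simpa using hi⟩)
  simp only [Finset.mem_filter, Finset.mem_univ, true_and] at hi₁ hmin
  have hi₁' := hi₁
  rw [mem_leaders] at hi₁'
  push Not at hi₁'
  obtain ⟨i₀, hlt, hle⟩ := hi₁'
  refine ⟨i₀, ?_, i₁, hi₁, hlt, hle⟩
  by_contra h
  exact absurd (hmin i₀ h) (not_le.2 hlt)

theorem le_nuPoly_shiftFamily {f : Fin m → ℤ[X]} (hf : IsPrimitiveFamily f) {M : ℕ}
    (hM : ∀ j j' (d : ℤ), (f j).comp (X + C d) = f j' → |d| ≤ M) (hk : 1 ≤ k) {t : Fin k → ℕ}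
    (hinj : Function.Injective t) (ht : ¬ IsPrimitiveFamily (shiftFamily f t)) {p : ℕ}
    (hp : p.Prime) (hgood : ∀ a b, shiftFamily f t a ≠ shiftFamily f t b → ∀ x : ZMod p,
      ¬ (aeval x (shiftFamily f t a) = 0 ∧ aeval x (shiftFamily f t b) = 0)) :
    (m * (leaders M t).card + 1) * nuPoly f p ≤ m * nuPoly (shiftFamily f t) p := by
  classical
  obtain ⟨i₀, hi₀, i₁, hi₁, hlt, hle⟩ := exists_not_leader hf hM hk hinj ht
  obtain ⟨_, hfinj, hprop⟩ := hf
  have key : ∀ j₀, (leaders M t).card * ∑ j, zeroCount (f j) p + zeroCount (f j₀) p ≤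
      nuPoly (shiftFamily f t) p := by
    intro j₀
    obtain ⟨j, ⟨a, ha⟩, hj⟩ := exists_translate_not_mem f (fun j => (hprop j).2.1)
      (δ := (t i₁ : ℤ) - t i₀) (by omega) j₀
    have hnew : ∀ b : Fin m × Fin k, b.2 ∈ leaders M t →
        shiftFamily f t (j, i₁) ≠ shiftFamily f t b := by
      intro b hb heq
      rw [shiftFamily_eq_iff] at heq
      have habs := abs_le.1 (hM _ _ _ heq)
      by_cases hbi : b.2 = i₀
      · rw [hbi] at heq
        exact hj _ heq
      · have h0 : t b.2 ≠ t i₀ := fun h => hbi (hinj h)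
        have h1 : t b.2 ≠ t i₁ := fun h => hi₁ (hinj h ▸ hb)
        simp only at habs
        rcases lt_or_gt_of_ne h0 with h | h
        · have := mem_leaders.1 hi₀ b.2 h
          omega
        · have := mem_leaders.1 hb i₀ h
          rcases lt_or_gt_of_ne h1 with h' | h'
          · omega
          · have := mem_leaders.1 hb i₁ h'
            omega
    have hnot : (j, i₁) ∉ (Finset.univ : Finset (Fin m)) ×ˢ leaders M t := by simpa using hi₁
    have hinjOn : ∀ a ∈ insert (j, i₁) ((Finset.univ : Finset (Fin m)) ×ˢ leaders M t),
        ∀ b ∈ insert (j, i₁) ((Finset.univ : Finset (Fin m)) ×ˢ leaders M t), a ≠ b →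
        shiftFamily f t a ≠ shiftFamily f t b := by
      have hlead : ∀ a b : Fin m × Fin k, a.2 ∈ leaders M t → b.2 ∈ leaders M t → a ≠ b →
          shiftFamily f t a ≠ shiftFamily f t b := by
        intro a b ha hb hab heq
        rw [shiftFamily_eq_iff] at heq
        have habs := abs_le.1 (hM _ _ _ heq)
        have htt : t a.2 = t b.2 := by
          rcases lt_trichotomy (t a.2) (t b.2) with h | h | h
          · have := mem_leaders.1 hb a.2 h
            omega
          · exact h
          · have := mem_leaders.1 ha b.2 h
            omega
        rw [htt, sub_self, C_0, add_zero, comp_X] at heq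
        exact hab (Prod.ext (hfinj heq) (hinj htt))
      intro a ha b hb hab
      rw [Finset.mem_insert, Finset.mem_product] at ha hb
      rcases ha with rfl | ha <;> rcases hb with rfl | hb
      · exact absurd rfl hab
      · exact hnew b hb.2
      · exact (hnew a ha.2).symm
      · exact hlead a b ha.2 hb.2 hab
    have := sum_zeroCount_le_nuPoly (shiftFamily f t) hp
      (insert (j, i₁) ((Finset.univ : Finset (Fin m)) ×ˢ leaders M t))
      fun a ha b hb hab x => hgood a b (hinjOn a ha b hb hab) x
    rw [Finset.sum_insert hnot, Finset.sum_product_right] at this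
    simp only [zeroCount_shiftFamily, Finset.sum_const, smul_eq_mul] at this
    rw [ha, zeroCount_comp_X_add_C] at this
    omega
  calc (m * (leaders M t).card + 1) * nuPoly f p
      ≤ (m * (leaders M t).card + 1) * ∑ j, zeroCount (f j) p :=
        Nat.mul_le_mul_left _ (nuPoly_le_sum_zeroCount f hp)
    _ = ∑ j₀ : Fin m, ((leaders M t).card * ∑ j, zeroCount (f j) p + zeroCount (f j₀) p) := by
        rw [Finset.sum_add_distrib, Finset.sum_const, Finset.card_univ, Fintype.card_fin,
          smul_eq_mul]
        ring
    _ ≤ ∑ _j₀ : Fin m, nuPoly (shiftFamily f t) p := Finset.sum_le_sum fun j₀ _ => key j₀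
    _ = m * nuPoly (shiftFamily f t) p := by simp

end Leaders

section BadPrimes

open Polynomial

/-- Some two distinct members of the family `g` have a common zero modulo `p`. -/
def HasCommonZero {ι : Type*} (g : ι → ℤ[X]) (p : ℕ) : Prop :=
  ∃ a b, g a ≠ g b ∧ ∃ x : ZMod p, aeval x (g a) = 0 ∧ aeval x (g b) = 0

open Classical in
theorem exists_card_hasCommonZero_le {m : ℕ} {f : Fin m → ℤ[X]} (hf : IsPrimitiveFamily f)
    (k : ℕ) :
    ∃ K : ℝ, 0 ≤ K ∧ ∀ (H : ℕ) (t : Fin k → ℕ), (∀ i, t i ≤ H) → ∀ y : ℕ,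
      (((primesUpTo y).filter (HasCommonZero (shiftFamily f t))).card : ℝ) ≤
        K * (1 + Real.log (1 + H)) := by
  have hex : ∀ j j', ∃ c : ℕ, ∀ d : ℤ, (f j).comp (X + C d) ≠ f j' → ∃ R : ℤ, R ≠ 0 ∧
      |(R : ℝ)| ≤ (c + 1) * (1 + |(d : ℝ)|) ^ c ∧
      ∀ p : ℕ, ∀ x : ZMod p, aeval x ((f j).comp (X + C d)) = 0 → aeval x (f j') = 0 →
        (p : ℤ) ∣ R := fun j j' => by
    obtain ⟨h1, h2, h3, _⟩ := hf.2.2 j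
    obtain ⟨g1, _, g3, g4⟩ := hf.2.2 j'
    exact exists_common_zero_dvd h1 h2 h3 g1 g3 g4
  choose c hc using hex
  set K : Fin m → Fin m → ℝ := fun j j' => 2 * (Real.log (c j j' + 1) + c j j') with hK
  have hK0 : ∀ j j', 0 ≤ K j j' := fun j j' =>
    mul_nonneg zero_le_two (add_nonneg (Real.log_nonneg (by simp)) (Nat.cast_nonneg _))
  refine ⟨∑ ab : (Fin m × Fin k) × (Fin m × Fin k), K ab.1.1 ab.2.1,
    Finset.sum_nonneg fun _ _ => hK0 _ _, fun H t htH y => ?_⟩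
  have hlog : 0 ≤ Real.log (1 + H) := Real.log_nonneg (by simp)
  have hsub : (primesUpTo y).filter (HasCommonZero (shiftFamily f t)) ⊆
      (Finset.univ : Finset ((Fin m × Fin k) × (Fin m × Fin k))).biUnion fun ab =>
        (primesUpTo y).filter fun p => shiftFamily f t ab.1 ≠ shiftFamily f t ab.2 ∧
          ∃ x : ZMod p, aeval x (shiftFamily f t ab.1) = 0 ∧ aeval x (shiftFamily f t ab.2) = 0 := by
    intro p hp
    rw [Finset.mem_filter] at hp
    obtain ⟨hp, a, b, hab⟩ := hp
    exact Finset.mem_biUnion.2 ⟨(a, b), Finset.mem_univ _, Finset.mem_filter.2 ⟨hp, hab⟩⟩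
  have hcard := (Finset.card_le_card hsub).trans Finset.card_biUnion_le
  refine (Nat.cast_le.2 hcard).trans ?_
  rw [Nat.cast_sum, Finset.sum_mul]
  refine Finset.sum_le_sum fun ab _ => ?_
  obtain ⟨a, b⟩ := ab
  by_cases hab : shiftFamily f t a = shiftFamily f t b
  · simp only [hab, ne_eq, not_true_eq_false, false_and, Finset.filter_false, Finset.card_empty,
      Nat.cast_zero]
    exact mul_nonneg (hK0 _ _) (by linarith)
  have hab' := hab
  rw [shiftFamily_eq_iff] at hab'
  obtain ⟨R, hR0, hR, hdvd⟩ := hc _ _ _ hab'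
  have hdH : |(((t a.2 : ℤ) - t b.2 : ℤ) : ℝ)| ≤ H := by
    have h1 := htH a.2
    have h2 := htH b.2
    have : |(t a.2 : ℤ) - t b.2| ≤ H := abs_le.2 ⟨by omega, by omega⟩
    exact_mod_cast this
  refine (card_primes_dvd_le _ (fun p hp => ?_) R hR0 fun p hp => ?_).trans ?_
  · exact (mem_primesUpTo.1 (Finset.mem_filter.1 hp).1).2
  · obtain ⟨_, _, x, hxa, hxb⟩ := Finset.mem_filter.1 hp
    simp only [shiftFamily, aeval_comp_X_add_C] at hxa hxb
    refine hdvd p (x + (t b.2 : ℤ)) ?_ hxb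
    rw [aeval_comp_X_add_C, ← hxa]
    congr 2
    push_cast
    ring
  · have hRpos : 0 < |(R : ℝ)| := abs_pos.2 (by exact_mod_cast hR0)
    have h1 : Real.log |(R : ℝ)| ≤
        Real.log (c a.1 b.1 + 1) + c a.1 b.1 * Real.log (1 + H) := by
      rw [← Real.log_pow, ← Real.log_mul (by positivity) (by positivity)]
      refine Real.log_le_log hRpos (hR.trans ?_)
      gcongr
    have h2 : 0 ≤ Real.log ((c a.1 b.1 : ℝ) + 1) := Real.log_nonneg (by simp)
    have h3 : (0 : ℝ) ≤ c a.1 b.1 := Nat.cast_nonneg _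
    simp only [hK]
    nlinarith

end BadPrimes

section Mertens

open Polynomial

theorem exp_neg_le_one_sub_mul_exp {d p x : ℝ} (hd : 1 ≤ d) (hp : 1 ≤ p) (hx0 : 0 ≤ x)
    (hxd : x ≤ d / p) (hx1 : x ≤ 1 - 1 / p) :
    Real.exp (-x) ≤ (1 - x) * Real.exp (8 * d ^ 3 * (1 / p ^ 2)) := by
  have hp0 : 0 < p := by linarith
  rcases le_or_gt x (1 / 2) with hx | hx
  · have h1 : Real.exp (-x) ≤ 1 - x + x ^ 2 := by
      have := (abs_le.1 (Real.abs_exp_sub_one_sub_id_le (x := -x)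
        (by rw [abs_neg, abs_of_nonneg hx0]; linarith))).2
      nlinarith
    have h2 : x ^ 2 ≤ d ^ 2 * (1 / p ^ 2) := by
      calc x ^ 2 ≤ (d / p) ^ 2 := by gcongr
        _ = _ := by rw [div_pow]; ring
    have h3 : 2 * x ^ 2 ≤ 8 * d ^ 3 * (1 / p ^ 2) := by
      have h4 : d ^ 2 ≤ d ^ 3 := pow_le_pow_right₀ hd (by norm_num)
      have h5 : 0 ≤ 1 / p ^ 2 := by positivity
      nlinarith [mul_le_mul_of_nonneg_right h4 h5, sq_nonneg x]
    have h4 := Real.add_one_le_exp (8 * d ^ 3 * (1 / p ^ 2))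
    calc Real.exp (-x) ≤ 1 - x + x ^ 2 := h1
      _ ≤ (1 - x) * (1 + 2 * x ^ 2) := by nlinarith [mul_nonneg (sq_nonneg x) (sub_nonneg.2 hx)]
      _ ≤ _ := by
        refine mul_le_mul_of_nonneg_left ?_ (by linarith)
        linarith
  · have hpd : p < 2 * d := by
      have := hx.trans_le hxd
      rw [lt_div_iff₀ hp0] at this
      linarith
    have h1 : 1 / p ≤ 1 - x := by linarith
    have h2 : p ≤ Real.exp (8 * d ^ 3 * (1 / p ^ 2)) := by
      have h3 := Real.add_one_le_exp (8 * d ^ 3 * (1 / p ^ 2))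
      have h4 : p ^ 3 ≤ 8 * d ^ 3 := by
        calc p ^ 3 ≤ (2 * d) ^ 3 := by gcongr
          _ = _ := by ring
      have h5 : p = p ^ 3 * (1 / p ^ 2) := by field_simp
      have h6 : p ^ 3 * (1 / p ^ 2) ≤ 8 * d ^ 3 * (1 / p ^ 2) := by gcongr
      linarith
    calc Real.exp (-x) ≤ 1 := Real.exp_le_one_iff.2 (by linarith)
      _ = 1 / p * p := by field_simp
      _ ≤ _ := by gcongr; linarith [show 0 ≤ 1 / p by positivity]

theorem nuPoly_le_natDegree {ι : Type*} [Fintype ι] {g : ι → ℤ[X]} (hg : ∀ j, (g j).content = 1)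
    {p : ℕ} (hp : p.Prime) : nuPoly g p ≤ ∑ j, (g j).natDegree :=
  (nuPoly_le_sum_zeroCount g hp).trans (Finset.sum_le_sum fun j _ =>
    zeroCount_le_natDegree (hg j) hp)

theorem nuPoly_le {ι : Type*} [Fintype ι] (g : ι → ℤ[X]) {p : ℕ} (hp : p.Prime) :
    nuPoly g p ≤ p := by
  have := Fact.mk hp
  exact (Set.ncard_le_card _).trans (by simp [ZMod.card])

theorem nuPoly_lt_of_tendsto_s16 {ι : Type*} [Fintype ι] {g : ι → ℤ[X]} {S : ℝ}
    (hS : Tendsto (partialSS g) atTop (𝓝 S)) (hS0 : S ≠ 0) {p : ℕ} (hp : p.Prime) :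
    nuPoly g p < p := by
  refine lt_of_le_of_ne (nuPoly_le g hp) fun h => hS0 ?_
  refine tendsto_nhds_unique hS (tendsto_const_nhds.congr' ?_)
  filter_upwards [eventually_ge_atTop p] with y hy
  refine (Finset.prod_eq_zero (i := p) ?_ ?_).symm
  · simpa [Nat.lt_succ_iff, hy] using hp
  · rw [h, div_self (by exact_mod_cast hp.ne_zero), sub_self, zero_mul]

theorem exists_le_sum_nuPoly_div {m : ℕ} {f : Fin m → ℤ[X]} (hf : ∀ j, (f j).content = 1) {S : ℝ}
    (hS : Tendsto (partialSS f) atTop (𝓝 S)) (hS0 : S ≠ 0) :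
    ∃ C : ℝ, ∀ y : ℕ, 1 ≤ y → m * Real.log (Real.log (y + 1)) - C ≤
      ∑ p ∈ primesUpTo y, (nuPoly f p : ℝ) / p := by
  obtain ⟨K, hKub⟩ := hS.bddAbove_range
  have hK : ∀ y, partialSS f y ≤ max K 1 := fun y => (hKub ⟨y, rfl⟩).trans (le_max_left _ _)
  have hKpos : 0 < max K 1 := lt_max_of_lt_right one_pos
  set d : ℝ := 1 + ∑ j, ((f j).natDegree : ℝ) with hd
  have hd1 : 1 ≤ d := le_add_of_nonneg_right (Finset.sum_nonneg fun _ _ => Nat.cast_nonneg _)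
  set T : ℝ := ∑' n : ℕ, 1 / (n : ℝ) ^ 2 with hT
  refine ⟨Real.log (max K 1) + 8 * d ^ 3 * T, fun y hy => ?_⟩
  have hlog : 0 < Real.log (y + 1) := Real.log_pos (by
    have : (1 : ℝ) ≤ y := by exact_mod_cast hy
    linarith)
  have hone : ∀ p ∈ primesUpTo y, (0 : ℝ) < 1 - 1 / (p : ℝ) := by
    intro p hp
    have : (1 : ℝ) < p := by exact_mod_cast (mem_primesUpTo.1 hp).2.one_lt
    rw [sub_pos, div_lt_one (by linarith)]
    exact this
  have hprod0 : 0 < ∏ p ∈ primesUpTo y, (1 - 1 / (p : ℝ)) := Finset.prod_pos hone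
  have hprod : ∏ p ∈ primesUpTo y, (1 - (nuPoly f p : ℝ) / p) ≤
      max K 1 * ((Real.log (y + 1))⁻¹) ^ m := by
    have h1 : partialSS f y = (∏ p ∈ primesUpTo y, (1 - (nuPoly f p : ℝ) / p)) *
        ((∏ p ∈ primesUpTo y, (1 - 1 / (p : ℝ))) ^ m)⁻¹ := by
      rw [partialSS, Finset.prod_mul_distrib, Finset.prod_zpow, Fintype.card_fin, zpow_neg,
        zpow_natCast]
      rfl
    have h2 := hK y
    rw [h1, ← div_eq_mul_inv, div_le_iff₀ (pow_pos hprod0 m)] at h2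
    refine h2.trans ?_
    gcongr
    exact prod_primes_one_sub_inv_le y hy
  have hexp : Real.exp (-∑ p ∈ primesUpTo y, (nuPoly f p : ℝ) / p) ≤
      (∏ p ∈ primesUpTo y, (1 - (nuPoly f p : ℝ) / p)) * Real.exp (8 * d ^ 3 * T) := by
    rw [← Finset.sum_neg_distrib]
    have h1 : ∏ p ∈ primesUpTo y, Real.exp (-((nuPoly f p : ℝ) / p)) ≤
        ∏ p ∈ primesUpTo y,
          ((1 - (nuPoly f p : ℝ) / p) * Real.exp (8 * d ^ 3 * (1 / (p : ℝ) ^ 2))) := by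
      refine Finset.prod_le_prod (fun _ _ => (Real.exp_pos _).le) fun p hp => ?_
      have hpp := (mem_primesUpTo.1 hp).2
      have hp1 : (1 : ℝ) ≤ p := by exact_mod_cast hpp.one_lt.le
      refine exp_neg_le_one_sub_mul_exp hd1 hp1 (by positivity) ?_ ?_
      · gcongr
        have : (nuPoly f p : ℝ) ≤ ∑ j, ((f j).natDegree : ℝ) := by
          exact_mod_cast nuPoly_le_natDegree hf hpp
        linarith
      · rw [one_sub_div (by linarith)]
        gcongr
        have : (nuPoly f p : ℝ) + 1 ≤ p := by exact_mod_cast nuPoly_lt_of_tendsto_s16 hS hS0 hpp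
        linarith
    rw [Finset.prod_mul_distrib, ← Real.exp_sum, ← Real.exp_sum, ← Finset.mul_sum] at h1
    refine h1.trans ?_
    have h2 : 0 ≤ ∏ p ∈ primesUpTo y, (1 - (nuPoly f p : ℝ) / p) := by
      refine Finset.prod_nonneg fun p hp => ?_
      rw [sub_nonneg]
      exact div_le_one_of_le₀ (by exact_mod_cast nuPoly_le f (mem_primesUpTo.1 hp).2)
        (Nat.cast_nonneg _)
    have h3 : ∑ p ∈ primesUpTo y, 1 / (p : ℝ) ^ 2 ≤ T :=
      (Real.summable_one_div_nat_pow.2 one_lt_two).sum_le_tsum _ fun _ _ => by positivity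
    gcongr
  have hfin := hexp.trans (mul_le_mul_of_nonneg_right hprod (Real.exp_pos _).le)
  have h4 := Real.log_le_log (Real.exp_pos _) hfin
  rw [Real.log_exp, Real.log_mul (by positivity) (Real.exp_pos _).ne', Real.log_exp,
    Real.log_mul hKpos.ne' (by positivity), Real.log_pow, Real.log_inv] at h4
  linarith

end Mertens

section Sieving

open Polynomial

open Classical in
/-- The residues `n` modulo `p` for which some member of `g` vanishes at `n` modulo `p`. -/
noncomputable def zeroResidues {ι : Type*} (g : ι → ℤ[X]) (p : ℕ) : Finset ℕ :=
  (Finset.range p).filter fun n => ∃ j, aeval (n : ZMod p) (g j) = 0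

open Classical in
theorem zeroResidues_subset {ι : Type*} (g : ι → ℤ[X]) (p : ℕ) :
    zeroResidues g p ⊆ Finset.range p :=
  Finset.filter_subset _ _

theorem card_zeroResidues {ι : Type*} [Fintype ι] (g : ι → ℤ[X]) {p : ℕ} (hp : p.Prime) :
    (zeroResidues g p).card = nuPoly g p := by
  have := Fact.mk hp
  have himg : {x : ZMod p | ∃ j, aeval x (g j) = 0} =
      (fun n : ℕ => (n : ZMod p)) '' (zeroResidues g p : Set ℕ) := by
    ext x
    simp only [zeroResidues, Set.mem_ofPred_eq, Finset.coe_filter, Finset.mem_range, Set.mem_image]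
    constructor
    · intro hx
      exact ⟨x.val, ⟨ZMod.val_lt x, by simpa using hx⟩, by simp⟩
    · rintro ⟨n, ⟨_, hn⟩, rfl⟩
      exact hn
  rw [nuPoly, himg, Set.InjOn.ncard_image, Set.ncard_coe_finset]
  intro a ha b hb hab
  simp only [zeroResidues, Finset.coe_filter, Finset.mem_range, Set.mem_ofPred_eq] at ha hb
  have := (ZMod.natCast_eq_natCast_iff' a b p).1 hab
  rwa [Nat.mod_eq_of_lt ha.1, Nat.mod_eq_of_lt hb.1] at this

theorem ncard_eval_eq_le {g : ℤ[X]} (hg : 1 ≤ g.natDegree) (c : ℤ) :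
    {n : ℕ | g.eval (n : ℤ) = c}.Finite ∧ {n : ℕ | g.eval (n : ℤ) = c}.ncard ≤ g.natDegree := by
  have hne : g - C c ≠ 0 := by
    intro h
    rw [sub_eq_zero.1 h, natDegree_C] at hg
    omega
  have hmaps : ∀ n ∈ {n : ℕ | g.eval (n : ℤ) = c},
      (n : ℤ) ∈ ((g - C c).roots.toFinset : Set ℤ) := by
    intro n hn
    rw [Finset.mem_coe, Multiset.mem_toFinset, mem_roots hne]
    simpa [IsRoot, sub_eq_zero] using hn
  have hinj : Set.InjOn (fun n : ℕ => (n : ℤ)) {n : ℕ | g.eval (n : ℤ) = c} :=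
    Nat.cast_injective.injOn
  refine ⟨Set.Finite.of_injOn hmaps hinj (Finset.finite_toSet _), ?_⟩
  refine (Set.ncard_le_ncard_of_injOn _ hmaps hinj (Finset.finite_toSet _)).trans ?_
  rw [Set.ncard_coe_finset]
  refine (Multiset.toFinset_card_le _).trans ((card_roots' _).trans ?_)
  rw [natDegree_sub_C]

theorem piCount_le {ι : Type*} [Fintype ι] (g : ι → ℤ[X]) {N : ℝ} (hN : 0 ≤ N) :
    (piCount g N : ℝ) ≤ N := by
  have hsub : {n : ℕ | 1 ≤ n ∧ (n : ℝ) ≤ N ∧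
      ∀ j, 0 < (g j).eval (n : ℤ) ∧ Prime ((g j).eval (n : ℤ))} ⊆
      (Finset.Ioc 0 ⌊N⌋₊ : Set ℕ) := by
    rintro n ⟨h1, h2, _⟩
    simpa using ⟨h1, Nat.le_floor h2⟩
  have := Set.ncard_le_ncard hsub (Finset.finite_toSet _)
  rw [Set.ncard_coe_finset, Nat.card_Ioc, tsub_zero] at this
  exact (Nat.cast_le.2 this).trans (Nat.floor_le hN)

theorem piCount_le_sifted_add {ι : Type*} [Fintype ι] {g : ι → ℤ[X]}
    (hg : ∀ j, 1 ≤ (g j).natDegree) (N : ℝ) (y : ℕ) {P : Finset ℕ}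
    (hP : P ⊆ primesUpTo y) :
    piCount g N ≤
      ((Finset.Ioc 0 ⌊N⌋₊).filter fun n => ∀ p ∈ P, n % p ∉ zeroResidues g p).card +
        y * ∑ j, (g j).natDegree := by
  classical
  set F := (Finset.Ioc 0 ⌊N⌋₊).filter fun n => ∀ p ∈ P, n % p ∉ zeroResidues g p with hF
  set E : Set ℕ := ⋃ pj ∈ Finset.Ioc 0 y ×ˢ (Finset.univ : Finset ι),
    {n : ℕ | (g pj.2).eval (n : ℤ) = (pj.1 : ℤ)} with hE
  have hsub : {n : ℕ | 1 ≤ n ∧ (n : ℝ) ≤ N ∧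
      ∀ j, 0 < (g j).eval (n : ℤ) ∧ Prime ((g j).eval (n : ℤ))} ⊆ (F : Set ℕ) ∪ E := by
    rintro n ⟨h1, h2, h3⟩
    by_cases hn : n ∈ F
    · exact Or.inl hn
    · right
      have hnI : n ∈ Finset.Ioc 0 ⌊N⌋₊ := Finset.mem_Ioc.2 ⟨h1, Nat.le_floor h2⟩
      simp only [hF, Finset.mem_filter, hnI, true_and] at hn
      push Not at hn
      obtain ⟨p, hp, hnp⟩ := hn
      obtain ⟨hpy, hpp⟩ := mem_primesUpTo.1 (hP hp)
      simp only [zeroResidues, Finset.mem_filter] at hnp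
      obtain ⟨_, j, hj⟩ := hnp
      have hcast : (((n % p : ℕ)) : ZMod p) = algebraMap ℤ (ZMod p) (n : ℤ) := by simp
      rw [hcast, aeval_algebraMap_apply, coe_aeval_eq_eval, algebraMap_int_eq, eq_intCast,
        ZMod.intCast_zmod_eq_zero_iff_dvd] at hj
      obtain ⟨hpos, hprime⟩ := h3 j
      have hassoc := ((Nat.prime_iff_prime_int.1 hpp).associated_of_dvd hprime hj)
      have heq := Int.eq_of_associated_of_nonneg hassoc (Int.natCast_nonneg p) hpos.le
      refine Set.mem_biUnion (x := (p, j)) ?_ heq.symm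
      simpa using ⟨hpp.pos, hpy⟩
  have hEfin : E.Finite := Set.Finite.biUnion (Finset.finite_toSet _) fun pj _ =>
    (ncard_eval_eq_le (hg pj.2) _).1
  refine (Set.ncard_le_ncard hsub ((Finset.finite_toSet _).union hEfin)).trans
    ((Set.ncard_union_le _ _).trans ?_)
  rw [Set.ncard_coe_finset]
  gcongr
  refine (Finset.set_ncard_biUnion_le _ _).trans ((Finset.sum_le_sum fun pj _ =>
    (ncard_eval_eq_le (hg pj.2) _).2).trans ?_)
  rw [Finset.sum_product]
  simp

end Sieving

section Tuples

open Polynomial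

open Classical in
theorem le_sum_nuPoly_shiftFamily_div {m k : ℕ} {f : Fin m → ℤ[X]} (hf : IsPrimitiveFamily f)
    {M : ℕ} (hM : ∀ j j' (d : ℤ), (f j).comp (X + C d) = f j' → |d| ≤ M) (hk : 1 ≤ k)
    {t : Fin k → ℕ} (hinj : Function.Injective t) (ht : ¬ IsPrimitiveFamily (shiftFamily f t))
    (y : ℕ) {B : ℝ} (hB : 1 ≤ B)
    (hcard : (((primesUpTo y).filter (HasCommonZero (shiftFamily f t))).card : ℝ) ≤ B) :
    (m * (leaders M t).card + 1) * (∑ p ∈ primesUpTo y, (nuPoly f p : ℝ) / p -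
        (∑ j, (f j).natDegree) * (2 + Real.log B)) ≤
      m * ∑ p ∈ (primesUpTo y).filter (fun p => ¬ HasCommonZero (shiftFamily f t) p),
        (nuPoly (shiftFamily f t) p : ℝ) / p := by
  have hbad : ∑ p ∈ (primesUpTo y).filter (HasCommonZero (shiftFamily f t)),
      (nuPoly f p : ℝ) / p ≤ (∑ j, (f j).natDegree) * (2 + Real.log B) := by
    refine le_trans ?_ (mul_le_mul_of_nonneg_left (sum_inv_le_two_add_log _ (fun n hn =>
      (mem_primesUpTo.1 (Finset.mem_filter.1 hn).1).2.one_lt.le) hB hcard) (Nat.cast_nonneg _))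
    rw [Finset.mul_sum]
    refine Finset.sum_le_sum fun p hp => ?_
    rw [mul_one_div]
    gcongr
    exact nuPoly_le_natDegree (fun j => (hf.2.2 j).2.2.2)
      (mem_primesUpTo.1 (Finset.mem_filter.1 hp).1).2
  have hgood : (m * (leaders M t).card + 1) *
      ∑ p ∈ (primesUpTo y).filter (fun p => ¬ HasCommonZero (shiftFamily f t) p),
        (nuPoly f p : ℝ) / p ≤
      m * ∑ p ∈ (primesUpTo y).filter (fun p => ¬ HasCommonZero (shiftFamily f t) p),
        (nuPoly (shiftFamily f t) p : ℝ) / p := by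
    rw [Finset.mul_sum, Finset.mul_sum]
    refine Finset.sum_le_sum fun p hp => ?_
    rw [← mul_div_assoc, ← mul_div_assoc]
    refine div_le_div_of_nonneg_right ?_ (Nat.cast_nonneg _)
    obtain ⟨hp, hgood⟩ := Finset.mem_filter.1 hp
    exact_mod_cast le_nuPoly_shiftFamily hf hM hk hinj ht (mem_primesUpTo.1 hp).2
      fun a b hab x hx => hgood ⟨a, b, hab, x, hx⟩
  refine le_trans (mul_le_mul_of_nonneg_left ?_ (by positivity)) hgood
  rw [← Finset.sum_filter_add_sum_filter_not (primesUpTo y) (HasCommonZero (shiftFamily f t))]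
  linarith

theorem prod_one_sub_div_le_exp {ι : Type*} [Fintype ι] (g : ι → ℤ[X]) {P : Finset ℕ}
    (hP : ∀ p ∈ P, p.Prime) :
    ∏ p ∈ P, (1 - (nuPoly g p : ℝ) / p) ≤ Real.exp (-∑ p ∈ P, (nuPoly g p : ℝ) / p) := by
  rw [← Finset.sum_neg_distrib, Real.exp_sum]
  refine Finset.prod_le_prod (fun p hp => ?_) fun p _ => ?_
  · rw [sub_nonneg]
    exact div_le_one_of_le₀ (by exact_mod_cast nuPoly_le g (hP p hp)) (Nat.cast_nonneg _)
  · have := Real.add_one_le_exp (-((nuPoly g p : ℝ) / p))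
    linarith

theorem eventually_log_tuple_le (K lam : ℝ) (hK : 0 ≤ K) (hlam : 0 < lam) (m : ℕ) {θ : ℝ}
    (hθ : 0 < θ) :
    ∀ᶠ L : ℝ in atTop, 1 + K * (1 + Real.log (1 + lam * L ^ m)) ≤ L ^ θ := by
  have h1 := eventually_mul_log_le_rpow (K * m + 1) hθ
  have h2 : ∀ᶠ L : ℝ in atTop, 1 + K * (1 + Real.log (1 + lam)) ≤ Real.log L :=
    Real.tendsto_log_atTop.eventually_ge_atTop _
  filter_upwards [h1, h2, eventually_ge_atTop 1] with L h1 h2 hL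
  have h3 : Real.log (1 + lam * L ^ m) ≤ Real.log (1 + lam) + m * Real.log L := by
    rw [← Real.log_pow, ← Real.log_mul (by positivity) (by positivity)]
    refine Real.log_le_log (by positivity) ?_
    have := one_le_pow₀ hL (n := m)
    nlinarith
  nlinarith [mul_le_mul_of_nonneg_left h3 hK]

theorem exponent_le {m r d θ W ε l lB ly C T₁ T₂ : ℝ} (hm : 1 ≤ m) (hr : 0 ≤ r) (hd : 0 ≤ d)
    (hl : 0 ≤ l) (hθ : 0 ≤ θ) (hrW : m * r + 1 ≤ W) (hθW : (m + d + 1) * θ * W = ε / 2)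
    (hB : (m * r + 1) * (T₁ - d * (2 + lB)) ≤ m * T₂) (hlB : lB ≤ θ * l)
    (hly : (1 - θ) * l ≤ ly) (hT₁ : m * ly - C ≤ T₁) (hC : C + 2 * d ≤ θ * l) :
    (m * r + 1 - ε / 2) * l ≤ T₂ := by
  have h1 : (m - (m + d + 1) * θ) * l ≤ T₁ - d * (2 + lB) := by
    have h2 := mul_le_mul_of_nonneg_left hlB hd
    have h3 := mul_le_mul_of_nonneg_left hly (by linarith : (0 : ℝ) ≤ m)
    linarith
  have h2 : (m * r + 1) * ((m - (m + d + 1) * θ) * l) ≤ m * T₂ :=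
    (mul_le_mul_of_nonneg_left h1 (by positivity)).trans hB
  have h3 : (m * r + 1) * ((m + d + 1) * θ) ≤ ε / 2 := by
    rw [← hθW, mul_comm]
    gcongr
  have hε : 0 ≤ ε / 2 := le_trans (by positivity) h3
  have h4 : 0 ≤ (m * (ε / 2) - (m * r + 1) * ((m + d + 1) * θ)) * l :=
    mul_nonneg (by linarith [mul_nonneg (sub_nonneg.2 hm) hε]) hl
  have h5 : m * ((m * r + 1 - ε / 2) * l) ≤ m * T₂ := by linarith
  exact le_of_mul_le_mul_left h5 (by linarith)

theorem eventually_le_exp_half_mul_rpow_neg (W c : ℝ) :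
    ∀ᶠ L : ℝ in atTop, c ≤ Real.exp (L / 2) * L ^ (-W) := by
  filter_upwards [(tendsto_rpow_mul_exp_neg_mul_atTop_nhds_zero W (1 / 2)
    (by norm_num)).eventually_le_const (show (0 : ℝ) < (|c| + 1)⁻¹ by positivity),
    eventually_gt_atTop 0] with L h hL
  have hW := Real.rpow_pos_of_pos hL W
  rw [show -(1 / 2) * L = -(L / 2) by ring, Real.exp_neg, ← div_eq_mul_inv,
    div_le_iff₀ (Real.exp_pos _), ← div_eq_inv_mul, le_div_iff₀ (by positivity)] at h
  rw [Real.rpow_neg hL.le, ← div_eq_mul_inv, le_div_iff₀ hW]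
  nlinarith [le_abs_self c]

theorem eventually_piCount_shiftFamily_le {m k : ℕ} {f : Fin m → ℤ[X]}
    (hf : IsPrimitiveFamily f) {S : ℝ} (hS : Tendsto (partialSS f) atTop (𝓝 S)) (hS0 : S ≠ 0)
    (hk : 1 ≤ k) {M : ℕ}
    (hM : ∀ j j' (d : ℤ), (f j).comp (X + C d) = f j' → |d| ≤ M) {lam ε : ℝ} (hlam : 0 < lam)
    (hε : 0 < ε) :
    ∀ᶠ L : ℝ in atTop, ∀ H : ℕ, (H : ℝ) ≤ lam * L ^ m → ∀ t ∈ distinctTuples k H,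
      ¬ IsPrimitiveFamily (shiftFamily f t) →
      (piCount (shiftFamily f t) (Real.exp L) : ℝ) ≤
        Real.exp L * L ^ (ε - (m * (leaders M t).card + 1)) := by
  classical
  obtain ⟨C₀, hC₀⟩ := exists_le_sum_nuPoly_div (fun j => (hf.2.2 j).2.2.2) hS hS0
  obtain ⟨K, hK0, hK⟩ := exists_card_hasCommonZero_le hf k
  set d : ℕ := ∑ j, (f j).natDegree with hd
  set W : ℝ := m * k + 1 with hW
  have hW1 : 1 ≤ W := le_add_of_nonneg_left (by positivity)
  have hmpos : (1 : ℝ) ≤ m := by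
    obtain ⟨j⟩ := hf.1
    exact_mod_cast j.pos
  set θ : ℝ := ε / (2 * W * (m + d + 1)) with hθ
  have hθ0 : 0 < θ := by positivity
  have e1 := eventually_sieve_bound (k * d + 1) (by omega) W hθ0
  have e2 := eventually_log_tuple_le K lam hK0 hlam m hθ0
  have e3 : ∀ᶠ L : ℝ in atTop, C₀ + 2 * d ≤ θ * Real.log L :=
    (Real.tendsto_log_atTop.const_mul_atTop hθ0).eventually_ge_atTop _
  have e4 : ∀ᶠ L : ℝ in atTop, 4 ≤ L ^ (ε / 2) :=
    (tendsto_rpow_atTop (half_pos hε)).eventually_ge_atTop _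
  have e5 := eventually_le_exp_half_mul_rpow_neg W (k * d + 1)
  filter_upwards [e1, e2, e3, e4, e5, eventually_ge_atTop 1] with L e1 e2 e3 e4 e5 hL H hH t htH ht
  obtain ⟨y, hy1, hyexp, hylog, hsieve⟩ := e1
  have hL0 : 0 < L := by linarith
  have hlogL : 0 ≤ Real.log L := Real.log_nonneg hL
  simp only [distinctTuples, Finset.mem_filter, Fintype.mem_piFinset, Finset.mem_Icc] at htH
  obtain ⟨htH, hinj⟩ := htH
  set g := shiftFamily f t with hg
  set P := (primesUpTo y).filter fun p => ¬ HasCommonZero g p with hP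
  have hPprime : ∀ p ∈ P, p.Prime := fun p hp =>
    (mem_primesUpTo.1 (Finset.mem_filter.1 hp).1).2
  have hgprops : ∀ a, 1 ≤ (g a).natDegree ∧ (g a).content = 1 ∧
      (g a).natDegree = (f a.1).natDegree := by
    intro a
    obtain ⟨h1, h2, h3, h4⟩ := hf.2.2 a.1
    obtain ⟨_, g2, _, g4⟩ := comp_X_add_C_props h1 h2 h3 (t a.2)
    exact ⟨g2 ▸ h2, g4, g2⟩
  have hgdeg : ∑ a, (g a).natDegree = k * d := by
    rw [Finset.sum_congr rfl fun a _ => (hgprops a).2.2, Fintype.sum_prod_type, hd,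
      Finset.mul_sum]
    simp
  have hcount := piCount_le_sifted_add (fun a => (hgprops a).1) (Real.exp L) y
    (P := P) (Finset.filter_subset _ _)
  rw [hgdeg] at hcount
  have hsift := hsieve P (Finset.filter_subset _ _) (zeroResidues g)
    (fun p _ => zeroResidues_subset g p)
    (fun p hp => by
      rw [card_zeroResidues g (hPprime p hp)]
      exact (nuPoly_le_natDegree (fun a => (hgprops a).2.1) (hPprime p hp)).trans (by omega))
    ⌊Real.exp L⌋₊ (Nat.floor_le (Real.exp_pos L).le)
  set r : ℝ := ((leaders M t).card : ℝ) with hr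
  have hrk : r ≤ k := by
    have := Finset.card_le_univ (leaders M t)
    rw [Fintype.card_fin] at this
    exact Nat.cast_le.2 this
  have hrW : m * r + 1 ≤ W := by rw [hW]; gcongr
  have hr0 : 0 ≤ r := Nat.cast_nonneg _
  have hprod : ∏ p ∈ P, (1 - ((zeroResidues g p).card : ℝ) / p) ≤
      L ^ (ε / 2 - (m * r + 1)) := by
    rw [Finset.prod_congr rfl fun p hp => by rw [card_zeroResidues g (hPprime p hp)]]
    refine (prod_one_sub_div_le_exp g hPprime).trans ?_
    rw [Real.rpow_def_of_pos hL0, Real.exp_le_exp]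
    have hB := le_sum_nuPoly_shiftFamily_div hf hM hk hinj ht y
      (B := 1 + K * (1 + Real.log (1 + lam * L ^ m)))
      (le_add_of_nonneg_right (mul_nonneg hK0 (add_nonneg zero_le_one
        (Real.log_nonneg (le_add_of_nonneg_right (by positivity))))))
      (by
        refine (hK H t (fun i => (htH i).2) y).trans ?_
        have : Real.log (1 + H) ≤ Real.log (1 + lam * L ^ m) :=
          Real.log_le_log (by positivity) (by linarith)
        nlinarith [mul_le_mul_of_nonneg_left this hK0])
    have hlogB : Real.log (1 + K * (1 + Real.log (1 + lam * L ^ m))) ≤ θ * Real.log L := by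
      rw [← Real.log_rpow hL0]
      refine Real.log_le_log ?_ e2
      have : 0 ≤ Real.log (1 + lam * L ^ m) :=
        Real.log_nonneg (le_add_of_nonneg_right (by positivity))
      positivity
    have hloglog : (1 - θ) * Real.log L ≤ Real.log (Real.log (y + 1)) := by
      rw [← Real.log_rpow hL0]
      exact Real.log_le_log (by positivity) hylog
    have hmain := hC₀ y hy1
    rw [← hd] at hB
    have := exponent_le (ε := ε) hmpos hr0 (Nat.cast_nonneg d) hlogL hθ0.le hrW
      (by rw [hθ]; field_simp) hB hlogB hloglog hmain e3
    linarith
  have hyterm : (y : ℝ) * (k * d) ≤ Real.exp L * L ^ (-W) := by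
    calc (y : ℝ) * (k * d) ≤ Real.exp (L / 2) * (Real.exp (L / 2) * L ^ (-W)) :=
          mul_le_mul hyexp (by linarith) (by positivity) (by positivity)
      _ = _ := by rw [← mul_assoc, ← Real.exp_add, add_halves]
  have hWle : L ^ (-W) ≤ L ^ (ε / 2 - (m * r + 1)) :=
    Real.rpow_le_rpow_of_exponent_le hL (by linarith)
  have hcount' : (piCount g (Real.exp L) : ℝ) ≤ (((Finset.Ioc 0 ⌊Real.exp L⌋₊).filter
      fun n => ∀ p ∈ P, n % p ∉ zeroResidues g p).card : ℝ) + y * (k * d) := by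
    exact_mod_cast hcount
  calc (piCount g (Real.exp L) : ℝ) ≤ _ := hcount'
    _ ≤ Real.exp L * L ^ (ε / 2 - (m * r + 1)) + 2 * (Real.exp L * L ^ (ε / 2 - (m * r + 1))) +
        Real.exp L * L ^ (ε / 2 - (m * r + 1)) := by
      refine add_le_add (hsift.trans ?_) (hyterm.trans ?_) <;> gcongr
    _ = Real.exp L * (4 * L ^ (ε / 2 - (m * r + 1))) := by ring
    _ ≤ Real.exp L * (L ^ (ε / 2) * L ^ (ε / 2 - (m * r + 1))) := by gcongr
    _ = _ := by rw [← Real.rpow_add hL0]; congr 2; ring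

end Tuples

section Summation

open Polynomial

theorem sum_inv_pow_card_leaders_le (k M H : ℕ) {lam x : ℝ} (hlam : 0 ≤ lam) (hx : 0 < x)
    (hH : (H : ℝ) ≤ lam * x) :
    ∑ t ∈ distinctTuples k H, (x⁻¹) ^ (leaders M t).card ≤
      2 ^ k * ((1 + lam) ^ k * ((k * (k * M + 1)) ^ k : ℕ)) := by
  rw [← Finset.sum_fiberwise (distinctTuples k H) (leaders M)]
  calc ∑ I : Finset (Fin k), ∑ t ∈ (distinctTuples k H).filter (fun t => leaders M t = I),
        (x⁻¹) ^ (leaders M t).card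
      ≤ ∑ _I : Finset (Fin k), (1 + lam) ^ k * ((k * (k * M + 1)) ^ k : ℕ) := by
        refine Finset.sum_le_sum fun I _ => ?_
        rw [Finset.sum_congr rfl fun t ht => by rw [(Finset.mem_filter.1 ht).2],
          Finset.sum_const, nsmul_eq_mul]
        have h1 : (((distinctTuples k H).filter fun t => leaders M t = I).card : ℝ) ≤
            (H : ℝ) ^ I.card * ((k * (k * M + 1)) ^ k : ℕ) := by
          exact_mod_cast card_filter_leaders_le M H I
        have h2 : (H : ℝ) * x⁻¹ ≤ 1 + lam := by
          rw [← div_eq_mul_inv, div_le_iff₀ hx]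
          nlinarith
        have h3 : I.card ≤ k := (Finset.card_le_univ I).trans (by simp)
        calc _ ≤ (H : ℝ) ^ I.card * ((k * (k * M + 1)) ^ k : ℕ) * x⁻¹ ^ I.card := by gcongr
          _ = ((H : ℝ) * x⁻¹) ^ I.card * ((k * (k * M + 1)) ^ k : ℕ) := by
            rw [mul_pow]
            ring
          _ ≤ (1 + lam) ^ I.card * ((k * (k * M + 1)) ^ k : ℕ) := by gcongr
          _ ≤ _ := by
            gcongr
            linarith
    _ = _ := by simp

theorem card_distinctTuples_le (k H : ℕ) : (distinctTuples k H).card ≤ H ^ k := by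
  refine (Finset.card_filter_le _ _).trans ?_
  rw [Fintype.card_piFinset]
  simp

theorem rpow_le_add_rpow {a b x : ℝ} (s : ℝ) (ha : 0 < a) (hax : a ≤ x) (hxb : x ≤ b) :
    x ^ s ≤ a ^ s + b ^ s := by
  rcases le_total 0 s with hs | hs
  · exact (Real.rpow_le_rpow (ha.le.trans hax) hxb hs).trans
      (le_add_of_nonneg_left (Real.rpow_nonneg ha.le s))
  · exact (Real.rpow_le_rpow_of_nonpos ha hax hs).trans
      (le_add_of_nonneg_right (Real.rpow_nonneg (ha.le.trans (hax.trans hxb)) s))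

end Summation

open Classical in
/-- Let `f` be a primitive family whose singular series exists and is nonzero, and
`k ≥ 1`. For every `λ > 0` and `ε > 0` there is `C ≥ 0` such that for all `N ≥ 2` and
all real `1 ≤ h ≤ λ (log N)^m`, the sum of `π(N; f∘h)` over `k`-tuples of distinct
positive integers with entries `≤ h` for which `f∘h` is NOT primitive is at most
`C · N / (log N)^(1−ε)`. -/
theorem imprimitive_contribution_small (m : ℕ) (f : Fin m → Polynomial ℤ)
    (hf : IsPrimitiveFamily f) (Sf : ℝ) (hSf : Tendsto (partialSS f) atTop (𝓝 Sf))
    (hSf0 : Sf ≠ 0) (k : ℕ) (hk : 1 ≤ k) (lam : ℝ) (hlam : 0 < lam)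
    (ε : ℝ) (hε : 0 < ε) :
    ∃ C : ℝ, 0 ≤ C ∧
      ∀ N : ℝ, 2 ≤ N → ∀ h : ℝ, 1 ≤ h → h ≤ lam * Real.log N ^ m →
        (∑ t ∈ (distinctTuples k ⌊h⌋₊).filter
            (fun t => ¬ IsPrimitiveFamily (shiftFamily f t)),
          (piCount (shiftFamily f t) N : ℝ)) ≤
          C * N / Real.log N ^ ((1 : ℝ) - ε) := by
  obtain ⟨M, hM⟩ := exists_shift_bound f fun j => (hf.2.2 j).2.1
  obtain ⟨L₀, hL₀⟩ := eventually_atTop.1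
    (eventually_piCount_shiftFamily_le hf hSf hSf0 hk hM hlam hε)
  have hlog2 : 0 < Real.log 2 := Real.log_pos one_lt_two
  set L₁ := max L₀ 1
  set C₁ : ℝ := 2 ^ k * ((1 + lam) ^ k * ((k * (k * M + 1)) ^ k : ℕ)) with hC₁
  set C₂ : ℝ := (lam * L₁ ^ m) ^ k * (Real.log 2 ^ (1 - ε) + L₁ ^ (1 - ε)) with hC₂
  have hL₁ : 0 < L₁ := lt_max_of_lt_right one_pos
  have hC₁0 : 0 ≤ C₁ := by positivity
  have hC₂0 : 0 ≤ C₂ := by positivity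
  refine ⟨C₁ + C₂, by positivity, fun N hN h h1 hle => ?_⟩
  have hN0 : 0 < N := by linarith
  have hlogN : Real.log 2 ≤ Real.log N := Real.log_le_log two_pos hN
  have hL0 : 0 < Real.log N := hlog2.trans_le hlogN
  have hH : (⌊h⌋₊ : ℝ) ≤ lam * Real.log N ^ m := (Nat.floor_le (by linarith)).trans hle
  have hpow := Real.rpow_pos_of_pos hL0 (1 - ε)
  rw [le_div_iff₀ hpow]
  rcases le_total L₁ (Real.log N) with hL | hL
  · have hbound := hL₀ (Real.log N) ((le_max_left _ _).trans hL) ⌊h⌋₊ hH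
    rw [Real.exp_log hN0] at hbound
    have hsum : ∑ t ∈ (distinctTuples k ⌊h⌋₊).filter
        (fun t => ¬ IsPrimitiveFamily (shiftFamily f t)), (piCount (shiftFamily f t) N : ℝ) ≤
        N * Real.log N ^ (ε - 1) * C₁ := by
      calc _ ≤ ∑ t ∈ (distinctTuples k ⌊h⌋₊).filter
            (fun t => ¬ IsPrimitiveFamily (shiftFamily f t)),
            N * Real.log N ^ (ε - 1) * ((Real.log N ^ m)⁻¹) ^ (leaders M t).card := by
            refine Finset.sum_le_sum fun t ht => ?_
            obtain ⟨ht, htp⟩ := Finset.mem_filter.1 ht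
            refine (hbound t ht htp).trans_eq ?_
            rw [show ε - ((m : ℝ) * (leaders M t).card + 1) =
              (ε - 1) - ((m * (leaders M t).card : ℕ) : ℝ) by push_cast; ring,
              Real.rpow_sub hL0, Real.rpow_natCast, pow_mul, inv_pow, div_eq_mul_inv, mul_assoc]
        _ ≤ ∑ t ∈ distinctTuples k ⌊h⌋₊,
            N * Real.log N ^ (ε - 1) * ((Real.log N ^ m)⁻¹) ^ (leaders M t).card :=
            Finset.sum_le_sum_of_subset_of_nonneg (Finset.filter_subset _ _)
              fun _ _ _ => by positivity
        _ ≤ _ := by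
            rw [← Finset.mul_sum]
            exact mul_le_mul_of_nonneg_left
              (sum_inv_pow_card_leaders_le k M _ hlam.le (by positivity) hH) (by positivity)
    calc _ ≤ N * Real.log N ^ (ε - 1) * C₁ * Real.log N ^ (1 - ε) := by gcongr
      _ = C₁ * N * (Real.log N ^ (ε - 1) * Real.log N ^ (1 - ε)) := by ring
      _ = C₁ * N := by
        rw [← Real.rpow_add hL0, show ε - 1 + (1 - ε) = 0 by ring, Real.rpow_zero, mul_one]
      _ ≤ (C₁ + C₂) * N := by gcongr; linarith
  · have hsum : ∑ t ∈ (distinctTuples k ⌊h⌋₊).filter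
        (fun t => ¬ IsPrimitiveFamily (shiftFamily f t)), (piCount (shiftFamily f t) N : ℝ) ≤
        (lam * L₁ ^ m) ^ k * N := by
      calc _ ≤ ∑ t ∈ distinctTuples k ⌊h⌋₊, N :=
            (Finset.sum_le_sum fun t _ => piCount_le _ hN0.le).trans
              (Finset.sum_le_sum_of_subset_of_nonneg (Finset.filter_subset _ _)
                fun _ _ _ => hN0.le)
        _ = ((distinctTuples k ⌊h⌋₊).card : ℝ) * N := by rw [Finset.sum_const, nsmul_eq_mul]
        _ ≤ (⌊h⌋₊ : ℝ) ^ k * N := by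
            gcongr
            exact_mod_cast card_distinctTuples_le k ⌊h⌋₊
        _ ≤ _ := by
            have : (⌊h⌋₊ : ℝ) ≤ lam * L₁ ^ m := hH.trans (by gcongr)
            gcongr
    calc _ ≤ (lam * L₁ ^ m) ^ k * N * (Real.log 2 ^ (1 - ε) + L₁ ^ (1 - ε)) :=
          mul_le_mul hsum (rpow_le_add_rpow _ hlog2 hlogN hL) hpow.le (by positivity)
      _ = C₂ * N := by rw [hC₂]; ring
      _ ≤ (C₁ + C₂) * N := by gcongr; linarith
end

section
/- For each fixed integer k ≥ 1, the density of k-tuples with nonvanishing singular series exists and is a finite Euler product: lim_{h→∞} h^{−k} · #{k-tuples h of distinct positive integers with h_i ≤ h and S(h) ≠ 0} = ∏_{p ≤ k} ( p^{−k} · #{u ∈ (ℤ/pℤ)^k : {u_1,…,u_k} ≠ ℤ/pℤ} ), the product running over primes p ≤ k. -/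
open Filter Topology

noncomputable def nup {k : ℕ} (h : Fin k → ℕ) (p : ℕ) : ℕ :=
  (Set.range fun i => ((h i : ZMod p))).ncard

/-- The `p`-factor `(1 - ν_p(h)/p) * (1 - 1/p)^(-k)` of the singular series. -/
noncomputable def singFactor {k : ℕ} (h : Fin k → ℕ) (p : ℕ) : ℝ :=
  (1 - (nup h p : ℝ) / p) * (1 - 1 / (p : ℝ)) ^ (-(k : ℤ))

/-- The singular series `S(h) = ∏_p (1 - ν_p(h)/p)(1 - 1/p)^(-k)`. -/
noncomputable def singSeries {k : ℕ} (h : Fin k → ℕ) : ℝ :=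
  ∏' p : Nat.Primes, singFactor h (p : ℕ)

lemma nup_le {k : ℕ} (h : Fin k → ℕ) (p : ℕ) : nup h p ≤ k := by
  rw [nup, ← Set.image_univ]
  exact (Set.ncard_image_le Set.finite_univ).trans (by simp [Set.ncard_univ])

lemma nup_eq_iff_range_eq_univ {k : ℕ} (h : Fin k → ℕ) (p : ℕ) [NeZero p] :
    nup h p = p ↔ (Set.range fun i => (h i : ZMod p)) = Set.univ := by
  rw [nup, Set.eq_univ_iff_ncard, Nat.card_zmod]

lemma nup_eq_of_lt {k : ℕ} {h : Fin k → ℕ} (hinj : Function.Injective h) {p : ℕ}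
    (hp : ∀ i, h i < p) : nup h p = k := by
  have hinj' : Function.Injective fun i => (h i : ZMod p) := by
    intro i j hij
    have := (ZMod.natCast_eq_natCast_iff' _ _ _).1 hij
    rw [Nat.mod_eq_of_lt (hp i), Nat.mod_eq_of_lt (hp j)] at this
    exact hinj this
  rw [nup, ← Set.image_univ, Set.ncard_image_of_injective _ hinj']
  simp [Set.ncard_univ]

lemma singFactor_ne_zero_iff {k : ℕ} (h : Fin k → ℕ) {p : ℕ} (hp : p.Prime) :
    singFactor h p ≠ 0 ↔ nup h p ≠ p := by
  have hp0 : (p : ℝ) ≠ 0 := by exact_mod_cast hp.ne_zero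
  have hp1 : (p : ℝ) - 1 ≠ 0 := sub_ne_zero.2 (by exact_mod_cast hp.ne_one)
  have h1 : (1 - 1 / (p : ℝ)) ^ (-(k : ℤ)) ≠ 0 := by
    apply zpow_ne_zero
    rw [one_sub_div hp0]
    exact div_ne_zero hp1 hp0
  rw [singFactor, Ne, mul_eq_zero, or_iff_left h1, one_sub_div hp0, div_eq_zero_iff,
    or_iff_left hp0, sub_eq_zero, Nat.cast_inj, Ne, eq_comm]

lemma abs_one_sub_mul_sub_one_sub_pow_le {x : ℝ} (hx0 : 0 ≤ x) (hx1 : x ≤ 1) (k : ℕ) :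
    |(1 - k * x) - (1 - x) ^ k| ≤ k ^ 2 * x ^ 2 := by
  induction k with
  | zero => simp
  | succ k ih =>
    have hk : (1 - (k + 1 : ℕ) * x) - (1 - x) ^ (k + 1) =
        (1 - x) * ((1 - k * x) - (1 - x) ^ k) - k * x ^ 2 := by
      push_cast
      ring
    rw [hk]
    have hx : 0 ≤ k * x ^ 2 := by positivity
    refine (abs_sub _ _).trans ?_
    rw [abs_mul, abs_of_nonneg (sub_nonneg.2 hx1), abs_of_nonneg hx]
    have : (1 - x) * |(1 - k * x) - (1 - x) ^ k| ≤ 1 * (k ^ 2 * x ^ 2) := by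
      gcongr
      linarith
    push_cast
    nlinarith [sq_nonneg x]

lemma abs_singFactor_sub_one_le {k : ℕ} {h : Fin k → ℕ} (hinj : Function.Injective h) {p : ℕ}
    (hp : 2 ≤ p) (hhp : ∀ i, h i < p) :
    |singFactor h p - 1| ≤ k ^ 2 * 2 ^ k * ((p : ℝ) ^ 2)⁻¹ := by
  have hp' : (2 : ℝ) ≤ p := by exact_mod_cast hp
  set x : ℝ := 1 / p with hx
  have hx0 : 0 ≤ x := by positivity
  have hx2 : x ≤ 1 / 2 := one_div_le_one_div_of_le (by norm_num) hp'
  have hpos : 0 < (1 - x) ^ k := pow_pos (by linarith) k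
  have hinv : ((1 - x) ^ k)⁻¹ ≤ 2 ^ k := by
    rw [← inv_pow]
    refine pow_le_pow_left₀ (inv_nonneg.2 (by linarith)) ?_ k
    rw [inv_le_comm₀ (by linarith) (by norm_num)]
    linarith
  have heq : singFactor h p - 1 = ((1 - k * x) - (1 - x) ^ k) * ((1 - x) ^ k)⁻¹ := by
    rw [singFactor, nup_eq_of_lt hinj hhp, zpow_neg, zpow_natCast, ← hx, div_eq_mul_one_div (k : ℝ),
      ← hx, sub_mul _ ((1 - x) ^ k), mul_inv_cancel₀ hpos.ne']
  have hpx : ((p : ℝ) ^ 2)⁻¹ = x ^ 2 := by rw [hx]; simp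
  rw [heq, abs_mul, abs_of_pos (inv_pos.2 hpos), hpx]
  calc _ ≤ (k ^ 2 * x ^ 2) * 2 ^ k := by
        gcongr
        exact abs_one_sub_mul_sub_one_sub_pow_le hx0 (by linarith) k
    _ = _ := by ring

lemma summable_norm_singFactor_sub_one {k : ℕ} {h : Fin k → ℕ} (hinj : Function.Injective h) :
    Summable fun p : Nat.Primes => ‖singFactor h p - 1‖ := by
  have hs : Summable fun p : Nat.Primes => (k ^ 2 * 2 ^ k : ℝ) * (((p : ℕ) : ℝ) ^ 2)⁻¹ :=
    ((Real.summable_nat_pow_inv.2 one_lt_two).mul_left _).comp_injective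
      Nat.Primes.coe_nat_injective
  refine Summable.of_norm_bounded_eventually hs ?_
  have hfin : Tendsto (fun p : Nat.Primes => (p : ℕ)) cofinite atTop :=
    Nat.cofinite_eq_atTop ▸ Nat.Primes.coe_nat_injective.tendsto_cofinite
  filter_upwards [hfin.eventually_gt_atTop (∑ i, h i)] with p hp
  rw [norm_norm, Real.norm_eq_abs]
  exact abs_singFactor_sub_one_le hinj p.2.two_le fun i =>
    (Finset.single_le_sum (fun _ _ => Nat.zero_le _) (Finset.mem_univ i)).trans_lt hp

/-- For distinct entries, the singular series vanishes exactly when some local factor does. -/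
lemma singSeries_ne_zero_iff {k : ℕ} {h : Fin k → ℕ} (hinj : Function.Injective h) :
    singSeries h ≠ 0 ↔ ∀ p : Nat.Primes, nup h p ≠ p := by
  simp_rw [← fun p : Nat.Primes => singFactor_ne_zero_iff h p.2]
  constructor
  · intro hne p hp
    exact hne (tprod_of_exists_eq_zero ⟨p, hp⟩)
  · intro hne
    have := tprod_one_add_ne_zero_of_summable (f := fun p : Nat.Primes => singFactor h p - 1)
      (by simpa using hne) (summable_norm_singFactor_sub_one hinj)
    simpa [singSeries] using this

abbrev SmallPrimes (k : ℕ) : Type := {p // p ∈ (Finset.range (k + 1)).filter Nat.Prime}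

instance (k : ℕ) (p : SmallPrimes k) : Fact (p : ℕ).Prime := ⟨(Finset.mem_filter.1 p.2).2⟩

lemma singSeries_ne_zero_iff_forall_smallPrimes {k : ℕ} {h : Fin k → ℕ}
    (hinj : Function.Injective h) :
    singSeries h ≠ 0 ↔
      ∀ p : SmallPrimes k, (Set.range fun i => (h i : ZMod p)) ≠ Set.univ := by
  rw [singSeries_ne_zero_iff hinj]
  constructor
  · intro H p
    rw [Ne, ← nup_eq_iff_range_eq_univ]
    exact H ⟨p, (Finset.mem_filter.1 p.2).2⟩
  · intro H p
    rcases le_or_gt (p : ℕ) k with hpk | hpk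
    · have : NeZero (p : ℕ) := ⟨p.2.ne_zero⟩
      rw [Ne, nup_eq_iff_range_eq_univ]
      exact H ⟨p, Finset.mem_filter.2 ⟨Finset.mem_range.2 (by omega), p.2⟩⟩
    · exact ((nup_le h p).trans_lt hpk).ne

/-- The natural density of a residue class modulo `Q` is `1 / Q`. -/
lemma tendsto_card_natCast_eq_div (Q : ℕ) [NeZero Q] (a : ZMod Q) :
    Tendsto (fun H : ℕ => (((Finset.Icc 1 H).filter fun n : ℕ => (n : ZMod Q) = a).card : ℝ) / H)
      atTop (𝓝 (1 / Q)) := by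
  have hQ : 0 < Q := Nat.pos_of_ne_zero (NeZero.ne Q)
  have hQ' : (0 : ℚ) < Q := by exact_mod_cast hQ
  have hbound (H : ℕ) :
      |(((Finset.Icc 1 H).filter fun n : ℕ => (n : ZMod Q) = a).card : ℝ) - H / Q| ≤ 1 := by
    have hcard : (((Finset.Icc 1 H).filter fun n : ℕ => (n : ZMod Q) = a).card : ℤ) =
        max (⌊((H : ℕ) - (a.val : ℕ) : ℚ) / Q⌋ - ⌊((0 : ℕ) - (a.val : ℕ) : ℚ) / Q⌋) 0 := by
      rw [← Nat.Ioc_filter_modEq_card _ _ hQ]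
      congr 2
      ext n
      simp only [Finset.mem_filter, Finset.mem_Icc, Finset.mem_Ioc, Nat.succ_le_iff,
        ← ZMod.natCast_eq_natCast_iff, ZMod.natCast_zmod_val]
    rw [max_eq_left (sub_nonneg.2 (by gcongr; simp))] at hcard
    set c := ((Finset.Icc 1 H).filter fun n : ℕ => (n : ZMod Q) = a).card
    have h1 := Int.floor_le (((H : ℕ) - (a.val : ℕ) : ℚ) / Q)
    have h2 := Int.lt_floor_add_one (((H : ℕ) - (a.val : ℕ) : ℚ) / Q)
    have h3 := Int.floor_le (((0 : ℕ) - (a.val : ℕ) : ℚ) / Q)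
    have h4 := Int.lt_floor_add_one (((0 : ℕ) - (a.val : ℕ) : ℚ) / Q)
    have hc : (c : ℚ) = (⌊((H : ℕ) - (a.val : ℕ) : ℚ) / Q⌋ : ℚ) -
        (⌊((0 : ℕ) - (a.val : ℕ) : ℚ) / Q⌋ : ℚ) := by exact_mod_cast hcard
    have h5 : |(c : ℚ) - H / Q| ≤ 1 := by
      simp only [sub_div, Nat.cast_zero, zero_div] at h1 h2 h3 h4 hc
      rw [abs_le]
      constructor <;> linarith
    have h6 := (Rat.cast_le (K := ℝ)).2 h5
    push_cast at h6
    exact h6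
  rw [tendsto_iff_norm_sub_tendsto_zero]
  refine squeeze_zero' (.of_forall fun _ => norm_nonneg _) ?_ tendsto_one_div_atTop_nhds_zero_nat
  filter_upwards [eventually_gt_atTop 0] with H hH
  have hH' : (0 : ℝ) < H := by exact_mod_cast hH
  have hdiv (c : ℝ) : c / H - 1 / Q = (c - H / Q) / H := by field_simp
  rw [hdiv, norm_div, Real.norm_eq_abs, Real.norm_of_nonneg hH'.le]
  exact div_le_div_of_nonneg_right (hbound H) hH'.le

open Classical in
/-- If every fibre of `f : ℕ → R` has natural density `w`, then the tuples whose image under `f`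
lies in `G` have density `#G * w ^ k`. -/
lemma tendsto_card_tuples_div {R : Type*} [DecidableEq R] {f : ℕ → R} {w : ℝ}
    (hf : ∀ r, Tendsto (fun H : ℕ => (((Finset.Icc 1 H).filter fun n => f n = r).card : ℝ) / H)
      atTop (𝓝 w)) (k : ℕ) (G : Finset (Fin k → R)) :
    Tendsto (fun H : ℕ => (((Fintype.piFinset fun _ : Fin k => Finset.Icc 1 H).filter
      fun h => (fun i => f (h i)) ∈ G).card : ℝ) / (H : ℝ) ^ k) atTop (𝓝 (G.card * w ^ k)) := by
  have hcard (H : ℕ) : (((Fintype.piFinset fun _ : Fin k => Finset.Icc 1 H).filter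
      fun h => (fun i => f (h i)) ∈ G).card : ℝ) / (H : ℝ) ^ k =
      ∑ u ∈ G, ∏ i, (((Finset.Icc 1 H).filter fun n => f n = u i).card : ℝ) / H := by
    have hmaps : (((Fintype.piFinset fun _ : Fin k => Finset.Icc 1 H).filter
        fun h => (fun i => f (h i)) ∈ G : Finset (Fin k → ℕ)) : Set (Fin k → ℕ)).MapsTo
        (fun h i => f (h i)) G := fun h hh => (Finset.mem_filter.1 hh).2
    rw [Finset.card_eq_sum_card_fiberwise hmaps, Nat.cast_sum, Finset.sum_div]
    refine Finset.sum_congr rfl fun u hu => ?_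
    rw [Finset.prod_div_distrib, Finset.prod_const, Finset.card_univ, Fintype.card_fin,
      ← Nat.cast_prod, ← Fintype.card_piFinset]
    congr 3
    ext h
    simp only [Finset.mem_filter, Fintype.mem_piFinset]
    constructor
    · rintro ⟨⟨h1, -⟩, h2⟩ i
      exact ⟨h1 i, congrFun h2 i⟩
    · intro h1
      have h2 : (fun i => f (h i)) = u := funext fun i => (h1 i).2
      exact ⟨⟨fun i => (h1 i).1, h2 ▸ hu⟩, h2⟩
  simp_rw [hcard]
  have := tendsto_finsetSum G fun u _ =>
    tendsto_finsetProd (Finset.univ : Finset (Fin k)) fun i _ => hf (u i)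
  simpa using this

lemma card_distinctTuples (k H : ℕ) : (distinctTuples k H).card = H.descFactorial k := by
  have := Fintype.card_embedding_eq (α := Fin k) (β := Finset.Icc 1 H)
  simp only [Fintype.card_coe, Nat.card_Icc, Nat.add_sub_cancel, Fintype.card_fin] at this
  rw [← this, ← Fintype.card_coe]
  refine Fintype.card_congr ⟨fun h => ⟨fun i => ⟨h.1 i, ?_⟩, ?_⟩, fun e => ⟨fun i => e i, ?_⟩,
    fun _ => rfl, fun _ => rfl⟩
  · exact Fintype.mem_piFinset.1 (Finset.mem_filter.1 h.2).1 i
  · intro i j hij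
    exact (Finset.mem_filter.1 h.2).2 (congrArg Subtype.val hij)
  · exact Finset.mem_filter.2 ⟨Fintype.mem_piFinset.2 fun i => (e i).2,
      Subtype.val_injective.comp e.injective⟩

open Classical in
/-- Almost all tuples have distinct entries. -/
lemma tendsto_card_not_injective_div (k : ℕ) :
    Tendsto (fun H : ℕ => (((Fintype.piFinset fun _ : Fin k => Finset.Icc 1 H).filter
      fun h => ¬ Function.Injective h).card : ℝ) / (H : ℝ) ^ k) atTop (𝓝 0) := by
  have hone : Tendsto (fun H : ℕ => (H.descFactorial k : ℝ) / (H : ℝ) ^ k) atTop (𝓝 1) := by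
    refine (Asymptotics.isEquivalent_iff_tendsto_one ?_).1 (isEquivalent_descFactorial k)
    filter_upwards [eventually_gt_atTop 0] with H hH
    simp [hH.ne']
  have hsub := (tendsto_const_nhds (x := (1 : ℝ))).sub hone
  rw [sub_self] at hsub
  refine hsub.congr' ?_
  filter_upwards [eventually_gt_atTop 0] with H hH
  have hH' : (H : ℝ) ^ k ≠ 0 := by positivity
  have hsplit := Finset.card_filter_add_card_filter_not
    (s := Fintype.piFinset fun _ : Fin k => Finset.Icc 1 H) Function.Injective
  have hinj := card_distinctTuples k H
  rw [distinctTuples] at hinj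
  rw [hinj] at hsplit
  simp only [Fintype.card_piFinset_const, Nat.card_Icc, Nat.add_sub_cancel] at hsplit
  rw [eq_div_iff hH', sub_mul, div_mul_cancel₀ _ hH', one_mul, sub_eq_iff_eq_add', eq_comm]
  exact_mod_cast hsplit

lemma pairwise_coprime_smallPrimes (k : ℕ) :
    Pairwise (Function.onFun Nat.Coprime fun p : SmallPrimes k => (p : ℕ)) := fun p q hpq =>
  (Nat.coprime_primes (Fact.out : (p : ℕ).Prime) (Fact.out : (q : ℕ).Prime)).2
    fun h => hpq (Subtype.ext h)

open Classical in
/-- Joint residues modulo all primes `p ≤ k` are equidistributed. -/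
lemma tendsto_card_smallPrimes_residue_div (k : ℕ) (r : ∀ p : SmallPrimes k, ZMod p) :
    Tendsto (fun H : ℕ => (((Finset.Icc 1 H).filter
      fun n : ℕ => (fun p : SmallPrimes k => (n : ZMod p)) = r).card : ℝ) / H)
      atTop (𝓝 (1 / ∏ p : SmallPrimes k, (p : ℝ))) := by
  set e := ZMod.prodEquivPi (fun p : SmallPrimes k => (p : ℕ)) (pairwise_coprime_smallPrimes k)
  have : NeZero (∏ p : SmallPrimes k, (p : ℕ)) :=
    ⟨Finset.prod_ne_zero_iff.2 fun p _ => (Fact.out : (p : ℕ).Prime).ne_zero⟩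
  have h := tendsto_card_natCast_eq_div (∏ p : SmallPrimes k, (p : ℕ)) (e.symm r)
  rw [Nat.cast_prod] at h
  refine h.congr fun H => ?_
  congr! 4 with n
  rw [← e.eq_symm_apply.symm.eq, map_natCast]
  rfl

open Classical in
lemma card_tuples_smallPrimes (k : ℕ) :
    ((Finset.univ : Finset (Fin k → ∀ p : SmallPrimes k, ZMod p)).filter
      fun u => ∀ p, (Set.range fun i => u i p) ≠ Set.univ).card =
    ∏ p : SmallPrimes k, {u : Fin k → ZMod p | Set.range u ≠ Set.univ}.ncard := by
  simp_rw [Set.ncard_eq_toFinset_card', ← Fintype.card_piFinset]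
  refine Finset.card_equiv (Equiv.piComm _) fun u => ?_
  simp [Equiv.piComm]

open Classical in
/-- For fixed `k ≥ 1`, the density of `k`-tuples (of distinct positive integers) with
nonvanishing singular series exists and equals the finite Euler product over primes
`p ≤ k` of `p^(-k) · #{u ∈ (ℤ/pℤ)^k : {u_1,…,u_k} ≠ ℤ/pℤ}`. -/
theorem density_nonvanishing (k : ℕ) (hk : 1 ≤ k) :
    Tendsto
      (fun H : ℕ =>
        (((distinctTuples k H).filter (fun h => singSeries h ≠ 0)).card : ℝ) /
          (H : ℝ) ^ k)
      atTop
      (𝓝 (∏ p ∈ (Finset.range (k + 1)).filter Nat.Prime,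
        (p : ℝ) ^ (-(k : ℤ)) *
          ({u : Fin k → ZMod p | Set.range u ≠ Set.univ}.ncard : ℝ))) := by
  set G := (Finset.univ : Finset (Fin k → ∀ p : SmallPrimes k, ZMod p)).filter
      fun u => ∀ p, (Set.range fun i => u i p) ≠ Set.univ with hG
  have hlim : (∏ p ∈ (Finset.range (k + 1)).filter Nat.Prime, (p : ℝ) ^ (-(k : ℤ)) *
      ({u : Fin k → ZMod p | Set.range u ≠ Set.univ}.ncard : ℝ)) =
      G.card * (1 / ∏ p : SmallPrimes k, (p : ℝ)) ^ k := by
    rw [hG, card_tuples_smallPrimes, Nat.cast_prod, one_div, ← Finset.prod_inv_distrib,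
      ← Finset.prod_pow, ← Finset.prod_mul_distrib, ← Finset.prod_coe_sort]
    refine Finset.prod_congr rfl fun p _ => ?_
    rw [zpow_neg, zpow_natCast, inv_pow, mul_comm]
  rw [hlim]
  have hall := tendsto_card_tuples_div (tendsto_card_smallPrimes_residue_div k) k G
  have hlower := hall.sub (tendsto_card_not_injective_div k)
  rw [sub_zero] at hlower
  have hmem {h : Fin k → ℕ} (hinj : Function.Injective h) :
      singSeries h ≠ 0 ↔ (fun i (p : SmallPrimes k) => (h i : ZMod p)) ∈ G := by
    rw [singSeries_ne_zero_iff_forall_smallPrimes hinj, hG]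
    simp
  refine tendsto_of_tendsto_of_tendsto_of_le_of_le hlower hall (fun H => ?_) fun H => ?_
  · dsimp only
    rw [← sub_div]
    gcongr
    rw [sub_le_iff_le_add]
    norm_cast
    refine (Finset.card_le_card fun h hh => ?_).trans (Finset.card_union_le _ _)
    rw [Finset.mem_filter] at hh
    by_cases hinj : Function.Injective h
    · exact Finset.mem_union_left _ (Finset.mem_filter.2
        ⟨Finset.mem_filter.2 ⟨hh.1, hinj⟩, (hmem hinj).2 hh.2⟩)
    · exact Finset.mem_union_right _ (Finset.mem_filter.2 ⟨hh.1, hinj⟩)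
  · dsimp only
    gcongr
    intro h hh
    obtain ⟨hd, hne⟩ := Finset.mem_filter.1 hh
    obtain ⟨hd, hinj⟩ := Finset.mem_filter.1 hd
    exact Finset.mem_filter.2 ⟨hd, (hmem hinj).1 hne⟩
end
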